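/- Let n ≥ 2, let K be a compact polynomially convex set in ℂⁿ, let Ω ⊆ ℂⁿ be an open set containing K, and let Φ : [0,1] × Ω → ℂⁿ be continuous such that each Φ_t = Φ(t,·) : Ω → ℂⁿ is injective and holomorphic, Φ₀ is the identity on Ω, and the compact set K_t = Φ_t(K) is polynomially convex for every t ∈ [0,1]. Then for every ε > 0 there exists a holomorphic automorphism Ψ of ℂⁿ with ‖Ψ(z) − Φ₁(z)‖ < ε for all z ∈ K. -/

import Mathlib

noncomputable section

/-- The polynomial hull of a set K ⊆ ℂⁿ:
`K̂ = {z : |p(z)| ≤ sup_K |p| for every polynomial p}`. -/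
def polyHull {n : ℕ} (K : Set (EuclideanSpace ℂ (Fin n))) : Set (EuclideanSpace ℂ (Fin n)) :=
  {z | ∀ p : MvPolynomial (Fin n) ℂ, ∀ c : ℝ,
    (∀ w ∈ K, ‖MvPolynomial.eval (fun i => w i) p‖ ≤ c) →
      ‖MvPolynomial.eval (fun i => z i) p‖ ≤ c}

/-- A compact set is polynomially convex if it equals its polynomial hull. -/
def IsPolynomiallyConvex {n : ℕ} (K : Set (EuclideanSpace ℂ (Fin n))) : Prop :=
  polyHull K = K

/-- A holomorphic automorphism of ℂⁿ: a bijective entire map with entire inverse. -/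
def IsHolomorphicAutomorphism {n : ℕ}
    (F : EuclideanSpace ℂ (Fin n) → EuclideanSpace ℂ (Fin n)) : Prop :=
  Differentiable ℂ F ∧ ∃ G : EuclideanSpace ℂ (Fin n) → EuclideanSpace ℂ (Fin n),
    Differentiable ℂ G ∧ (∀ z, G (F z) = z) ∧ (∀ z, F (G z) = z)

namespace AndersenLempert

open Set Filter Topology Metric

section SeveralVariables

variable {E F : Type*} [NormedAddCommGroup E] [NormedSpace ℂ E] [NormedAddCommGroup F]
  [NormedSpace ℂ F]

/-- Cauchy's estimate for the Fréchet derivative. -/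
theorem norm_fderiv_le_of_differentiableOn_ball {f : E → F} {z : E} {r M : ℝ} (hr : 0 < r)
    (hf : DifferentiableOn ℂ f (ball z r)) (hM : ∀ w ∈ ball z r, ‖f w‖ ≤ M) :
    ‖fderiv ℂ f z‖ ≤ M / r := by
  have hM0 : 0 ≤ M := (norm_nonneg _).trans (hM z (mem_ball_self hr))
  refine ContinuousLinearMap.opNorm_le_bound _ (by positivity) fun v => ?_
  rcases eq_or_ne v 0 with rfl | hv
  · simp
  have hv' : 0 < ‖v‖ := norm_pos_iff.2 hv
  have hdz : DifferentiableAt ℂ f z := hf.differentiableAt (isOpen_ball.mem_nhds (mem_ball_self hr))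
  have hline : ∀ t : ℂ, HasDerivAt (fun t : ℂ => z + t • v) v t := fun t => by
    simpa using ((hasDerivAt_id t).smul_const v).const_add z
  have hderiv : deriv (fun t : ℂ => f (z + t • v)) 0 = fderiv ℂ f z v := by
    have h1 : HasFDerivAt f (fderiv ℂ f z) (z + (0 : ℂ) • v) := by simpa using hdz.hasFDerivAt
    exact (h1.comp_hasDerivAt (0 : ℂ) (hline 0)).deriv
  have key : ∀ s : ℝ, 0 < s → s < r / ‖v‖ → ‖fderiv ℂ f z v‖ * s ≤ M := by
    intro s hs hsr
    have hmem : ∀ t ∈ closedBall (0 : ℂ) s, z + t • v ∈ ball z r := by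
      intro t ht
      rw [mem_closedBall_zero_iff] at ht
      rw [mem_ball_iff_norm, add_sub_cancel_left, norm_smul]
      calc ‖t‖ * ‖v‖ ≤ s * ‖v‖ := by gcongr
        _ < r := (lt_div_iff₀ hv').1 hsr
    have hdiff : DifferentiableOn ℂ (fun t : ℂ => f (z + t • v)) (closedBall 0 s) := fun t ht =>
      ((hf.differentiableAt (isOpen_ball.mem_nhds (hmem t ht))).comp t
        (hline t).differentiableAt).differentiableWithinAt
    have := Complex.norm_deriv_le_of_forall_mem_sphere_norm_le (c := 0) (C := M) hs
      (DifferentiableOn.diffContOnCl (by rwa [closure_ball _ hs.ne'])) fun t ht =>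
        hM _ (hmem t (sphere_subset_closedBall ht))
    rw [hderiv] at this
    exact (le_div_iff₀ hs).1 this
  have hpos : 0 < r / ‖v‖ := by positivity
  have hlim : ‖fderiv ℂ f z v‖ * (r / ‖v‖) ≤ M := by
    have h1 : Tendsto (fun s : ℝ => ‖fderiv ℂ f z v‖ * s) (𝓝[<] (r / ‖v‖))
        (𝓝 (‖fderiv ℂ f z v‖ * (r / ‖v‖))) :=
      (tendsto_id.const_mul _).mono_left nhdsWithin_le_nhds
    refine le_of_tendsto h1 ?_
    filter_upwards [Ioo_mem_nhdsLT hpos] with s hs using key s hs.1 hs.2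
  rw [div_mul_eq_mul_div, le_div_iff₀ hr]
  rw [mul_div_assoc', div_le_iff₀ hv'] at hlim
  exact hlim

theorem differentiableOn_fderiv_apply [FiniteDimensional ℂ E] [FiniteDimensional ℂ F] {f : E → F}
    {U : Set E} (hU : IsOpen U) (hf : DifferentiableOn ℂ f U) (v : E) :
    DifferentiableOn ℂ (fun z => fderiv ℂ f z v) U := by
  have _ : CompleteSpace F := FiniteDimensional.complete ℂ F
  intro z₀ hz₀
  refine DifferentiableAt.differentiableWithinAt ?_
  have hcont : ContinuousAt f z₀ := (hf.differentiableAt (hU.mem_nhds hz₀)).continuousAt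
  obtain ⟨ε, hε, hball⟩ : ∃ ε > 0, ball z₀ ε ⊆ U ∩ {z | ‖f z‖ < ‖f z₀‖ + 1} := by
    refine Metric.mem_nhds_iff.1 (inter_mem (hU.mem_nhds hz₀) ?_)
    exact hcont.norm.eventually (gt_mem_nhds (by linarith))
  set M := ‖f z₀‖ + 1
  have hbd : ∀ z ∈ ball z₀ (ε / 2), ‖fderiv ℂ f z‖ ≤ M / (ε / 2) := by
    intro z hz
    have hsub : ball z (ε / 2) ⊆ ball z₀ ε := by
      refine ball_subset_ball' ?_
      rw [mem_ball] at hz; linarith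
    exact norm_fderiv_le_of_differentiableOn_ball (by positivity)
      (hf.mono fun w hw => (hball (hsub hw)).1) fun w hw => (hball (hsub hw)).2.le
  set ρ := ε / (4 * (‖v‖ + 1)) with hρdef
  have hρ : 0 < ρ := by positivity
  have hρv : ρ * ‖v‖ ≤ ε / 4 := by
    rw [hρdef, div_mul_eq_mul_div, div_le_div_iff₀ (by positivity) (by norm_num)]
    nlinarith [norm_nonneg v]
  have hmem : ∀ z ∈ ball z₀ (ε / 4), ∀ t : ℂ, ‖t‖ ≤ ρ → z + t • v ∈ ball z₀ (ε / 2) := by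
    intro z hz t ht
    rw [mem_ball_iff_norm] at hz ⊢
    have h1 : ‖t • v‖ ≤ ε / 4 := by
      rw [norm_smul]; exact (mul_le_mul_of_nonneg_right ht (norm_nonneg v)).trans hρv
    calc ‖z + t • v - z₀‖ = ‖(z - z₀) + t • v‖ := by congr 1; abel
      _ ≤ ‖z - z₀‖ + ‖t • v‖ := norm_add_le _ _
      _ < ε / 2 := by linarith
  have hsub2 : ball z₀ (ε / 2) ⊆ U := fun w hw => (hball (ball_subset_ball (by linarith) hw)).1
  have hdiffAt : ∀ z ∈ ball z₀ (ε / 2), DifferentiableAt ℂ f z := fun z hz =>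
    hf.differentiableAt (hU.mem_nhds (hsub2 hz))
  have hline : ∀ (z : E) (t : ℂ), HasDerivAt (fun t : ℂ => z + t • v) v t := fun z t => by
    simpa using ((hasDerivAt_id t).smul_const v).const_add z
  have hrep : ∀ z ∈ ball z₀ (ε / 4), fderiv ℂ f z v =
      (2 * ↑Real.pi * Complex.I)⁻¹ • ∮ t in C(0, ρ), ((t - 0) ^ 2)⁻¹ • f (z + t • v) := by
    intro z hz
    have hopen : IsOpen ((fun t : ℂ => z + t • v) ⁻¹' ball z₀ (ε / 2)) :=
      isOpen_ball.preimage (by fun_prop)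
    rw [Complex.two_pi_I_inv_smul_circleIntegral_sub_sq_inv_smul_of_differentiable
      (f := fun t : ℂ => f (z + t • v)) hopen (c := 0) (R := ρ)
      (fun t ht => hmem z hz t (by simpa using ht))
      (fun t ht => ((hdiffAt _ ht).comp t (hline z t).differentiableAt).differentiableWithinAt)
      (mem_ball_self hρ)]
    have hz2 : z ∈ ball z₀ (ε / 2) := ball_subset_ball (by linarith) hz
    have h1 : HasFDerivAt f (fderiv ℂ f z) (z + (0 : ℂ) • v) := by
      simpa using (hdiffAt z hz2).hasFDerivAt
    exact (h1.comp_hasDerivAt (0 : ℂ) (hline z 0)).deriv.symm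
  have hnhds : ball z₀ (ε / 4) ∈ 𝓝 z₀ := ball_mem_nhds _ (by positivity)
  refine DifferentiableAt.congr_of_eventuallyEq ?_ (eventually_of_mem hnhds hrep)
  refine DifferentiableAt.const_smul ?_ _
  have hcm : ∀ θ : ℝ, ‖circleMap 0 ρ θ‖ = ρ := fun θ => by simp [hρ.le]
  have hcontz : ∀ z ∈ ball z₀ (ε / 4), Continuous fun θ : ℝ => deriv (circleMap 0 ρ) θ •
      ((circleMap 0 ρ θ - 0) ^ 2)⁻¹ • f (z + circleMap 0 ρ θ • v) := by
    intro z hz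
    have hne : ∀ θ, (circleMap 0 ρ θ - 0) ^ 2 ≠ 0 := fun θ => by
      simpa using (hρ.ne')
    have h1 : Continuous fun θ : ℝ => f (z + circleMap 0 ρ θ • v) := by
      rw [continuous_iff_continuousAt]
      intro θ
      exact ContinuousAt.comp (f := fun θ : ℝ => z + circleMap 0 ρ θ • v)
        (hdiffAt _ (hmem z hz _ (hcm θ).le)).continuousAt (by fun_prop)
    have h2 : Continuous fun θ : ℝ => ((circleMap 0 ρ θ - 0) ^ 2)⁻¹ :=
      Continuous.inv₀ (by fun_prop) hne
    simp only [deriv_circleMap]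
    exact ((by fun_prop : Continuous fun θ => circleMap 0 ρ θ * Complex.I)).smul (h2.smul h1)
  let _ : MeasurableSpace E := borel E
  have _ : BorelSpace E := ⟨rfl⟩
  have _ : ProperSpace (E →L[ℂ] F) := FiniteDimensional.proper ℂ _
  let _ : MeasurableSpace (E →L[ℂ] F) := borel _
  have _ : BorelSpace (E →L[ℂ] F) := ⟨rfl⟩
  simp only [circleIntegral]
  have hz₀' : z₀ ∈ ball z₀ (ε / 4) := mem_of_mem_nhds hnhds
  refine (intervalIntegral.hasFDerivAt_integral_of_dominated_of_fderiv_le (𝕜 := ℂ)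
    (F' := fun z θ => deriv (circleMap 0 ρ) θ •
      ((circleMap 0 ρ θ - 0) ^ 2)⁻¹ • fderiv ℂ f (z + circleMap 0 ρ θ • v))
    (bound := fun _ => ρ * ((ρ ^ 2)⁻¹ * (M / (ε / 2))))
    hnhds ?_ ?_ ?_ ?_ ?_ ?_).differentiableAt
  · filter_upwards [hnhds] with z hz using (hcontz z hz).aestronglyMeasurable
  · exact (hcontz z₀ hz₀').intervalIntegrable _ _
  · simp only [deriv_circleMap]
    have h1 : MeasureTheory.StronglyMeasurable
        fun θ : ℝ => fderiv ℂ f (z₀ + circleMap 0 ρ θ • v) :=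
      ((measurable_fderiv ℂ f).comp (by fun_prop : Continuous fun θ : ℝ =>
        z₀ + circleMap 0 ρ θ • v).measurable).stronglyMeasurable
    have hne : ∀ θ, (circleMap 0 ρ θ - 0) ^ 2 ≠ 0 := fun θ => by
      simpa using (hρ.ne')
    have h2 : Continuous fun θ : ℝ => ((circleMap 0 ρ θ - 0) ^ 2)⁻¹ :=
      Continuous.inv₀ (by fun_prop) hne
    have h3 : Continuous fun θ : ℝ => circleMap 0 ρ θ * Complex.I := by fun_prop
    exact (h3.stronglyMeasurable.smul (h2.stronglyMeasurable.smul h1)).aestronglyMeasurable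
  · refine Eventually.of_forall fun θ _ z hz => ?_
    rw [norm_smul, norm_smul, deriv_circleMap, norm_mul, hcm, Complex.norm_I, mul_one, norm_inv,
      norm_pow, sub_zero, hcm]
    have := hbd _ (hmem z hz _ (hcm θ).le)
    gcongr
  · exact intervalIntegrable_const
  · refine Eventually.of_forall fun θ _ z hz => ?_
    refine HasFDerivAt.const_smul (HasFDerivAt.const_smul ?_ _) _
    exact (hdiffAt _ (hmem z hz _ (hcm θ).le)).hasFDerivAt.comp z
      ((hasFDerivAt_id z).add_const _)

theorem contDiffOn_of_differentiableOn [FiniteDimensional ℂ E] [FiniteDimensional ℂ F]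
    {U : Set E} (hU : IsOpen U) (n : ℕ) {f : E → F} (hf : DifferentiableOn ℂ f U) :
    ContDiffOn ℂ n f U := by
  induction n generalizing f with
  | zero => exact contDiffOn_zero.2 hf.continuousOn
  | succ n ih =>
    push_cast
    rw [contDiffOn_succ_iff_fderiv_of_isOpen hU]
    refine ⟨hf, fun h => absurd h (by simp), ?_⟩
    rw [contDiffOn_clm_apply]
    exact fun v => ih (differentiableOn_fderiv_apply hU hf v)

theorem norm_iteratedFDeriv_le [FiniteDimensional ℂ E] [FiniteDimensional ℂ F] {f : E → F}
    {z : E} {r δ M : ℝ} (hδ : 0 < δ) (hf : DifferentiableOn ℂ f (ball z r))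
    (hM : ∀ w ∈ ball z r, ‖f w‖ ≤ M) (k : ℕ) :
    ∀ w ∈ ball z (r - k * δ), ‖iteratedFDeriv ℂ k f w‖ ≤ M * (δ⁻¹) ^ k := by
  induction k with
  | zero => simpa using hM
  | succ k ih =>
    intro w hw
    have hsub : ball w δ ⊆ ball z (r - k * δ) := by
      refine ball_subset_ball' ?_
      rw [mem_ball] at hw; push_cast at hw; linarith
    have hsub' : ball z (r - k * δ) ⊆ ball z r := ball_subset_ball (by nlinarith)
    have hd : DifferentiableOn ℂ (iteratedFDeriv ℂ k f) (ball z r) := by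
      have h1 := (contDiffOn_of_differentiableOn isOpen_ball (k + 1) hf)
      intro x hx
      exact ((h1.contDiffAt (isOpen_ball.mem_nhds hx)).differentiableAt_iteratedFDeriv
        (by exact_mod_cast Nat.lt_succ_self k)).differentiableWithinAt
    rw [← norm_fderiv_iteratedFDeriv]
    have := norm_fderiv_le_of_differentiableOn_ball hδ (hd.mono (hsub.trans hsub'))
      fun x hx => ih x (hsub hx)
    rw [pow_succ, ← mul_assoc, ← div_eq_mul_inv]
    exact this

theorem differentiableOn_iteratedFDeriv [FiniteDimensional ℂ E] [FiniteDimensional ℂ F]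
    {f : E → F} {U : Set E} (hU : IsOpen U) (hf : DifferentiableOn ℂ f U) (k : ℕ) :
    DifferentiableOn ℂ (iteratedFDeriv ℂ k f) U := fun _ hx =>
  (((contDiffOn_of_differentiableOn hU (k + 1) hf).contDiffAt
    (hU.mem_nhds hx)).differentiableAt_iteratedFDeriv
      (by exact_mod_cast Nat.lt_succ_self k)).differentiableWithinAt

theorem iteratedDeriv_comp_line [FiniteDimensional ℂ E] [FiniteDimensional ℂ F]
    {f : E → F} {U : Set E} (hU : IsOpen U) (hf : DifferentiableOn ℂ f U) (z y : E) (k : ℕ) :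
    ∀ t : ℂ, z + t • y ∈ U →
      iteratedDeriv k (fun t : ℂ => f (z + t • y)) t =
        iteratedFDeriv ℂ k f (z + t • y) fun _ => y := by
  have hline : ∀ t : ℂ, HasDerivAt (fun t : ℂ => z + t • y) y t := fun t => by
    simpa using ((hasDerivAt_id t).smul_const y).const_add z
  induction k with
  | zero => intro t _; simp
  | succ k ih =>
    intro t ht
    have hopen : IsOpen ((fun t : ℂ => z + t • y) ⁻¹' U) := hU.preimage (by fun_prop)
    have hev : iteratedDeriv k (fun t : ℂ => f (z + t • y)) =ᶠ[𝓝 t]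
        fun t => iteratedFDeriv ℂ k f (z + t • y) fun _ => y := by
      filter_upwards [hopen.mem_nhds ht] with s hs using ih s hs
    rw [iteratedDeriv_succ, hev.deriv_eq, iteratedFDeriv_succ_apply_left]
    have h1 : HasFDerivAt (iteratedFDeriv ℂ k f)
        (fderiv ℂ (iteratedFDeriv ℂ k f) (z + t • y)) (z + t • y) :=
      ((differentiableOn_iteratedFDeriv hU hf k).differentiableAt (hU.mem_nhds ht)).hasFDerivAt
    have h2 := h1.comp_hasDerivAt t (hline t)
    have h3 := ((ContinuousMultilinearMap.apply ℂ (fun _ : Fin k => E) F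
      fun _ => y).hasFDerivAt).comp_hasDerivAt t h2
    exact h3.deriv

theorem hasFPowerSeriesOnBall_of_differentiableOn [FiniteDimensional ℂ E]
    [FiniteDimensional ℂ F] {f : E → F} {z : E} {r M : ℝ} (hr : 0 < r)
    (hf : DifferentiableOn ℂ f (ball z r)) (hM : ∀ w ∈ ball z r, ‖f w‖ ≤ M) :
    HasFPowerSeriesOnBall f (fun k => ((k.factorial : ℂ))⁻¹ • iteratedFDeriv ℂ k f z) z
      (ENNReal.ofReal (r / 3)) := by
  have _ : CompleteSpace F := FiniteDimensional.complete ℂ F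
  have hM0 : 0 ≤ M := (norm_nonneg _).trans (hM z (mem_ball_self hr))
  refine ⟨?_, by simpa using hr, ?_⟩
  · refine FormalMultilinearSeries.le_radius_of_bound _ (M * Real.exp 1) fun k => ?_
    rw [Real.coe_toNNReal _ (by positivity)]
    have h1 := norm_iteratedFDeriv_le (δ := r / (k + 1)) (by positivity) hf hM k z (by
      refine mem_ball_self ?_
      rw [sub_pos, mul_div_assoc', div_lt_iff₀ (by positivity)]
      nlinarith)
    have h2 := Real.pow_div_factorial_le_exp ((k : ℝ) + 1) (by positivity) k
    have hk : (0 : ℝ) < k.factorial := by exact_mod_cast k.factorial_pos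
    have h3 : ‖((k.factorial : ℂ))⁻¹‖ = ((k.factorial : ℝ))⁻¹ := by simp
    have h4 : Real.exp ((k : ℝ) + 1) ≤ Real.exp 1 * 3 ^ k := by
      rw [Real.exp_add, mul_comm, ← Real.exp_one_pow]
      have := Real.exp_one_lt_three.le
      gcongr
    rw [norm_smul, h3]
    calc ((k.factorial : ℝ))⁻¹ * ‖iteratedFDeriv ℂ k f z‖ * (r / 3) ^ k
        ≤ ((k.factorial : ℝ))⁻¹ * (M * ((r / (k + 1))⁻¹) ^ k) * (r / 3) ^ k := by gcongr
      _ = M * (((k : ℝ) + 1) ^ k / k.factorial) / 3 ^ k := by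
        rw [inv_div, div_pow, div_pow]
        field_simp
      _ ≤ M * (Real.exp 1 * 3 ^ k) / 3 ^ k := by
        have := h2.trans h4
        gcongr
      _ = M * Real.exp 1 := by field_simp
  · intro y hy
    rw [Metric.mem_eball, edist_zero_right, ← ofReal_norm,
      ENNReal.ofReal_lt_ofReal_iff (by positivity)] at hy
    have hmem : ∀ t ∈ ball (0 : ℂ) 2, z + t • y ∈ ball z r := by
      intro t ht
      rw [mem_ball_zero_iff] at ht
      rw [mem_ball_iff_norm, add_sub_cancel_left, norm_smul]
      nlinarith [norm_nonneg y, norm_nonneg t]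
    have hdiff : DifferentiableOn ℂ (fun t : ℂ => f (z + t • y)) (ball 0 2) := fun t ht =>
      ((hf.differentiableAt (isOpen_ball.mem_nhds (hmem t ht))).comp t
        (f := fun t : ℂ => z + t • y) (by fun_prop)).differentiableWithinAt
    have h := Complex.hasSum_taylorSeries_on_ball hdiff (z := 1) (by simp)
    rw [one_smul] at h
    convert h using 2 with k
    rw [iteratedDeriv_comp_line isOpen_ball hf z y k 0 (by simpa using hr)]
    simp

theorem analyticAt_of_eventually_differentiableAt [FiniteDimensional ℂ E]
    [FiniteDimensional ℂ F] {f : E → F} {z : E} (hf : ∀ᶠ w in 𝓝 z, DifferentiableAt ℂ f w) :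
    AnalyticAt ℂ f z := by
  have hcont : ContinuousAt f z := hf.self_of_nhds.continuousAt
  obtain ⟨ε, hε, hball⟩ := Metric.mem_nhds_iff.1
    (hf.and (hcont.norm.eventually (gt_mem_nhds (lt_add_one ‖f z‖))))
  exact ⟨_, _, hasFPowerSeriesOnBall_of_differentiableOn hε
    (fun w hw => (hball hw).1.differentiableWithinAt) fun w hw => (hball hw).2.le⟩

theorem analyticOnNhd_of_differentiableOn [FiniteDimensional ℂ E]
    [FiniteDimensional ℂ F] {f : E → F} {U : Set E} (hU : IsOpen U)
    (hf : DifferentiableOn ℂ f U) : AnalyticOnNhd ℂ f U := fun z hz =>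
  analyticAt_of_eventually_differentiableAt <| by
    filter_upwards [hU.mem_nhds hz] with w hw using hf.differentiableAt (hU.mem_nhds hw)

/-- Integrals of jointly holomorphic functions depend holomorphically on the parameter. -/
theorem analyticAt_intervalIntegral [FiniteDimensional ℂ E] [FiniteDimensional ℂ F]
    {K : E × ℂ → F} {z₀ : E} {α β : ℝ} (hK : ∀ s ∈ uIcc α β, AnalyticAt ℂ K (z₀, (s : ℂ))) :
    AnalyticAt ℂ (fun z => ∫ s in α..β, K (z, (s : ℂ))) z₀ := by
  have hO : IsOpen {x | AnalyticAt ℂ K x} := isOpen_analyticAt ℂ K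
  set S : Set ℂ := (fun s : ℝ => (s : ℂ)) '' uIcc α β with hS
  have hScomp : IsCompact S := isCompact_uIcc.image Complex.continuous_ofReal
  obtain ⟨U, V, hU, hV, hzU, hSV, hUV⟩ := generalized_tube_lemma isCompact_singleton hScomp hO
    (s := {z₀}) (by rintro ⟨z, w⟩ ⟨hz, s, hs, hw⟩
                    simp only [mem_singleton_iff] at hz hw
                    subst hz; subst hw; exact hK s hs)
  have hzU' : z₀ ∈ U := hzU rfl
  have han : ∀ z ∈ U, ∀ s ∈ uIcc α β, AnalyticAt ℂ K (z, (s : ℂ)) := fun z hz s hs =>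
    hUV ⟨hz, hSV ⟨s, hs, rfl⟩⟩
  refine analyticAt_of_eventually_differentiableAt ?_
  filter_upwards [hU.mem_nhds hzU'] with z₁ hz₁
  have _ : ProperSpace E := FiniteDimensional.proper ℂ E
  have _ : CompleteSpace F := FiniteDimensional.complete ℂ F
  obtain ⟨ε, hε, hball⟩ := Metric.nhds_basis_closedBall.mem_iff.1 (hU.mem_nhds hz₁)
  have hcomp : IsCompact (closedBall z₁ ε ×ˢ S) := (isCompact_closedBall z₁ ε).prod hScomp
  have hfd : ContinuousOn (fun x => fderiv ℂ K x) (closedBall z₁ ε ×ˢ S) := by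
    rintro ⟨z, w⟩ ⟨hz, s, hs, rfl⟩
    exact (han z (hball hz) s hs).fderiv.continuousAt.continuousWithinAt
  obtain ⟨C, hC⟩ := hcomp.exists_bound_of_continuousOn hfd
  have hFcont : ∀ z ∈ U, ContinuousOn (fun s : ℝ => K (z, (s : ℂ))) (uIcc α β) := fun z hz s hs =>
    (ContinuousAt.comp (f := fun s : ℝ => (z, (s : ℂ))) (han z hz s hs).continuousAt
      (by fun_prop)).continuousWithinAt
  have hF'cont : ContinuousOn (fun s : ℝ => (fderiv ℂ K (z₁, (s : ℂ))).comp
      (ContinuousLinearMap.inl ℂ E ℂ)) (uIcc α β) := by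
    intro s hs
    refine ContinuousAt.continuousWithinAt ?_
    have : ContinuousAt (fun s : ℝ => fderiv ℂ K (z₁, (s : ℂ))) s :=
      ContinuousAt.comp (f := fun s : ℝ => (z₁, (s : ℂ)))
        (han z₁ hz₁ s hs).fderiv.continuousAt (by fun_prop)
    exact this.clm_comp continuousAt_const
  refine (intervalIntegral.hasFDerivAt_integral_of_dominated_of_fderiv_le (𝕜 := ℂ)
    (F' := fun z s => (fderiv ℂ K (z, (s : ℂ))).comp (ContinuousLinearMap.inl ℂ E ℂ))
    (bound := fun _ => C * ‖ContinuousLinearMap.inl ℂ E ℂ‖)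
    (closedBall_mem_nhds z₁ hε) ?_ ?_ ?_ ?_ ?_ ?_).differentiableAt
  · filter_upwards [hU.mem_nhds hz₁] with z hz
    exact ((hFcont z hz).mono uIoc_subset_uIcc).aestronglyMeasurable measurableSet_uIoc
  · exact (hFcont z₁ hz₁).intervalIntegrable
  · exact (hF'cont.mono uIoc_subset_uIcc).aestronglyMeasurable measurableSet_uIoc
  · refine Eventually.of_forall fun s hs z hz => ?_
    refine (ContinuousLinearMap.opNorm_comp_le _ _).trans ?_
    gcongr
    exact hC _ ⟨hz, s, uIoc_subset_uIcc hs, rfl⟩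
  · exact intervalIntegrable_const
  · refine Eventually.of_forall fun s hs z hz => ?_
    exact (han z (hball hz) s (uIoc_subset_uIcc hs)).differentiableAt.hasFDerivAt.comp z
      (hasFDerivAt_prodMk_left z (s : ℂ))

end SeveralVariables

section PolynomialFunctions

variable {ι : Type*}

/-- A function on `ℂ^ι` given by a polynomial. -/
def IsPolynomialFun (g : (ι → ℂ) → ℂ) : Prop :=
  ∃ P : MvPolynomial ι ℂ, ∀ z, g z = MvPolynomial.eval z P

theorem IsPolynomialFun.add {f g : (ι → ℂ) → ℂ} (hf : IsPolynomialFun f)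
    (hg : IsPolynomialFun g) : IsPolynomialFun fun z => f z + g z := by
  obtain ⟨P, hP⟩ := hf
  obtain ⟨Q, hQ⟩ := hg
  exact ⟨P + Q, fun z => by simp [hP, hQ]⟩

theorem IsPolynomialFun.mul {f g : (ι → ℂ) → ℂ} (hf : IsPolynomialFun f)
    (hg : IsPolynomialFun g) : IsPolynomialFun fun z => f z * g z := by
  obtain ⟨P, hP⟩ := hf
  obtain ⟨Q, hQ⟩ := hg
  exact ⟨P * Q, fun z => by simp [hP, hQ]⟩

theorem isPolynomialFun_const (c : ℂ) : IsPolynomialFun fun _ : ι → ℂ => c :=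
  ⟨MvPolynomial.C c, fun z => by simp⟩

theorem isPolynomialFun_coord (i : ι) : IsPolynomialFun fun z : ι → ℂ => z i :=
  ⟨MvPolynomial.X i, fun z => by simp⟩

theorem IsPolynomialFun.sum {κ : Type*} (s : Finset κ) {f : κ → (ι → ℂ) → ℂ}
    (hf : ∀ k ∈ s, IsPolynomialFun (f k)) : IsPolynomialFun fun z => ∑ k ∈ s, f k z := by
  classical
  induction s using Finset.induction_on with
  | empty => simpa using isPolynomialFun_const 0
  | insert k s hk ih =>
    simp only [Finset.sum_insert hk]
    exact (hf k (by simp)).add (ih fun j hj => hf j (by simp [hj]))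

theorem IsPolynomialFun.comp {κ : Type*} {f : (ι → ℂ) → ℂ} (hf : IsPolynomialFun f)
    {g : ι → (κ → ℂ) → ℂ} (hg : ∀ i, IsPolynomialFun (g i)) :
    IsPolynomialFun fun z => f fun i => g i z := by
  obtain ⟨P, hP⟩ := hf
  choose Q hQ using hg
  refine ⟨MvPolynomial.bind₁ Q P, fun z => ?_⟩
  have h : (fun i => g i z) = fun i => MvPolynomial.eval z (Q i) := funext fun i => hQ i z
  change f (fun i => g i z) = _
  rw [hP, h]
  rw [← MvPolynomial.coe_aeval_eq_eval, ← MvPolynomial.coe_aeval_eq_eval, RingHom.coe_coe,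
    RingHom.coe_coe, MvPolynomial.aeval_bind₁]

theorem IsPolynomialFun.differentiable [Finite ι] {f : (ι → ℂ) → ℂ} (hf : IsPolynomialFun f) :
    Differentiable ℂ f := by
  have := Fintype.ofFinite ι
  obtain ⟨P, hP⟩ := hf
  obtain rfl : f = fun z => MvPolynomial.eval z P := funext hP
  induction P using MvPolynomial.induction_on with
  | C a => simp
  | add p q hp hq =>
    simp only [map_add]
    exact (hp fun _ => rfl).add (hq fun _ => rfl)
  | mul_X p i hp =>
    simp only [map_mul, MvPolynomial.eval_X]
    exact (hp fun _ => rfl).mul (differentiable_apply i)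

theorem isPolynomialFun_multilinear_diagonal [Fintype ι] (k : ℕ)
    (p : ContinuousMultilinearMap ℂ (fun _ : Fin k => ι → ℂ) ℂ) :
    IsPolynomialFun fun z => p fun _ => z := by
  classical
  induction k with
  | zero =>
    refine ⟨MvPolynomial.C (p 0), fun z => ?_⟩
    rw [MvPolynomial.eval_C]
    exact congrArg p (funext fun i => i.elim0)
  | succ k ih =>
    have h : ∀ z : ι → ℂ, p (fun _ => z) =
        ∑ i, z i * p.curryLeft (Pi.single i 1) fun _ => z := by
      intro z
      have h1 : p (fun _ => z) = p.curryLeft z fun _ => z := by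
        rw [ContinuousMultilinearMap.curryLeft_apply]
        congr 1
        ext j : 1
        refine Fin.cases ?_ (fun j => ?_) j <;> simp
      have h2 : z = ∑ i, z i • (Pi.single i (1 : ℂ) : ι → ℂ) := by
        simpa using (pi_eq_sum_univ' z)
      have h3 : p.curryLeft z =
          ∑ i, z i • p.curryLeft (Pi.single i (1 : ℂ) : ι → ℂ) := by
        conv_lhs => rw [h2, map_sum]
        simp only [map_smul]
      rw [h1, h3]
      simp
    simp only [h]
    exact IsPolynomialFun.sum _ fun i _ => (isPolynomialFun_coord i).mul (ih _)

/-- Holomorphic functions near a polydisc are limits of polynomials on smaller polydiscs. -/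
theorem exists_polynomial_approx_on_ball [Fintype ι] {f : (ι → ℂ) → ℂ} {R : ℝ} (hR : 0 < R)
    (hf : AnalyticOnNhd ℂ f (closedBall 0 R)) {ε : ℝ} (hε : 0 < ε) :
    ∃ q : (ι → ℂ) → ℂ, IsPolynomialFun q ∧ ∀ z ∈ closedBall 0 (R / 4), ‖f z - q z‖ < ε := by
  obtain ⟨M, hM⟩ := (isCompact_closedBall (0 : ι → ℂ) R).exists_bound_of_continuousOn
    hf.continuousOn
  set S : FormalMultilinearSeries ℂ (ι → ℂ) ℂ := fun k =>
    ((k.factorial : ℂ))⁻¹ • iteratedFDeriv ℂ k f 0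
  have h : HasFPowerSeriesOnBall f S 0 _ := hasFPowerSeriesOnBall_of_differentiableOn hR
    (hf.differentiableOn.mono ball_subset_closedBall) fun w hw => hM w (ball_subset_closedBall hw)
  have h2 := h.tendstoUniformlyOn (r' := (R / 3.5).toNNReal) (by
    rw [← ENNReal.ofReal]
    rw [ENNReal.ofReal_lt_ofReal_iff (by positivity)]
    exact div_lt_div_of_pos_left hR (by norm_num) (by norm_num))
  obtain ⟨n, hn⟩ := (Metric.tendstoUniformlyOn_iff.1 h2 ε hε).exists
  refine ⟨fun z => S.partialSum n z, ?_, fun z hz => ?_⟩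
  rotate_left
  · have := hn z (by
      rw [mem_ball_zero_iff, Real.coe_toNNReal _ (by positivity)]
      rw [mem_closedBall_zero_iff] at hz
      exact hz.trans_lt (div_lt_div_of_pos_left hR (by norm_num) (by norm_num)))
    rw [zero_add, dist_eq_norm] at this
    exact this
  · exact IsPolynomialFun.sum _ fun k _ => isPolynomialFun_multilinear_diagonal k _

end PolynomialFunctions

section Rectangle

open Complex

/-- The integral of `g` over the positively oriented boundary of `[α, β] × [c, d]`. -/
def rectIntegral (g : ℂ → ℂ) (α β c d : ℝ) : ℂ :=
  (∫ x : ℝ in α..β, g (x + c * I)) - (∫ x : ℝ in α..β, g (x + d * I)) +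
    I * (∫ y : ℝ in c..d, g (β + y * I)) - I * (∫ y : ℝ in c..d, g (α + y * I))

theorem integral_inv_horizontal {α β c : ℝ} {w : ℂ} (hc : c ≠ w.im) :
    ∫ x : ℝ in α..β, ((x : ℂ) + c * I - w)⁻¹ =
      log (β + c * I - w) - log (α + c * I - w) := by
  have hne : ∀ x : ℝ, (x : ℂ) + c * I - w ≠ 0 := fun x h => by
    have := congrArg im h
    simp at this
    exact hc (by linarith)
  refine intervalIntegral.integral_eq_sub_of_hasDerivAt
    (f := fun x : ℝ => log ((x : ℂ) + c * I - w)) (fun x _ => ?_) ?_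
  · have h1 : HasDerivAt (fun x : ℝ => (x : ℂ) + c * I - w) 1 x :=
      ((hasDerivAt_id x).ofReal_comp.add_const _).sub_const _
    have h2 := h1.clog_real (by
      rw [mem_slitPlane_iff]; right; simp
      intro h; exact hc (by linarith))
    simpa using h2
  · exact (Continuous.inv₀ (by fun_prop) hne).intervalIntegrable _ _

theorem integral_inv_vertical {β c d : ℝ} {w : ℂ} (hβ : w.re < β) :
    I * ∫ y : ℝ in c..d, ((β : ℂ) + y * I - w)⁻¹ =
      log (β + d * I - w) - log (β + c * I - w) := by
  have hne : ∀ y : ℝ, (β : ℂ) + y * I - w ≠ 0 := fun x h => by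
    have := congrArg re h
    simp at this
    linarith
  rw [← intervalIntegral.integral_const_mul]
  refine intervalIntegral.integral_eq_sub_of_hasDerivAt
    (f := fun y : ℝ => log ((β : ℂ) + y * I - w)) (fun x _ => ?_) ?_
  · have h1 : HasDerivAt (fun y : ℝ => (β : ℂ) + y * I - w) I x := by
      simpa using (((hasDerivAt_id x).ofReal_comp.mul_const I).const_add (β : ℂ)).sub_const w
    have h2 := h1.clog_real (by
      rw [mem_slitPlane_iff]; left; simpa using hβ)
    simpa [div_eq_mul_inv] using h2
  · exact (continuous_const.mul (Continuous.inv₀ (by fun_prop) hne)).intervalIntegrable _ _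

theorem integral_inv_vertical_left {α c d : ℝ} {w : ℂ} (hα : α < w.re) :
    I * ∫ y : ℝ in c..d, ((α : ℂ) + y * I - w)⁻¹ =
      log (-(α + d * I - w)) - log (-(α + c * I - w)) := by
  have hne : ∀ y : ℝ, (α : ℂ) + y * I - w ≠ 0 := fun x h => by
    have := congrArg re h
    simp at this
    linarith
  rw [← intervalIntegral.integral_const_mul]
  refine intervalIntegral.integral_eq_sub_of_hasDerivAt
    (f := fun y : ℝ => log (-((α : ℂ) + y * I - w))) (fun x _ => ?_) ?_
  · have h1 : HasDerivAt (fun y : ℝ => (α : ℂ) + y * I - w) I x := by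
      simpa using (((hasDerivAt_id x).ofReal_comp.mul_const I).const_add (α : ℂ)).sub_const w
    have h2 := h1.neg.clog_real (by
      rw [mem_slitPlane_iff]; left; simpa using hα)
    rw [← div_eq_mul_inv, ← neg_div_neg_eq]
    exact h2
  · exact (continuous_const.mul (Continuous.inv₀ (by fun_prop) hne)).intervalIntegrable _ _

theorem log_sub_log_neg_of_im_pos {x : ℂ} (hx : 0 < x.im) :
    log x - log (-x) = Real.pi * I := by
  rw [log, log, arg_neg_eq_arg_sub_pi_of_im_pos hx, norm_neg]
  push_cast
  ring

theorem log_sub_log_neg_of_im_neg {x : ℂ} (hx : x.im < 0) :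
    log x - log (-x) = -(Real.pi * I) := by
  rw [log, log, arg_neg_eq_arg_add_pi_of_im_neg hx, norm_neg]
  push_cast
  ring

theorem rectIntegral_inv {α β c d : ℝ} {w : ℂ} (hα : α < w.re) (hβ : w.re < β) (hc : c < w.im)
    (hd : w.im < d) : rectIntegral (fun ζ => (ζ - w)⁻¹) α β c d = 2 * Real.pi * I := by
  rw [rectIntegral, integral_inv_horizontal hc.ne, integral_inv_horizontal hd.ne',
    integral_inv_vertical hβ, integral_inv_vertical_left hα]
  have h1 := log_sub_log_neg_of_im_pos (x := α + d * I - w) (by simpa using hd)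
  have h2 := log_sub_log_neg_of_im_neg (x := α + c * I - w) (by simpa using hc)
  linear_combination h1 - h2

/-- Cauchy's integral formula for a rectangle. -/
theorem rectIntegral_inv_mul {g : ℂ → ℂ} {α β c d : ℝ} {w : ℂ}
    (hg : ∀ ζ : ℂ, ζ.re ∈ Icc α β → ζ.im ∈ Icc c d → DifferentiableAt ℂ g ζ)
    (hα : α < w.re) (hβ : w.re < β) (hc : c < w.im) (hd : w.im < d) :
    rectIntegral (fun ζ => (ζ - w)⁻¹ * g ζ) α β c d = 2 * Real.pi * I * g w := by
  have hαβ : α ≤ β := by linarith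
  have hcd : c ≤ d := by linarith
  have hw : DifferentiableAt ℂ g w := hg w ⟨hα.le, hβ.le⟩ ⟨hc.le, hd.le⟩
  have hdiff : ContinuousOn (dslope g w) (uIcc α β ×ℂ uIcc c d) := by
    rintro ζ ⟨h1, h2⟩
    rw [uIcc_of_le hαβ] at h1
    rw [uIcc_of_le hcd] at h2
    rcases eq_or_ne ζ w with rfl | hne
    · exact (continuousAt_dslope_same.2 hw).continuousWithinAt
    · exact ((continuousAt_dslope_of_ne hne).2 (hg ζ h1 h2).continuousAt).continuousWithinAt
  have h0 := integral_boundary_rect_eq_zero_of_differentiable_on_off_countable (dslope g w)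
    ⟨α, c⟩ ⟨β, d⟩ {w} (countable_singleton w) hdiff (by
      rintro ζ ⟨⟨h1, h2⟩, hne⟩
      simp only [min_eq_left hαβ, max_eq_right hαβ, min_eq_left hcd, max_eq_right hcd] at h1 h2
      exact (differentiableAt_dslope_of_ne hne).2
        (hg ζ ⟨h1.1.le, h1.2.le⟩ ⟨h2.1.le, h2.2.le⟩))
  have h1 := rectIntegral_inv hα hβ hc hd
  simp only [smul_eq_mul] at h0
  have key : ∀ (γ : ℝ → ℂ) (u v : ℝ), Continuous γ → u ≤ v → (∀ s, γ s ≠ w) →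
      (∀ s ∈ Icc u v, DifferentiableAt ℂ g (γ s)) →
      ∫ s in u..v, (γ s - w)⁻¹ * g (γ s) =
        (∫ s in u..v, dslope g w (γ s)) + (∫ s in u..v, (γ s - w)⁻¹) * g w := by
    intro γ u v hγ huv hne hγg
    have hinv : Continuous fun s => (γ s - w)⁻¹ :=
      Continuous.inv₀ (by fun_prop) fun s => sub_ne_zero.2 (hne s)
    rw [← intervalIntegral.integral_mul_const, ← intervalIntegral.integral_add]
    · refine intervalIntegral.integral_congr fun s _ => ?_
      simp only [dslope_of_ne g (hne s), slope_def_field]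
      ring
    · refine ContinuousOn.intervalIntegrable fun s hs => ?_
      rw [uIcc_of_le huv] at hs
      exact (ContinuousAt.comp ((continuousAt_dslope_of_ne (hne s)).2 (hγg s hs).continuousAt)
        hγ.continuousAt).continuousWithinAt
    · exact (hinv.mul continuous_const).intervalIntegrable _ _
  have hne1 : ∀ x y : ℝ, x ≠ w.re → (x : ℂ) + y * I ≠ w := fun x y hx h => hx (by
    simpa using congrArg re h)
  have hne2 : ∀ x y : ℝ, y ≠ w.im → (x : ℂ) + y * I ≠ w := fun x y hy h => hy (by
    simpa using congrArg im h)
  rw [rectIntegral] at h1 ⊢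
  rw [key (fun x : ℝ => (x : ℂ) + c * I) α β (by fun_prop) hαβ (fun s => hne2 _ _ hc.ne)
      fun s hs => hg _ (by simpa using hs) (by simpa using hcd),
    key (fun x : ℝ => (x : ℂ) + d * I) α β (by fun_prop) hαβ (fun s => hne2 _ _ hd.ne')
      fun s hs => hg _ (by simpa using hs) (by simpa using hcd),
    key (fun y : ℝ => (β : ℂ) + y * I) c d (by fun_prop) hcd (fun s => hne1 _ _ hβ.ne')
      fun s hs => hg _ (by simpa using hαβ) (by simpa using hs),
    key (fun y : ℝ => (α : ℂ) + y * I) c d (by fun_prop) hcd (fun s => hne1 _ _ hα.ne)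
      fun s hs => hg _ (by simpa using hαβ) (by simpa using hs)]
  linear_combination h0 + g w * h1

end Rectangle

section Splitting

variable {ι : Type} [Fintype ι]

open Classical in
/-- Additive Cousin splitting across a slab in one complex coordinate, with parameters. -/
theorem exists_split_in_coordinate {B : Set (ι → ℂ)} (hB : IsCompact B) (k : ι) {u : ℂ}
    (hu : u ≠ 0) {t c d : ℝ} (hcd : c ≤ d) {h : (ι → ℂ) → ℂ}
    (hh : ∀ z ∈ B, ∀ y ∈ Icc c d,
      AnalyticAt ℂ h (Function.update z k (u * (t + y * Complex.I)))) :
    ∃ h₁ h₂ : (ι → ℂ) → ℂ,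
      (∀ z ∈ B, ∀ ξ : ℂ, ξ.re ≤ t → ξ.im ∈ Icc c d →
        AnalyticAt ℂ h₁ (Function.update z k (u * ξ))) ∧
      (∀ z ∈ B, ∀ ξ : ℂ, t ≤ ξ.re → ξ.im ∈ Icc c d →
        AnalyticAt ℂ h₂ (Function.update z k (u * ξ))) ∧
      ∀ z ∈ B, ∀ y ∈ Icc c d, ∀ᶠ x in 𝓝 (Function.update z k (u * (t + y * Complex.I))),
        h x = h₁ x - h₂ x := by
  have hre : ∀ x y : ℝ, ((x : ℂ) + y * Complex.I).re = x := fun x y => by simp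
  have him : ∀ x y : ℝ, ((x : ℂ) + y * Complex.I).im = y := fun x y => by simp
  have hm : Continuous fun p : (ι → ℂ) × ℂ => Function.update p.1 k (u * p.2) :=
    continuous_fst.update k (continuous_const.mul continuous_snd)
  have hO : IsOpen {p : (ι → ℂ) × ℂ | AnalyticAt ℂ h (Function.update p.1 k (u * p.2))} :=
    (isOpen_analyticAt ℂ h).preimage hm
  set S : Set ℂ := (fun y : ℝ => (t : ℂ) + y * Complex.I) '' Icc c d with hS
  have hSc : IsCompact S := isCompact_Icc.image (by fun_prop)
  obtain ⟨U, V, hU, hV, hBU, hSV, hUV⟩ := generalized_tube_lemma hB hSc hO (by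
    rintro ⟨z, w⟩ ⟨hz, y, hy, rfl⟩
    exact hh z hz y hy)
  obtain ⟨ε, hε, hεV⟩ := hSc.exists_thickening_subset_open hV hSV
  set δ := ε / 4 with hδdef
  have hδ : 0 < δ := by positivity
  have hrect : ∀ ζ : ℂ, ζ.re ∈ Icc (t - δ) (t + δ) → ζ.im ∈ Icc (c - δ) (d + δ) → ζ ∈ V := by
    intro ζ h1 h2
    refine hεV (mem_thickening_iff.2 ?_)
    set y := max c (min d ζ.im) with hy
    have hyI : y ∈ Icc c d := ⟨le_max_left _ _, max_le hcd (min_le_left _ _)⟩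
    refine ⟨_, ⟨y, hyI, rfl⟩, ?_⟩
    have h3 : |ζ.im - y| ≤ δ := by
      rw [hy, abs_le]
      rcases le_total d ζ.im with h | h
      · rw [min_eq_left h, max_eq_right hcd]; constructor <;> linarith [h2.2]
      · rw [min_eq_right h]
        rcases le_total c ζ.im with h' | h'
        · rw [max_eq_right h']; simp [hδ.le]
        · rw [max_eq_left h']; constructor <;> linarith [h2.1]
    have h4 : |ζ.re - t| ≤ δ := by
      rw [abs_le]; constructor <;> linarith [h1.1, h1.2]
    rw [dist_eq_norm]
    refine (Complex.norm_le_abs_re_add_abs_im _).trans_lt ?_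
    have e1 : (ζ - (t + y * Complex.I)).re = ζ.re - t := by simp
    have e2 : (ζ - (t + y * Complex.I)).im = ζ.im - y := by simp
    rw [e1, e2]
    linarith
  set G : (ι → ℂ) → ℂ → ℂ := fun z ζ =>
    (ζ - u⁻¹ * z k)⁻¹ * h (Function.update z k (u * ζ)) with hG
  have hGan : ∀ z ∈ B, ∀ ξ : ℂ, ∀ γ : ℂ → ℂ, Differentiable ℂ γ → ∀ s : ℂ,
      γ s ∈ V → γ s ≠ ξ →
      AnalyticAt ℂ (fun p : (ι → ℂ) × ℂ => G p.1 (γ p.2)) (Function.update z k (u * ξ), s) := by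
    intro z hz ξ γ hγ s hV hne
    have hγ' : AnalyticAt ℂ (fun p : (ι → ℂ) × ℂ => γ p.2) (Function.update z k (u * ξ), s) :=
      (hγ.analyticAt s).comp analyticAt_snd
    have hpk : AnalyticAt ℂ (fun p : (ι → ℂ) × ℂ => p.1 k) (Function.update z k (u * ξ), s) :=
      ((ContinuousLinearMap.proj (R := ℂ) (φ := fun _ : ι => ℂ) k).comp
        (ContinuousLinearMap.fst ℂ (ι → ℂ) ℂ)).analyticAt _
    refine AnalyticAt.mul (AnalyticAt.inv (hγ'.sub (analyticAt_const.mul hpk)) ?_) ?_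
    · simpa [hu, sub_eq_zero] using hne
    · refine AnalyticAt.fun_comp (g := h)
        (f := fun p : (ι → ℂ) × ℂ => Function.update p.1 k (u * γ p.2)) ?_ ?_
      · simp only [Function.update_idem]
        exact hUV (show (z, γ s) ∈ U ×ˢ V from ⟨hBU hz, hV⟩)
      · rw [analyticAt_pi_iff]
        intro j
        rcases eq_or_ne j k with rfl | hj
        · simp only [Function.update_self]
          exact analyticAt_const.mul hγ'
        · simp only [Function.update_of_ne hj]
          exact ((ContinuousLinearMap.proj (R := ℂ) (φ := fun _ : ι => ℂ) j).comp
            (ContinuousLinearMap.fst ℂ (ι → ℂ) ℂ)).analyticAt _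
  set h₁ : (ι → ℂ) → ℂ := fun z => (2 * Real.pi * Complex.I)⁻¹ *
    ((∫ x : ℝ in t..t + δ, G z (x + (c - δ : ℝ) * Complex.I)) -
      (∫ x : ℝ in t..t + δ, G z (x + (d + δ : ℝ) * Complex.I)) +
      Complex.I * ∫ y : ℝ in c - δ..d + δ, G z ((t + δ : ℝ) + y * Complex.I)) with hh₁
  set h₂ : (ι → ℂ) → ℂ := fun z => (2 * Real.pi * Complex.I)⁻¹ *
    (-(∫ x : ℝ in t - δ..t, G z (x + (c - δ : ℝ) * Complex.I)) +
      (∫ x : ℝ in t - δ..t, G z (x + (d + δ : ℝ) * Complex.I)) +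
      Complex.I * ∫ y : ℝ in c - δ..d + δ, G z ((t - δ : ℝ) + y * Complex.I)) with hh₂
  have hhor : ∀ z ∈ B, ∀ ξ : ℂ, ∀ α β η : ℝ, α ≤ β → t - δ ≤ α → β ≤ t + δ →
      η ∈ Icc (c - δ) (d + δ) → η ≠ ξ.im →
      AnalyticAt ℂ (fun z => ∫ x : ℝ in α..β, G z (x + η * Complex.I))
        (Function.update z k (u * ξ)) := by
    intro z hz ξ α β η hαβ hα hβ hη hne
    refine analyticAt_intervalIntegral
      (K := fun p : (ι → ℂ) × ℂ => G p.1 (p.2 + η * Complex.I)) fun s hs => ?_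
    rw [uIcc_of_le hαβ] at hs
    refine hGan z hz ξ (fun s => s + η * Complex.I) (by fun_prop) s (hrect _ ?_ ?_) ?_
    · rw [hre]; exact ⟨hα.trans hs.1, hs.2.trans hβ⟩
    · rw [him]; exact hη
    · intro h; exact hne (by simpa using congrArg Complex.im h)
  have hver : ∀ z ∈ B, ∀ ξ : ℂ, ∀ η : ℝ,
      η ∈ Icc (t - δ) (t + δ) → η ≠ ξ.re →
      AnalyticAt ℂ (fun z => ∫ y : ℝ in c - δ..d + δ, G z (η + y * Complex.I))
        (Function.update z k (u * ξ)) := by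
    intro z hz ξ η hη hne
    refine analyticAt_intervalIntegral
      (K := fun p : (ι → ℂ) × ℂ => G p.1 (η + p.2 * Complex.I)) fun s hs => ?_
    rw [uIcc_of_le (by linarith)] at hs
    refine hGan z hz ξ (fun s => η + s * Complex.I) (by fun_prop) s (hrect _ ?_ ?_) ?_
    · rw [hre]; exact hη
    · rw [him]; exact hs
    · intro h; exact hne (by simpa using congrArg Complex.re h)
  refine ⟨h₁, h₂, fun z hz ξ h1 h2 => ?_, fun z hz ξ h1 h2 => ?_, fun z hz y hy => ?_⟩
  · refine analyticAt_const.mul (((hhor z hz ξ _ _ _ ?_ ?_ ?_ ⟨?_, ?_⟩ ?_).sub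
      (hhor z hz ξ _ _ _ ?_ ?_ ?_ ⟨?_, ?_⟩ ?_)).add
        (analyticAt_const.mul (hver z hz ξ _ ⟨?_, ?_⟩ ?_)))
    all_goals linarith [h2.1, h2.2]
  · refine analyticAt_const.mul (((hhor z hz ξ _ _ _ ?_ ?_ ?_ ⟨?_, ?_⟩ ?_).neg.add
      (hhor z hz ξ _ _ _ ?_ ?_ ?_ ⟨?_, ?_⟩ ?_)).add
        (analyticAt_const.mul (hver z hz ξ _ ⟨?_, ?_⟩ ?_)))
    all_goals linarith [h2.1, h2.2]
  · set x₀ := Function.update z k (u * (t + y * Complex.I)) with hx₀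
    have hc1 : Continuous fun x : ι → ℂ => Function.update x k (z k) :=
      continuous_id.update k continuous_const
    have hc2 : Continuous fun x : ι → ℂ => u⁻¹ * x k := by fun_prop
    have e1 : Function.update x₀ k (z k) ∈ U := by
      rw [hx₀, Function.update_idem, Function.update_eq_self]; exact hBU hz
    have e2 : u⁻¹ * x₀ k = t + y * Complex.I := by simp [hx₀, hu]
    have n1 : ∀ᶠ x in 𝓝 x₀, Function.update x k (z k) ∈ U :=
      hc1.continuousAt.eventually (hU.mem_nhds e1)
    have hopen : IsOpen {ζ : ℂ | t - δ < ζ.re ∧ ζ.re < t + δ ∧ c - δ < ζ.im ∧ ζ.im < d + δ} := by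
      simp only [ofPred_and]
      exact (isOpen_lt continuous_const Complex.continuous_re).inter
        ((isOpen_lt Complex.continuous_re continuous_const).inter
        ((isOpen_lt continuous_const Complex.continuous_im).inter
          (isOpen_lt Complex.continuous_im continuous_const)))
    have n2 : ∀ᶠ x in 𝓝 x₀, u⁻¹ * x k ∈
        {ζ : ℂ | t - δ < ζ.re ∧ ζ.re < t + δ ∧ c - δ < ζ.im ∧ ζ.im < d + δ} := by
      refine hc2.continuousAt.eventually (hopen.mem_nhds ?_)
      change u⁻¹ * x₀ k ∈ _
      rw [e2]
      simp only [mem_ofPred_eq, Complex.add_re, Complex.ofReal_re, Complex.mul_re, Complex.I_re,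
        mul_zero, Complex.ofReal_im, Complex.I_im, mul_one, sub_self, add_zero, Complex.add_im,
        Complex.mul_im, zero_add]
      refine ⟨?_, ?_, ?_, ?_⟩ <;> linarith [hy.1, hy.2]
    filter_upwards [n1, n2] with x hx1 hx2
    have hdiff : ∀ ζ : ℂ, ζ.re ∈ Icc (t - δ) (t + δ) → ζ.im ∈ Icc (c - δ) (d + δ) →
        DifferentiableAt ℂ (fun ζ => h (Function.update x k (u * ζ))) ζ := by
      intro ζ h1 h2
      have h3 : AnalyticAt ℂ h (Function.update x k (u * ζ)) := by
        have := hUV (show (Function.update x k (z k), ζ) ∈ U ×ˢ V from ⟨hx1, hrect ζ h1 h2⟩)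
        simpa using this
      refine h3.differentiableAt.comp ζ (f := fun ζ => Function.update x k (u * ζ)) ?_
      rw [differentiableAt_pi]
      intro j
      rcases eq_or_ne j k with rfl | hj
      · simp only [Function.update_self]
        fun_prop
      · simp only [Function.update_of_ne hj]
        fun_prop
    have hcau := rectIntegral_inv_mul hdiff hx2.1 hx2.2.1 hx2.2.2.1 hx2.2.2.2
    have hgw : h (Function.update x k (u * (u⁻¹ * x k))) = h x := by
      rw [mul_inv_cancel_left₀ hu, Function.update_eq_self]
    rw [hgw] at hcau
    have hint : ∀ η : ℝ, η ∈ Icc (c - δ) (d + δ) → η ≠ (u⁻¹ * x k).im → ∀ α β : ℝ, α ≤ β →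
        t - δ ≤ α → β ≤ t + δ →
        IntervalIntegrable (fun s : ℝ => G x (s + η * Complex.I)) MeasureTheory.volume α β := by
      intro η hη hne α β hαβ hα hβ
      refine ContinuousOn.intervalIntegrable fun s hs => ?_
      rw [uIcc_of_le hαβ] at hs
      refine ContinuousAt.continuousWithinAt (ContinuousAt.mul (ContinuousAt.inv₀ (by fun_prop) ?_)
        ?_)
      · intro h
        have := congrArg Complex.im (sub_eq_zero.1 h)
        exact hne (by simpa using this)
      · exact ContinuousAt.comp (g := fun ζ => h (Function.update x k (u * ζ)))
          (f := fun s : ℝ => (s : ℂ) + η * Complex.I)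
          (hdiff _ (by rw [hre]; exact ⟨hα.trans hs.1, hs.2.trans hβ⟩)
            (by rw [him]; exact hη)).continuousAt
          (by fun_prop)
    have hδ1 : c - δ ∈ Icc (c - δ) (d + δ) := ⟨le_rfl, by linarith⟩
    have hδ2 : d + δ ∈ Icc (c - δ) (d + δ) := ⟨by linarith, le_rfl⟩
    have i1 := intervalIntegral.integral_add_adjacent_intervals
      (hint (c - δ) hδ1 hx2.2.2.1.ne (t - δ) t (by linarith) le_rfl (by linarith))
      (hint (c - δ) hδ1 hx2.2.2.1.ne t (t + δ) (by linarith) (by linarith) le_rfl)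
    have i2 := intervalIntegral.integral_add_adjacent_intervals
      (hint (d + δ) hδ2 hx2.2.2.2.ne' (t - δ) t (by linarith) le_rfl (by linarith))
      (hint (d + δ) hδ2 hx2.2.2.2.ne' t (t + δ) (by linarith) (by linarith) le_rfl)
    have hpi : (2 * Real.pi * Complex.I : ℂ) ≠ 0 := Complex.two_pi_I_ne_zero
    rw [rectIntegral] at hcau
    rw [hh₁, hh₂]
    simp only
    rw [← mul_sub]
    refine (eq_inv_mul_iff_mul_eq₀ hpi).2 ?_
    rw [← hcau]
    change (∫ s : ℝ in t - δ..t + δ, G x (s + (c - δ : ℝ) * Complex.I)) -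
      (∫ s : ℝ in t - δ..t + δ, G x (s + (d + δ : ℝ) * Complex.I)) + _ - _ = _
    rw [← i1, ← i2]
    ring

end Splitting

section Boxes

/-- Bisection: a property of boxes that holds for small boxes around each point and is stable
under gluing two boxes along a common face holds for the whole box. -/
theorem box_induction {κ : Type*} [Fintype κ] [DecidableEq κ] {P : (κ → ℝ) → (κ → ℝ) → Prop}
    {a b : κ → ℝ} (hab : a ≤ b)
    (hloc : ∀ x ∈ Icc a b, ∃ δ > 0, ∀ a' b', a ≤ a' → a' ≤ b' → b' ≤ b → x ∈ Icc a' b' →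
      (∀ k, b' k - a' k < δ) → P a' b')
    (hmerge : ∀ a' b', a ≤ a' → a' ≤ b' → b' ≤ b → ∀ k, ∀ t ∈ Icc (a' k) (b' k),
      P a' (Function.update b' k t) → P (Function.update a' k t) b' → P a' b') : P a b := by
  by_contra hP
  have hhalf : ∀ a' b', a ≤ a' → a' ≤ b' → b' ≤ b → ¬ P a' b' → ∀ s : Finset κ,
      ∃ a'' b'', a' ≤ a'' ∧ a'' ≤ b'' ∧ b'' ≤ b' ∧ ¬ P a'' b'' ∧
        ∀ k ∈ s, b'' k - a'' k ≤ (b' k - a' k) / 2 := by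
    intro a' b' h1 h2 h3 h4 s
    induction s using Finset.induction_on with
    | empty => exact ⟨a', b', le_rfl, h2, le_rfl, h4, by simp⟩
    | insert k s hk ih =>
      obtain ⟨c, d, i1, i2, i3, i4, i5⟩ := ih
      set t := (c k + d k) / 2 with ht
      have hcd := i2 k
      have htI : t ∈ Icc (c k) (d k) := ⟨by linarith, by linarith⟩
      have hw : d k - c k ≤ b' k - a' k := by linarith [i1 k, i3 k]
      by_cases hL : P c (Function.update d k t)
      · have hR : ¬ P (Function.update c k t) d := fun hR =>
          i4 (hmerge c d (h1.trans i1) i2 (i3.trans h3) k t htI hL hR)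
        refine ⟨Function.update c k t, d, fun j => ?_, fun j => ?_, i3, hR, fun j hj => ?_⟩
        · rcases eq_or_ne j k with rfl | hjk
          · simpa using (i1 j).trans htI.1
          · simpa [hjk] using i1 j
        · rcases eq_or_ne j k with rfl | hjk
          · simpa using htI.2
          · simpa [hjk] using i2 j
        · rcases eq_or_ne j k with rfl | hjk
          · simp only [Function.update_self]; linarith
          · simpa [hjk] using i5 j ((Finset.mem_insert.1 hj).resolve_left hjk)
      · refine ⟨c, Function.update d k t, i1, fun j => ?_, fun j => ?_, hL, fun j hj => ?_⟩
        · rcases eq_or_ne j k with rfl | hjk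
          · simpa using htI.1
          · simpa [hjk] using i2 j
        · rcases eq_or_ne j k with rfl | hjk
          · simpa using htI.2.trans (i3 j)
          · simpa [hjk] using i3 j
        · rcases eq_or_ne j k with rfl | hjk
          · simp only [Function.update_self]; linarith
          · simpa [hjk] using i5 j ((Finset.mem_insert.1 hj).resolve_left hjk)
  let T := {q : (κ → ℝ) × (κ → ℝ) // a ≤ q.1 ∧ q.1 ≤ q.2 ∧ q.2 ≤ b ∧ ¬ P q.1 q.2}
  have hstep : ∀ q : T, ∃ q' : T, q.1.1 ≤ q'.1.1 ∧ q'.1.2 ≤ q.1.2 ∧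
      ∀ k, q'.1.2 k - q'.1.1 k ≤ (q.1.2 k - q.1.1 k) / 2 := by
    rintro ⟨⟨a', b'⟩, h1, h2, h3, h4⟩
    obtain ⟨c, d, i1, i2, i3, i4, i5⟩ := hhalf a' b' h1 h2 h3 h4 Finset.univ
    exact ⟨⟨⟨c, d⟩, h1.trans i1, i2, i3.trans h3, i4⟩, i1, i3, fun k => i5 k (Finset.mem_univ k)⟩
  choose next hn1 hn2 hn3 using hstep
  let q : ℕ → T := fun n => Nat.rec ⟨⟨a, b⟩, le_rfl, hab, le_rfl, hP⟩ (fun _ p => next p) n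
  have hanti : Antitone fun n => Icc (q n).1.1 (q n).1.2 :=
    antitone_nat_of_succ_le fun n => Icc_subset_Icc (hn1 (q n)) (hn2 (q n))
  have hsup := ciSup_mem_iInter_Icc_of_antitone_Icc hanti fun n => (q n).2.2.1
  set x : κ → ℝ := ⨆ n, (q n).1.1
  have hx : ∀ n, x ∈ Icc (q n).1.1 (q n).1.2 := fun n => mem_iInter.1 hsup n
  have hlen : ∀ n k, (q n).1.2 k - (q n).1.1 k ≤ (b k - a k) * (1 / 2) ^ n := by
    intro n k
    induction n with
    | zero => simp [q]
    | succ n ih =>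
      have := hn3 (q n) k
      rw [pow_succ]
      change (next (q n)).1.2 k - (next (q n)).1.1 k ≤ _
      linarith
  obtain ⟨δ, hδ, hδP⟩ := hloc x (hx 0)
  have hlim : ∀ k, ∀ᶠ n : ℕ in atTop, (b k - a k) * (1 / 2 : ℝ) ^ n < δ := by
    intro k
    have := (tendsto_pow_atTop_nhds_zero_of_lt_one (by norm_num : (0 : ℝ) ≤ 1 / 2)
      (by norm_num)).const_mul (b k - a k)
    rw [mul_zero] at this
    exact this.eventually (gt_mem_nhds hδ)
  obtain ⟨n, hn⟩ := (eventually_all.2 hlim).exists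
  exact (q n).2.2.2.2 (hδP _ _ (q n).2.1 (q n).2.2.1 (q n).2.2.2.1 (hx n)
    fun k => (hlen n k).trans_lt (hn k))

variable {ι : Type}

/-- The real coordinates of a point of `ℂ^ι`. -/
def realCoord (z : ι → ℂ) (κ : ι × Bool) : ℝ := bif κ.2 then (z κ.1).im else (z κ.1).re

@[simp] theorem realCoord_false (z : ι → ℂ) (i : ι) : realCoord z (i, false) = (z i).re := rfl
@[simp] theorem realCoord_true (z : ι → ℂ) (i : ι) : realCoord z (i, true) = (z i).im := rfl

theorem continuous_realCoord (κ : ι × Bool) : Continuous fun z : ι → ℂ => realCoord z κ := by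
  rcases κ with ⟨i, _ | _⟩
  · exact Complex.continuous_re.comp (continuous_apply i)
  · exact Complex.continuous_im.comp (continuous_apply i)

/-- A closed box in `ℂ^ι`. -/
def cbox (a b : ι × Bool → ℝ) : Set (ι → ℂ) := {z | ∀ κ, realCoord z κ ∈ Icc (a κ) (b κ)}

theorem isCompact_cbox [Fintype ι] (a b : ι × Bool → ℝ) : IsCompact (cbox a b) := by
  have h1 : IsClosed (cbox a b) := by
    simp only [cbox, ofPred_forall]
    exact isClosed_iInter fun κ => isClosed_Icc.preimage (continuous_realCoord κ)
  refine (isCompact_univ_pi fun i : ι => (isCompact_Icc (a := a (i, false))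
    (b := b (i, false))).reProdIm (isCompact_Icc (a := a (i, true)) (b := b (i, true)))).of_isClosed_subset
      h1 fun z hz i _ => ⟨hz (i, false), hz (i, true)⟩

/-- Functions holomorphic near the intersection of `Q` with a slab are differences of functions
holomorphic near the parts of `Q` on either side of the slab. -/
def Splits (Q : Set (ι → ℂ)) [Fintype ι] : Prop :=
  ∀ (a b : ι × Bool → ℝ) (κ : ι × Bool) (t : ℝ), a ≤ b → t ∈ Icc (a κ) (b κ) →
    ∀ h : (ι → ℂ) → ℂ, (∀ z ∈ Q ∩ cbox a b, realCoord z κ = t → AnalyticAt ℂ h z) →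
    ∃ h₁ h₂ : (ι → ℂ) → ℂ, (∀ z ∈ Q ∩ cbox a b, realCoord z κ ≤ t → AnalyticAt ℂ h₁ z) ∧
      (∀ z ∈ Q ∩ cbox a b, t ≤ realCoord z κ → AnalyticAt ℂ h₂ z) ∧
      ∀ z ∈ Q ∩ cbox a b, realCoord z κ = t → ∀ᶠ x in 𝓝 z, h x = h₁ x - h₂ x

open Classical in
theorem splits_univ [Fintype ι] : Splits (univ : Set (ι → ℂ)) := by
  intro a b κ t hab ht h hh
  simp only [univ_inter] at hh ⊢
  rcases κ with ⟨k, _ | _⟩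
  · obtain ⟨h₁, h₂, i1, i2, i3⟩ := exists_split_in_coordinate (isCompact_cbox a b) k
      one_ne_zero (t := t) (c := a (k, true)) (d := b (k, true)) (hab _) (h := h) (by
        intro z hz y hy
        refine hh _ (fun κ => ?_) (by simp)
        rcases κ with ⟨j, c⟩
        rcases eq_or_ne j k with rfl | hj
        · cases c
          · simpa using ht
          · simpa using hy
        · have := hz (j, c)
          cases c <;> simpa [hj] using this)
    refine ⟨h₁, h₂, fun z hz hzt => ?_, fun z hz hzt => ?_, fun z hz hzt => ?_⟩
    · simpa using i1 z hz (z k) hzt (hz (k, true))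
    · simpa using i2 z hz (z k) hzt (hz (k, true))
    · have h0 : (1 : ℂ) * (t + (z k).im * Complex.I) = z k := by
        rw [← hzt, realCoord_false, one_mul, Complex.re_add_im]
      have := i3 z hz (z k).im (hz (k, true))
      rwa [h0, Function.update_eq_self] at this
  · obtain ⟨h₁, h₂, i1, i2, i3⟩ := exists_split_in_coordinate (isCompact_cbox a b) k
      Complex.I_ne_zero (t := t) (c := -b (k, false)) (d := -a (k, false))
      (neg_le_neg (hab _)) (h := h) (by
        intro z hz y hy
        refine hh _ (fun κ => ?_) (by simp)
        rcases κ with ⟨j, c⟩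
        rcases eq_or_ne j k with rfl | hj
        · cases c
          · simpa using ⟨le_neg.1 hy.2, neg_le.1 hy.1⟩
          · simpa using ht
        · have := hz (j, c)
          cases c <;> simpa [hj] using this)
    have hI : ∀ w : ℂ, Complex.I * (-Complex.I * w) = w := fun w => by
      rw [← mul_assoc, mul_neg, Complex.I_mul_I, neg_neg, one_mul]
    refine ⟨h₁, h₂, fun z hz hzt => ?_, fun z hz hzt => ?_, fun z hz hzt => ?_⟩
    · have := i1 z hz (-Complex.I * z k) (by simpa using hzt) (by simpa using (hz (k, false)).symm)
      rwa [hI, Function.update_eq_self] at this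
    · have := i2 z hz (-Complex.I * z k) (by simpa using hzt) (by simpa using (hz (k, false)).symm)
      rwa [hI, Function.update_eq_self] at this
    · have h0 : Complex.I * (t + (-(z k).re : ℝ) * Complex.I) = z k := by
        rw [← hzt, realCoord_true]
        refine Complex.ext ?_ ?_ <;> simp
      have := i3 z hz (-(z k).re) (by
        have := hz (k, false); simp only [realCoord_false, mem_Icc] at this
        exact ⟨neg_le_neg this.2, neg_le_neg this.1⟩)
      rwa [h0, Function.update_eq_self] at this

end Boxes

section Division

variable {E : Type*} [NormedAddCommGroup E] [NormedSpace ℂ E]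

open Classical in
/-- The quotient of a function `H` by a function `φ` with `∂φ/∂e = 1`, provided that `H` vanishes
where `φ` does. -/
def quotientBy (φ : E → ℂ) (e : E) (H : E → ℂ) (x : E) : ℂ :=
  if φ x = 0 then fderiv ℂ H x e else (φ x)⁻¹ * H x

theorem mul_quotientBy {φ : E → ℂ} {e : E} {H : E → ℂ} {x : E} (h : φ x = 0 → H x = 0) :
    φ x * quotientBy φ e H x = H x := by
  rw [quotientBy]
  split_ifs with h0
  · rw [h0, h h0, zero_mul]
  · rw [mul_inv_cancel_left₀ h0]

theorem analyticAt_quotientBy [FiniteDimensional ℂ E] {φ : E → ℂ} (hφ : Differentiable ℂ φ) {e : E}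
    (hφe : ∀ x t, φ (x + t • e) = φ x + t) {H : E → ℂ} {x₀ : E} (hH : AnalyticAt ℂ H x₀)
    (hv : φ x₀ = 0 → ∀ᶠ x in 𝓝 x₀, φ x = 0 → H x = 0) :
    AnalyticAt ℂ (quotientBy φ e H) x₀ := by
  have hφa : AnalyticAt ℂ φ x₀ :=
    analyticAt_of_eventually_differentiableAt (Eventually.of_forall fun x => hφ x)
  by_cases h0 : φ x₀ = 0
  · have hint : AnalyticAt ℂ (fun x => ∫ s in (0 : ℝ)..1,
        fderiv ℂ H (x - ((1 - (s : ℂ)) * φ x) • e) e) x₀ := by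
      refine analyticAt_intervalIntegral
        (K := fun q : E × ℂ => fderiv ℂ H (q.1 - ((1 - q.2) * φ q.1) • e) e) fun s _ => ?_
      have h1 : AnalyticAt ℂ (fun q : E × ℂ => q.1 - ((1 - q.2) * φ q.1) • e) (x₀, (s : ℂ)) :=
        analyticAt_fst.sub (((analyticAt_const.sub analyticAt_snd).mul
          (AnalyticAt.fun_comp (g := φ) (f := Prod.fst) hφa analyticAt_fst)).smul analyticAt_const)
      have h2 : AnalyticAt ℂ (fun q : E × ℂ => fderiv ℂ H (q.1 - ((1 - q.2) * φ q.1) • e))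
          (x₀, (s : ℂ)) :=
        AnalyticAt.fun_comp (g := fderiv ℂ H) (f := fun q : E × ℂ => q.1 - ((1 - q.2) * φ q.1) • e)
          (by simpa [h0] using hH.fderiv) h1
      exact ((ContinuousLinearMap.apply ℂ ℂ e).analyticAt _).fun_comp h2
    refine hint.congr ?_
    obtain ⟨ε, hε, hball⟩ := Metric.mem_nhds_iff.1 (hH.eventually_analyticAt.and (hv h0))
    have hcont : Continuous fun x => ‖x - x₀‖ + ‖φ x‖ * ‖e‖ :=
      ((continuous_id.sub continuous_const).norm).add (hφ.continuous.norm.mul continuous_const)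
    have hnear : ∀ᶠ x in 𝓝 x₀, ‖x - x₀‖ + ‖φ x‖ * ‖e‖ < ε :=
      hcont.continuousAt.eventually (gt_mem_nhds (by simpa [h0] using hε))
    filter_upwards [hnear] with x hx
    by_cases hx0 : φ x = 0
    · simp [quotientBy, hx0]
    · have hmem : ∀ s ∈ Icc (0 : ℝ) 1, x - ((1 - (s : ℂ)) * φ x) • e ∈ ball x₀ ε := by
        intro s hs
        rw [mem_ball_iff_norm]
        have h3 : ‖(1 - (s : ℂ))‖ ≤ 1 := by
          rw [← Complex.ofReal_one, ← Complex.ofReal_sub, Complex.norm_real, Real.norm_eq_abs,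
            abs_le]
          constructor <;> linarith [hs.1, hs.2]
        calc ‖x - ((1 - (s : ℂ)) * φ x) • e - x₀‖ = ‖(x - x₀) - ((1 - (s : ℂ)) * φ x) • e‖ := by
              congr 1; abel
          _ ≤ ‖x - x₀‖ + ‖((1 - (s : ℂ)) * φ x) • e‖ := norm_sub_le _ _
          _ = ‖x - x₀‖ + ‖(1 - (s : ℂ))‖ * (‖φ x‖ * ‖e‖) := by rw [norm_smul, norm_mul, mul_assoc]
          _ ≤ ‖x - x₀‖ + 1 * (‖φ x‖ * ‖e‖) := by gcongr
          _ < ε := by rw [one_mul]; exact hx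
      have hder : ∀ s ∈ uIcc (0 : ℝ) 1, HasDerivAt (fun s : ℝ => H (x - ((1 - (s : ℂ)) * φ x) • e))
          (φ x * fderiv ℂ H (x - ((1 - (s : ℂ)) * φ x) • e) e) s := by
        intro s hs
        rw [uIcc_of_le zero_le_one] at hs
        have h4 : HasDerivAt (fun s : ℝ => x - ((1 - (s : ℂ)) * φ x) • e) (φ x • e) s := by
          have := ((((hasDerivAt_id s).ofReal_comp.const_sub (1 : ℂ)).mul_const (φ x)).smul_const
            e).const_sub x
          simpa using this
        have h5 := ((hball (hmem s hs)).1.differentiableAt.hasFDerivAt.restrictScalars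
          ℝ).comp_hasDerivAt s h4
        simp only [ContinuousLinearMap.coe_restrictScalars', map_smul, smul_eq_mul] at h5
        exact h5
      have hFTC := intervalIntegral.integral_eq_sub_of_hasDerivAt hder (by
        refine ContinuousOn.intervalIntegrable fun s hs => ?_
        rw [uIcc_of_le zero_le_one] at hs
        refine ContinuousAt.continuousWithinAt (continuousAt_const.mul ?_)
        have h6 : ContinuousAt (fun s : ℝ => fderiv ℂ H (x - ((1 - (s : ℂ)) * φ x) • e)) s :=
          ContinuousAt.comp (g := fderiv ℂ H) (f := fun s : ℝ => x - ((1 - (s : ℂ)) * φ x) • e)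
            (hball (hmem s hs)).1.fderiv.continuousAt (by fun_prop)
        exact h6.clm_apply continuousAt_const)
      rw [intervalIntegral.integral_const_mul] at hFTC
      have h7 : H (x - ((1 - ((0 : ℝ) : ℂ)) * φ x) • e) = 0 := by
        refine (hball (hmem 0 ⟨le_rfl, zero_le_one⟩)).2 ?_
        have := hφe x (-φ x)
        simpa [sub_eq_add_neg] using this
      rw [h7] at hFTC
      rw [quotientBy, if_neg hx0, eq_inv_mul_iff_mul_eq₀ hx0, hFTC]
      simp
  · have hev : ∀ᶠ x in 𝓝 x₀, φ x ≠ 0 :=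
      hφ.continuous.continuousAt.eventually (isOpen_ne.mem_nhds h0)
    refine ((hφa.inv h0).mul hH).congr ?_
    filter_upwards [hev] with x hx
    simp [quotientBy, hx]

end Division

section Extension

variable {κ : Type} [Fintype κ]

/-- A holomorphic function near the zero set of `φ` in `Q ∩ cbox a b` extends, along that zero set,
to a holomorphic function near `Q ∩ cbox a b`. -/
theorem exists_extension_from_zeroSet {Q : Set (κ → ℂ)} (hQ : IsClosed Q) (hS : Splits Q)
    {φ : (κ → ℂ) → ℂ} (hφ : Differentiable ℂ φ) {e : κ → ℂ}
    (hφe : ∀ x t, φ (x + t • e) = φ x + t) {a b : κ × Bool → ℝ} (hab : a ≤ b) {G : (κ → ℂ) → ℂ}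
    (hG : ∀ x ∈ Q ∩ cbox a b, φ x = 0 → AnalyticAt ℂ G x) :
    ∃ F : (κ → ℂ) → ℂ, (∀ x ∈ Q ∩ cbox a b, AnalyticAt ℂ F x) ∧
      ∀ x ∈ Q ∩ cbox a b, ∀ᶠ y in 𝓝 x, φ y = 0 → F y = G y := by
  classical
  refine box_induction (P := fun a b => ∃ F : (κ → ℂ) → ℂ,
    (∀ x ∈ Q ∩ cbox a b, AnalyticAt ℂ F x) ∧
      ∀ x ∈ Q ∩ cbox a b, ∀ᶠ y in 𝓝 x, φ y = 0 → F y = G y) hab ?_ ?_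
  · intro c hc
    set x₀ : κ → ℂ := fun k => ⟨c (k, false), c (k, true)⟩ with hx₀
    have hcr : ∀ k, realCoord x₀ k = c k := by rintro ⟨k, _ | _⟩ <;> rfl
    have hx₀b : x₀ ∈ cbox a b := fun k => by rw [hcr]; exact ⟨hc.1 k, hc.2 k⟩
    have hloc : ∃ F : (κ → ℂ) → ℂ, ∀ᶠ x in 𝓝 x₀, x ∈ Q → AnalyticAt ℂ F x ∧
        ∀ᶠ y in 𝓝 x, φ y = 0 → F y = G y := by
      by_cases hxQ : x₀ ∈ Q
      · by_cases h0 : φ x₀ = 0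
        · refine ⟨G, ?_⟩
          filter_upwards [(hG x₀ ⟨hxQ, hx₀b⟩ h0).eventually_analyticAt] with x hx _
          exact ⟨hx, Eventually.of_forall fun _ _ => rfl⟩
        · refine ⟨0, ?_⟩
          have hopen : IsOpen {x | φ x ≠ 0} := isOpen_ne.preimage hφ.continuous
          filter_upwards [hopen.mem_nhds h0] with x hx _
          refine ⟨analyticAt_const, ?_⟩
          filter_upwards [hopen.mem_nhds hx] with y hy hy0 using absurd hy0 hy
      · refine ⟨0, ?_⟩
        filter_upwards [hQ.isOpen_compl.mem_nhds hxQ] with x hx hxQ' using absurd hxQ' hx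
    obtain ⟨F, hF⟩ := hloc
    obtain ⟨ε, hε, hball⟩ := Metric.mem_nhds_iff.1 hF
    refine ⟨ε / 2, by positivity, fun a' b' _ _ _ hca' hsmall => ?_⟩
    have hsub : cbox a' b' ⊆ ball x₀ ε := by
      intro x hx
      rw [mem_ball, dist_pi_lt_iff hε]
      intro k
      have hk : ∀ s, |realCoord x (k, s) - c (k, s)| < ε / 2 := fun s => by
        have h1 := hx (k, s)
        have h2 := hsmall (k, s)
        have h3 := hca'.1 (k, s)
        have h4 := hca'.2 (k, s)
        rw [abs_lt]; constructor <;> linarith [h1.1, h1.2]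
      rw [dist_eq_norm]
      refine (Complex.norm_le_abs_re_add_abs_im _).trans_lt ?_
      have := hk false
      have := hk true
      simp only [realCoord_false, realCoord_true] at *
      simp only [Complex.sub_re, Complex.sub_im, hx₀]
      linarith
    exact ⟨F, fun x hx => (hball (hsub hx.2) hx.1).1, fun x hx => (hball (hsub hx.2) hx.1).2⟩
  · rintro a' b' - ha'b' - k t ht ⟨F₁, hF₁, hF₁G⟩ ⟨F₂, hF₂, hF₂G⟩
    have hmem₁ : ∀ x ∈ Q ∩ cbox a' b', realCoord x k ≤ t →
        x ∈ Q ∩ cbox a' (Function.update b' k t) := by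
      rintro x ⟨hxQ, hx⟩ hxt
      refine ⟨hxQ, fun j => ⟨(hx j).1, ?_⟩⟩
      rcases eq_or_ne j k with rfl | hj
      · simpa using hxt
      · simpa [hj] using (hx j).2
    have hmem₂ : ∀ x ∈ Q ∩ cbox a' b', t ≤ realCoord x k →
        x ∈ Q ∩ cbox (Function.update a' k t) b' := by
      rintro x ⟨hxQ, hx⟩ hxt
      refine ⟨hxQ, fun j => ⟨?_, (hx j).2⟩⟩
      rcases eq_or_ne j k with rfl | hj
      · simpa using hxt
      · simpa [hj] using (hx j).1
    set H : (κ → ℂ) → ℂ := fun x => F₁ x - F₂ x with hHdef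
    have hv : ∀ x ∈ Q ∩ cbox a' b', realCoord x k = t → ∀ᶠ y in 𝓝 x, φ y = 0 → H y = 0 := by
      intro x hx hxt
      filter_upwards [hF₁G x (hmem₁ x hx hxt.le), hF₂G x (hmem₂ x hx hxt.ge)] with y h1 h2 h0
      simp only [hHdef]
      rw [h1 h0, h2 h0, sub_self]
    obtain ⟨g₁, g₂, hg₁, hg₂, hg⟩ := hS a' b' k t ha'b' ht (quotientBy φ e H) fun x hx hxt =>
      analyticAt_quotientBy hφ hφe ((hF₁ x (hmem₁ x hx hxt.le)).sub (hF₂ x (hmem₂ x hx hxt.ge)))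
        fun _ => hv x hx hxt
    have hφa : ∀ x, AnalyticAt ℂ φ x := fun x =>
      analyticAt_of_eventually_differentiableAt (Eventually.of_forall fun y => hφ y)
    set A : (κ → ℂ) → ℂ := fun x => F₁ x - φ x * g₁ x with hA
    set B : (κ → ℂ) → ℂ := fun x => F₂ x - φ x * g₂ x with hB
    set F : (κ → ℂ) → ℂ := fun x => if realCoord x k ≤ t then A x else B x with hF
    have hAan : ∀ x ∈ Q ∩ cbox a' b', realCoord x k ≤ t → AnalyticAt ℂ A x ∧
        ∀ᶠ y in 𝓝 x, φ y = 0 → A y = G y := by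
      intro x hx hxt
      refine ⟨(hF₁ x (hmem₁ x hx hxt)).sub ((hφa x).mul (hg₁ x hx hxt)), ?_⟩
      filter_upwards [hF₁G x (hmem₁ x hx hxt)] with y hy h0
      simp only [hA, h0, zero_mul, sub_zero, hy h0]
    have hBan : ∀ x ∈ Q ∩ cbox a' b', t ≤ realCoord x k → AnalyticAt ℂ B x ∧
        ∀ᶠ y in 𝓝 x, φ y = 0 → B y = G y := by
      intro x hx hxt
      refine ⟨(hF₂ x (hmem₂ x hx hxt)).sub ((hφa x).mul (hg₂ x hx hxt)), ?_⟩
      filter_upwards [hF₂G x (hmem₂ x hx hxt)] with y hy h0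
      simp only [hB, h0, zero_mul, sub_zero, hy h0]
    have key : ∀ x ∈ Q ∩ cbox a' b', AnalyticAt ℂ F x ∧ ∀ᶠ y in 𝓝 x, φ y = 0 → F y = G y := by
      have hcongr : ∀ (x : κ → ℂ) (C : (κ → ℂ) → ℂ), F =ᶠ[𝓝 x] C → (AnalyticAt ℂ C x ∧
          ∀ᶠ y in 𝓝 x, φ y = 0 → C y = G y) →
          AnalyticAt ℂ F x ∧ ∀ᶠ y in 𝓝 x, φ y = 0 → F y = G y := by
        rintro x C hFC ⟨h1, h2⟩
        refine ⟨h1.congr hFC.symm, ?_⟩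
        filter_upwards [hFC, h2] with y hy1 hy2 h0
        rw [hy1, hy2 h0]
      intro x hx
      rcases lt_trichotomy (realCoord x k) t with hlt | heq | hgt
      · refine hcongr x A ?_ (hAan x hx hlt.le)
        filter_upwards [(continuous_realCoord k).continuousAt.eventually (gt_mem_nhds hlt)] with y hy
        simp only [hF]
        rw [if_pos hy.le]
      · refine hcongr x A ?_ (hAan x hx heq.le)
        filter_upwards [hg x hx heq, hv x hx heq] with y hy1 hy2
        simp only [hF]
        split_ifs with h
        · rfl
        · have h3 := mul_quotientBy (e := e) hy2
          rw [hy1] at h3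
          simp only [hHdef] at h3
          simp only [hA, hB]
          linear_combination h3
      · refine hcongr x B ?_ (hBan x hx hgt.le)
        filter_upwards [(continuous_realCoord k).continuousAt.eventually (lt_mem_nhds hgt)] with y hy
        simp only [hF]
        rw [if_neg (not_le.2 hy)]
    exact ⟨F, fun x hx => (key x hx).1, fun x hx => (key x hx).2⟩

end Extension

section Polyhedra

variable {ι : Type} [Fintype ι]

/-- The closed square of half side `r` in the plane. -/
def square (r : ℝ) : Set ℂ := {w | w.re ∈ Icc (-r) r ∧ w.im ∈ Icc (-r) r}

theorem isClosed_square (r : ℝ) : IsClosed (square r) :=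
  (isClosed_Icc.preimage Complex.continuous_re).inter (isClosed_Icc.preimage Complex.continuous_im)

theorem mem_square_of_norm_le {r : ℝ} {w : ℂ} (h : ‖w‖ ≤ r) : w ∈ square r :=
  ⟨abs_le.1 ((Complex.abs_re_le_norm w).trans h), abs_le.1 ((Complex.abs_im_le_norm w).trans h)⟩

/-- The set where all functions of a list take values in a square. -/
def polyhedron (r : ℝ) (L : List ((ι → ℂ) → ℂ)) : Set (ι → ℂ) := {z | ∀ p ∈ L, p z ∈ square r}

omit [Fintype ι] in
theorem isClosed_polyhedron {r : ℝ} {L : List ((ι → ℂ) → ℂ)} (hL : ∀ p ∈ L, Continuous p) :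
    IsClosed (polyhedron r L) := by
  have : polyhedron r L = ⋂ p, ⋂ _ : p ∈ L, p ⁻¹' square r := by
    ext z; simp [polyhedron]
  rw [this]
  exact isClosed_iInter fun p => isClosed_iInter fun hp => (isClosed_square r).preimage (hL p hp)

/-- The projection forgetting the extra coordinate. -/
def baseMap : (Option ι → ℂ) →L[ℂ] (ι → ℂ) :=
  ContinuousLinearMap.pi fun i => ContinuousLinearMap.proj (some i)

omit [Fintype ι] in
@[simp] theorem baseMap_apply (x : Option ι → ℂ) (i : ι) : baseMap x i = x (some i) := rfl

/-- The graph embedding of a function. -/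
def graphMap (p : (ι → ℂ) → ℂ) (y : ι → ℂ) : Option ι → ℂ := fun o => o.elim (p y) y

omit [Fintype ι] in
@[simp] theorem graphMap_none (p : (ι → ℂ) → ℂ) (y : ι → ℂ) : graphMap p y none = p y := rfl
omit [Fintype ι] in
@[simp] theorem graphMap_some (p : (ι → ℂ) → ℂ) (y : ι → ℂ) (i : ι) :
    graphMap p y (some i) = y i := rfl
omit [Fintype ι] in
@[simp] theorem baseMap_graphMap (p : (ι → ℂ) → ℂ) (y : ι → ℂ) : baseMap (graphMap p y) = y := rfl

theorem differentiable_graphMap {p : (ι → ℂ) → ℂ} (hp : Differentiable ℂ p) :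
    Differentiable ℂ (graphMap p) := by
  rw [differentiable_pi]
  rintro (_ | i)
  · exact hp
  · exact differentiable_apply i

/-- Bounds for a box in the larger space. -/
def extendBound (s : ℝ) (a : ι × Bool → ℝ) (κ : Option ι × Bool) : ℝ :=
  κ.1.elim s fun i => a (i, κ.2)

omit [Fintype ι] in
theorem mem_cbox_extendBound {r : ℝ} {a b : ι × Bool → ℝ} {x : Option ι → ℂ} :
    x ∈ cbox (extendBound (-r) a) (extendBound r b) ↔ baseMap x ∈ cbox a b ∧ x none ∈ square r := by
  constructor
  · exact fun h => ⟨fun ⟨i, c⟩ => by have := h (some i, c); cases c <;> exact this,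
      h (none, false), h (none, true)⟩
  · rintro ⟨h1, h2⟩ ⟨_ | i, c⟩
    · cases c
      exacts [h2.1, h2.2]
    · have := h1 (i, c)
      cases c <;> exact this

omit [Fintype ι] in
theorem extendBound_le {r : ℝ} (hr : 0 ≤ r) {a b : ι × Bool → ℝ} (hab : a ≤ b) :
    extendBound (-r) a ≤ extendBound r b := by
  rintro ⟨_ | i, c⟩
  · change -r ≤ r
    linarith
  · exact hab (i, c)

theorem exists_extension_from_graph {Q : Set (ι → ℂ)} (hQ : IsClosed Q)
    (hS : Splits (baseMap ⁻¹' Q)) {p : (ι → ℂ) → ℂ} (hp : Differentiable ℂ p)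
    {r : ℝ} (hr : 0 ≤ r) {a b : ι × Bool → ℝ} (hab : a ≤ b) {f : (ι → ℂ) → ℂ}
    (hf : ∀ y ∈ Q ∩ cbox a b, p y ∈ square r → AnalyticAt ℂ f y) :
    ∃ F : (Option ι → ℂ) → ℂ,
      (∀ x, baseMap x ∈ Q ∩ cbox a b → x none ∈ square r → AnalyticAt ℂ F x) ∧
      ∀ y ∈ Q ∩ cbox a b, p y ∈ square r → ∀ᶠ y' in 𝓝 y, F (graphMap p y') = f y' := by
  classical
  obtain ⟨F, h1, h2⟩ := exists_extension_from_zeroSet (Q := baseMap ⁻¹' Q)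
    (hQ.preimage baseMap.continuous) hS (φ := fun x => x none - p (baseMap x))
    ((differentiable_apply none).sub (hp.comp baseMap.differentiable)) (e := Pi.single none 1)
    (fun x t => by
      have : baseMap (x + t • (Pi.single none 1 : Option ι → ℂ)) = baseMap x := by
        ext i; simp
      simp only [this]
      simp; ring)
    (extendBound_le hr hab) (G := fun x => f (baseMap x)) (fun x hx h0 => by
      obtain ⟨hxQ, hx⟩ := hx
      rw [mem_cbox_extendBound] at hx
      exact AnalyticAt.fun_comp (g := f) (f := baseMap)
        (hf _ ⟨hxQ, hx.1⟩ (by rw [← sub_eq_zero.1 h0]; exact hx.2)) (baseMap.analyticAt x))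
  refine ⟨F, fun x hx hxn => h1 x ⟨hx.1, mem_cbox_extendBound.2 ⟨hx.2, hxn⟩⟩, fun y hy hpy => ?_⟩
  have h3 := h2 (graphMap p y) ⟨hy.1, mem_cbox_extendBound.2 ⟨hy.2, hpy⟩⟩
  filter_upwards [(differentiable_graphMap hp).continuous.continuousAt.eventually h3] with y' hy'
  have := hy' (by simp)
  simpa using this

omit [Fintype ι] in
theorem baseMap_preimage_polyhedron (r : ℝ) (L : List ((ι → ℂ) → ℂ)) :
    baseMap ⁻¹' polyhedron r L = polyhedron r (L.map fun p x => p (baseMap x)) := by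
  ext x; simp [polyhedron]

theorem splits_polyhedron {r : ℝ} (hr : 0 ≤ r) (N : ℕ) : ∀ {ι : Type} [Fintype ι]
    (L : List ((ι → ℂ) → ℂ)), L.length = N → (∀ p ∈ L, Differentiable ℂ p) →
    Splits (polyhedron r L) := by
  classical
  induction N with
  | zero =>
    intro ι _ L hL _
    rw [List.length_eq_zero_iff.1 hL]
    have : polyhedron r ([] : List ((ι → ℂ) → ℂ)) = univ := by ext; simp [polyhedron]
    rw [this]
    exact splits_univ
  | succ N ih =>
    intro ι _ L hL hd
    obtain ⟨p, L, rfl⟩ := List.exists_cons_of_length_eq_add_one hL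
    have hL' : L.length = N := by simpa using hL
    have hp : Differentiable ℂ p := hd p (by simp)
    have hdL : ∀ q ∈ L, Differentiable ℂ q := fun q hq => hd q (by simp [hq])
    have hS : Splits (baseMap ⁻¹' polyhedron r L) := by
      rw [baseMap_preimage_polyhedron]
      refine ih _ (by simpa using hL') fun q hq => ?_
      obtain ⟨q', hq', rfl⟩ := List.mem_map.1 hq
      exact (hdL q' hq').comp baseMap.differentiable
    have hmem : ∀ z, z ∈ polyhedron r (p :: L) ↔ p z ∈ square r ∧ z ∈ polyhedron r L := by
      intro z; simp [polyhedron]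
    rintro a b ⟨k, c⟩ t hab ht h hh
    have hslab : ∀ z ∈ cbox (Function.update a (k, c) t) (Function.update b (k, c) t),
        z ∈ cbox a b ∧ realCoord z (k, c) = t := by
      intro z hz
      have hzt := hz (k, c)
      simp only [Function.update_self, Icc_self, mem_singleton_iff] at hzt
      refine ⟨fun j => ?_, hzt⟩
      rcases eq_or_ne j (k, c) with rfl | hj
      · rwa [hzt]
      · simpa [hj] using hz j
    have hslab' : ∀ z ∈ cbox a b, realCoord z (k, c) = t →
        z ∈ cbox (Function.update a (k, c) t) (Function.update b (k, c) t) := by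
      intro z hz hzt j
      rcases eq_or_ne j (k, c) with rfl | hj
      · simp [hzt]
      · simpa [hj] using hz j
    obtain ⟨F, hF, hFh⟩ := exists_extension_from_graph
      (isClosed_polyhedron fun q hq => (hdL q hq).continuous) hS hp hr
      (a := Function.update a (k, c) t) (b := Function.update b (k, c) t) (f := h)
      (fun j => by
        rcases eq_or_ne j (k, c) with rfl | hj
        · simp
        · simpa [hj] using hab j)
      (fun y hy hpy => hh y ⟨(hmem y).2 ⟨hpy, hy.1⟩, (hslab y hy.2).1⟩ (hslab y hy.2).2)
    have hcoord : ∀ x : Option ι → ℂ, realCoord x (some k, c) = realCoord (baseMap x) (k, c) := by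
      intro x; cases c <;> rfl
    obtain ⟨F₁, F₂, hF₁, hF₂, hF₁₂⟩ := hS (extendBound (-r) a) (extendBound r b) (some k, c) t
      (extendBound_le hr hab) ht F fun x hx hxt => by
        obtain ⟨hxQ, hx⟩ := hx
        rw [mem_cbox_extendBound] at hx
        exact hF x ⟨hxQ, hslab' _ hx.1 (by rw [← hcoord, hxt])⟩ hx.2
    have hgr : ∀ y, AnalyticAt ℂ (graphMap p) y := fun y =>
      analyticAt_of_eventually_differentiableAt
        (Eventually.of_forall fun y => differentiable_graphMap hp y)
    have hmemg : ∀ z ∈ polyhedron r (p :: L) ∩ cbox a b,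
        graphMap p z ∈ baseMap ⁻¹' polyhedron r L ∩
          cbox (extendBound (-r) a) (extendBound r b) := by
      rintro z ⟨hz1, hz2⟩
      exact ⟨((hmem z).1 hz1).2, mem_cbox_extendBound.2 ⟨hz2, ((hmem z).1 hz1).1⟩⟩
    refine ⟨fun z => F₁ (graphMap p z), fun z => F₂ (graphMap p z), fun z hz hzt => ?_,
      fun z hz hzt => ?_, fun z hz hzt => ?_⟩
    · exact (hF₁ _ (hmemg z hz) (by rw [hcoord]; exact hzt)).fun_comp (hgr z)
    · exact (hF₂ _ (hmemg z hz) (by rw [hcoord]; exact hzt)).fun_comp (hgr z)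
    · have h1 := hF₁₂ _ (hmemg z hz) (by rw [hcoord]; exact hzt)
      have h2 := hFh z ⟨((hmem z).1 hz.1).2, hslab' z hz.2 hzt⟩ ((hmem z).1 hz.1).1
      filter_upwards [(hgr z).continuousAt.eventually h1, h2] with y hy1 hy2
      rw [← hy2, hy1]

/-- Oka's approximation theorem on polynomial polyhedra. -/
theorem exists_polynomial_approx_on_polyhedron {r : ℝ} (hr : 0 < r) {ε : ℝ} (hε : 0 < ε) (N : ℕ) :
    ∀ {ι : Type} [Fintype ι] (L : List ((ι → ℂ) → ℂ)), L.length = N →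
    (∀ p ∈ L, IsPolynomialFun p) → ∀ f : (ι → ℂ) → ℂ,
    (∀ z ∈ polyhedron r L ∩ cbox (fun _ => -r) (fun _ => r), AnalyticAt ℂ f z) →
    ∃ q : (ι → ℂ) → ℂ, IsPolynomialFun q ∧
      ∀ z, ‖z‖ ≤ r / 4 → (∀ p ∈ L, ‖p z‖ ≤ r / 4) → ‖f z - q z‖ < ε := by
  have hball : ∀ {ι : Type} [Fintype ι] (z : ι → ℂ), ‖z‖ ≤ r →
      z ∈ cbox (fun _ => -r) (fun _ => r) := by
    rintro ι _ z hz ⟨i, c⟩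
    have := mem_square_of_norm_le ((norm_le_pi_norm z i).trans hz)
    cases c
    exacts [this.1, this.2]
  induction N with
  | zero =>
    intro ι _ L hL _ f hf
    rw [List.length_eq_zero_iff.1 hL] at hf ⊢
    obtain ⟨q, hq, hqf⟩ := exists_polynomial_approx_on_ball hr (f := f) (fun z hz =>
      hf z ⟨by simp [polyhedron], hball z (mem_closedBall_zero_iff.1 hz)⟩) hε
    exact ⟨q, hq, fun z hz _ => hqf z (mem_closedBall_zero_iff.2 hz)⟩
  | succ N ih =>
    intro ι _ L hL hpol f hf
    obtain ⟨p, L, rfl⟩ := List.exists_cons_of_length_eq_add_one hL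
    have hL' : L.length = N := by simpa using hL
    have hp : IsPolynomialFun p := hpol p (by simp)
    have hpL : ∀ q ∈ L, IsPolynomialFun q := fun q hq => hpol q (by simp [hq])
    have hlift : ∀ q ∈ L.map (fun p (x : Option ι → ℂ) => p (baseMap x)), IsPolynomialFun q := by
      intro q hq
      obtain ⟨q', hq', rfl⟩ := List.mem_map.1 hq
      exact (hpL q' hq').comp (g := fun i x => x (some i)) fun i => isPolynomialFun_coord _
    have hS : Splits (baseMap ⁻¹' polyhedron r L) := by
      rw [baseMap_preimage_polyhedron]
      exact splits_polyhedron hr.le N _ (by simpa using hL') fun q hq =>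
        (hlift q hq).differentiable
    have hmem : ∀ z, z ∈ polyhedron r (p :: L) ↔ p z ∈ square r ∧ z ∈ polyhedron r L := by
      intro z; simp [polyhedron]
    obtain ⟨F, hF, hFf⟩ := exists_extension_from_graph
      (isClosed_polyhedron fun q hq => (hpL q hq).differentiable.continuous) hS hp.differentiable
      hr.le (a := fun _ => -r) (b := fun _ => r) (f := f) (fun _ => by simpa using by linarith)
      (fun y hy hpy => hf y ⟨(hmem y).2 ⟨hpy, hy.1⟩, hy.2⟩)
    have he : ∀ s : ℝ, extendBound s (fun _ : ι × Bool => s) = fun _ => s := fun s => by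
      ext ⟨_ | i, c⟩ <;> rfl
    obtain ⟨q, hq, hqF⟩ := ih (L.map fun p (x : Option ι → ℂ) => p (baseMap x))
      (by simpa using hL') hlift F (by
        rintro x ⟨hx1, hx2⟩
        rw [← baseMap_preimage_polyhedron] at hx1
        rw [← he r, ← he (-r), mem_cbox_extendBound] at hx2
        exact hF x ⟨hx1, hx2.1⟩ hx2.2)
    refine ⟨fun z => q (graphMap p z), hq.comp (g := fun o z => graphMap p z o) ?_,
      fun z hz hzp => ?_⟩
    · rintro (_ | i)
      exacts [hp, isPolynomialFun_coord i]
    · have hr4 : r / 4 ≤ r := by linarith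
      have hz1 : z ∈ polyhedron r L := fun g hg =>
        mem_square_of_norm_le ((hzp g (by simp [hg])).trans hr4)
      have h1 := (hFf z ⟨hz1, hball z (hz.trans hr4)⟩
        (mem_square_of_norm_le ((hzp p (by simp)).trans hr4))).self_of_nhds
      rw [← h1]
      refine hqF _ ?_ ?_
      · rw [pi_norm_le_iff_of_nonneg (by positivity)]
        rintro (_ | i)
        · exact hzp p (by simp)
        · exact (norm_le_pi_norm z i).trans hz
      · intro g hg
        obtain ⟨g', hg', rfl⟩ := List.mem_map.1 hg
        exact hzp g' (by simp [hg'])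

end Polyhedra

section OkaWeil

variable {n : ℕ}

/-- A vector field on `ℂⁿ` with polynomial components. -/
def IsPolynomialField (V : EuclideanSpace ℂ (Fin n) → EuclideanSpace ℂ (Fin n)) : Prop :=
  ∀ i, ∃ P : MvPolynomial (Fin n) ℂ, ∀ z, V z i = MvPolynomial.eval (fun j => z j) P

/-- Points off a polynomially convex set are separated from it by a polynomial, with any
prescribed bounds. -/
theorem exists_polynomial_separating {K : Set (EuclideanSpace ℂ (Fin n))}
    (hK : IsPolynomiallyConvex K) {w : EuclideanSpace ℂ (Fin n)} (hw : w ∉ K) {r : ℝ} (hr : 0 < r) :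
    ∃ q : (Fin n → ℂ) → ℂ, IsPolynomialFun q ∧ (∀ z ∈ K, ‖q (fun i => z i)‖ < r / 4) ∧
      2 * r < ‖q fun i => w i‖ := by
  obtain ⟨p, c, hc, hpK, hpw⟩ : ∃ (p : MvPolynomial (Fin n) ℂ) (c : ℝ), 0 ≤ c ∧
      (∀ z ∈ K, ‖MvPolynomial.eval (fun i => z i) p‖ ≤ c) ∧
      c < ‖MvPolynomial.eval (fun i => w i) p‖ := by
    rw [← hK] at hw
    have hw' : ¬ ∀ p : MvPolynomial (Fin n) ℂ, ∀ c : ℝ,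
      (∀ w ∈ K, ‖MvPolynomial.eval (fun i => w i) p‖ ≤ c) →
      ‖MvPolynomial.eval (fun i => w i) p‖ ≤ c := hw
    push Not at hw'
    obtain ⟨p, c, h1, h2⟩ := hw'
    rcases K.eq_empty_or_nonempty with rfl | ⟨z, hz⟩
    · exact ⟨1, 0, le_rfl, by simp, by simp⟩
    · exact ⟨p, c, (norm_nonneg _).trans (h1 z hz), h1, h2⟩
  set s := ‖MvPolynomial.eval (fun i => w i) p‖ with hs
  have hs0 : 0 < s := hc.trans_lt hpw
  obtain ⟨m, hm⟩ := exists_pow_lt_of_lt_one (show (0 : ℝ) < 1 / 16 by norm_num)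
    ((div_lt_one hs0).2 hpw)
  have key : ∀ z : Fin n → ℂ, ‖MvPolynomial.eval z
      (MvPolynomial.C ((3 * r : ℝ) : ℂ) * (MvPolynomial.C ((s⁻¹ : ℝ) : ℂ) * p) ^ m)‖ =
      3 * r * (‖MvPolynomial.eval z p‖ / s) ^ m := fun z => by
    rw [map_mul, map_pow, map_mul, MvPolynomial.eval_C, MvPolynomial.eval_C, norm_mul, norm_pow,
      norm_mul, Complex.norm_real, Complex.norm_real, Real.norm_of_nonneg (by positivity),
      Real.norm_of_nonneg (by positivity), inv_mul_eq_div]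
  refine ⟨fun z => MvPolynomial.eval z
    (MvPolynomial.C ((3 * r : ℝ) : ℂ) * (MvPolynomial.C ((s⁻¹ : ℝ) : ℂ) * p) ^ m),
    ⟨_, fun _ => rfl⟩, fun z hz => ?_, ?_⟩
  · rw [key]
    have : (‖MvPolynomial.eval (fun i => z i) p‖ / s) ^ m ≤ (c / s) ^ m := by
      gcongr
      exact hpK z hz
    nlinarith
  · rw [key, ← hs, div_self hs0.ne', one_pow]
    linarith

/-- The Oka–Weil approximation theorem. -/
theorem exists_polynomialField_approx {K : Set (EuclideanSpace ℂ (Fin n))} (hKc : IsCompact K)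
    (hK : IsPolynomiallyConvex K) {U : Set (EuclideanSpace ℂ (Fin n))} (hU : IsOpen U)
    (hKU : K ⊆ U) :
    ∃ P : Set (EuclideanSpace ℂ (Fin n)), IsCompact P ∧ K ⊆ interior P ∧ P ⊆ U ∧
      ∀ f : EuclideanSpace ℂ (Fin n) → EuclideanSpace ℂ (Fin n), DifferentiableOn ℂ f U →
      ∀ η > 0, ∃ Q : EuclideanSpace ℂ (Fin n) → EuclideanSpace ℂ (Fin n),
        IsPolynomialField Q ∧ ∀ z ∈ P, ‖f z - Q z‖ < η := by
  set e := EuclideanSpace.equiv (Fin n) ℂ with he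
  obtain ⟨b, hb⟩ := (hKc.image e.continuous).isBounded.exists_norm_le
  set r := 4 * (|b| + 1) with hr
  have hr0 : 0 < r := by positivity
  have hbK : ∀ z ∈ K, ‖e z‖ < r / 4 := fun z hz => by
    have := hb _ (mem_image_of_mem e hz)
    have := le_abs_self b
    linarith
  have hC : IsCompact (cbox (fun _ : Fin n × Bool => -r) (fun _ => r) \ e.symm ⁻¹' U) :=
    (isCompact_cbox _ _).diff (hU.preimage e.symm.continuous)
  have hsep : ∀ w : {w // w ∉ e.symm ⁻¹' U}, ∃ q : (Fin n → ℂ) → ℂ, IsPolynomialFun q ∧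
      (∀ z ∈ K, ‖q (e z)‖ < r / 4) ∧ 2 * r < ‖q w‖ := fun w =>
    exists_polynomial_separating hK (w := e.symm w) (fun h => w.2 (hKU h)) hr0
  choose q hq1 hq2 hq3 using hsep
  obtain ⟨t, ht⟩ := hC.elim_finite_subcover (fun w => {z | 2 * r < ‖q w z‖})
    (fun w => isOpen_lt continuous_const (hq1 w).differentiable.continuous.norm)
    (fun w hw => mem_iUnion.2 ⟨⟨w, hw.2⟩, hq3 ⟨w, hw.2⟩⟩)
  set L := t.toList.map q with hL
  have hmem : ∀ {p}, p ∈ L ↔ ∃ w ∈ t, q w = p := by simp [hL]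
  have hLp : ∀ p ∈ L, IsPolynomialFun p := fun p hp => by
    obtain ⟨w, -, rfl⟩ := hmem.1 hp
    exact hq1 w
  have hLU : ∀ z ∈ polyhedron r L ∩ cbox (fun _ => -r) (fun _ => r), e.symm z ∈ U := by
    intro z hz
    by_contra hzU
    obtain ⟨w, hw, hwz⟩ := mem_iUnion₂.1 (ht ⟨hz.2, hzU⟩)
    have h1 := hz.1 (q w) (hmem.2 ⟨w, hw, rfl⟩)
    have h2 : 2 * r < ‖q w z‖ := hwz
    have h3 := abs_le.2 h1.1
    have h4 := abs_le.2 h1.2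
    have := Complex.norm_le_abs_re_add_abs_im (q w z)
    linarith
  have hcl : IsClosed {z | ‖e z‖ ≤ r / 4 ∧ ∀ p ∈ L, ‖p (e z)‖ ≤ r / 4} := by
    have : {z | ‖e z‖ ≤ r / 4 ∧ ∀ p ∈ L, ‖p (e z)‖ ≤ r / 4} =
        {z | ‖e z‖ ≤ r / 4} ∩ ⋂ p, ⋂ _ : p ∈ L, {z | ‖p (e z)‖ ≤ r / 4} := by
      ext z; simp
    rw [this]
    exact (isClosed_le e.continuous.norm continuous_const).inter
      (isClosed_iInter fun p => isClosed_iInter fun hp => isClosed_le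
        ((hLp p hp).differentiable.continuous.comp e.continuous).norm continuous_const)
  have hop : IsOpen {z | ‖e z‖ < r / 4 ∧ ∀ p ∈ L, ‖p (e z)‖ < r / 4} := by
    have : {z | ‖e z‖ < r / 4 ∧ ∀ p ∈ L, ‖p (e z)‖ < r / 4} =
        {z | ‖e z‖ < r / 4} ∩ ⋂ p ∈ {p | p ∈ L}, {z | ‖p (e z)‖ < r / 4} := by
      ext z; simp
    rw [this]
    exact (isOpen_lt e.continuous.norm continuous_const).inter
      ((List.finite_toSet L).isOpen_biInter fun p hp => isOpen_lt
        ((hLp p hp).differentiable.continuous.comp e.continuous).norm continuous_const)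
  have hcomp : IsCompact {z | ‖e z‖ ≤ r / 4 ∧ ∀ p ∈ L, ‖p (e z)‖ ≤ r / 4} := by
    refine ((isCompact_closedBall (0 : Fin n → ℂ) (r / 4)).image
      e.symm.continuous).of_isClosed_subset hcl fun z hz => ⟨e z, ?_, e.symm_apply_apply z⟩
    rw [mem_closedBall_zero_iff]
    exact hz.1
  have hPU : {z | ‖e z‖ ≤ r / 4 ∧ ∀ p ∈ L, ‖p (e z)‖ ≤ r / 4} ⊆ U := fun z hz => by
    have hr4 : r / 4 ≤ r := by linarith
    have := hLU (e z) ⟨fun p hp => mem_square_of_norm_le ((hz.2 p hp).trans hr4), ?_⟩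
    · rwa [e.symm_apply_apply] at this
    · rintro ⟨i, c⟩
      have := mem_square_of_norm_le ((norm_le_pi_norm (e z) i).trans (hz.1.trans hr4))
      cases c
      exacts [this.1, this.2]
  refine ⟨_, hcomp, fun z hz => ?_, hPU, fun f hf η hη => ?_⟩
  · refine interior_maximal (fun z hz => ?_) hop (show z ∈ _ from ⟨hbK z hz, fun p hp => ?_⟩)
    · exact ⟨hz.1.le, fun p hp => (hz.2 p hp).le⟩
    · obtain ⟨w, -, rfl⟩ := hmem.1 hp
      exact hq2 w z hz
  · set η' := η / (‖(e.symm : (Fin n → ℂ) →L[ℂ] EuclideanSpace ℂ (Fin n))‖ + 1) with hη'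
    have hη'0 : 0 < η' := by positivity
    have happ : ∀ i, ∃ g : (Fin n → ℂ) → ℂ, IsPolynomialFun g ∧
        ∀ z, ‖z‖ ≤ r / 4 → (∀ p ∈ L, ‖p z‖ ≤ r / 4) → ‖f (e.symm z) i - g z‖ < η' := by
      intro i
      refine exists_polynomial_approx_on_polyhedron hr0 hη'0 L.length L rfl hLp
        (fun z => f (e.symm z) i) fun z hz => ?_
      have h1 := analyticOnNhd_of_differentiableOn hU hf (e.symm z) (hLU z hz)
      have h2 : AnalyticAt ℂ (fun z => f (e.symm z)) z :=
        h1.fun_comp (e.symm.toContinuousLinearMap.analyticAt z)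
      exact ((EuclideanSpace.proj i : EuclideanSpace ℂ (Fin n) →L[ℂ] ℂ).analyticAt _).fun_comp h2
    choose g hg1 hg2 using happ
    refine ⟨fun z => e.symm fun i => g i (e z), fun i => ?_, fun z hz => ?_⟩
    · obtain ⟨P, hP⟩ := hg1 i
      exact ⟨P, fun z => hP (e z)⟩
    · have h1 : ‖e (f z) - fun i => g i (e z)‖ ≤ η' := by
        rw [pi_norm_le_iff_of_nonneg hη'0.le]
        intro i
        have := hg2 i (e z) hz.1 hz.2
        rw [e.symm_apply_apply] at this
        exact this.le
      have h2 : f z - e.symm (fun i => g i (e z)) = e.symm (e (f z) - fun i => g i (e z)) := by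
        rw [map_sub, e.symm_apply_apply]
      rw [h2]
      refine ((e.symm : (Fin n → ℂ) →L[ℂ] EuclideanSpace ℂ (Fin n)).le_opNorm _).trans_lt ?_
      calc ‖(e.symm : (Fin n → ℂ) →L[ℂ] EuclideanSpace ℂ (Fin n))‖ * _
          ≤ ‖(e.symm : (Fin n → ℂ) →L[ℂ] EuclideanSpace ℂ (Fin n))‖ * η' := by gcongr
        _ < (‖(e.symm : (Fin n → ℂ) →L[ℂ] EuclideanSpace ℂ (Fin n))‖ + 1) * η' := by
          nlinarith
        _ = η := by rw [hη']; field_simp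

end OkaWeil

section Shears

variable {n : ℕ}

theorem isHolomorphicAutomorphism_id :
    IsHolomorphicAutomorphism (fun z : EuclideanSpace ℂ (Fin n) => z) :=
  ⟨differentiable_id, fun z => z, differentiable_id, fun _ => rfl, fun _ => rfl⟩

theorem _root_.IsHolomorphicAutomorphism.comp
    {F G : EuclideanSpace ℂ (Fin n) → EuclideanSpace ℂ (Fin n)}
    (hF : IsHolomorphicAutomorphism F) (hG : IsHolomorphicAutomorphism G) :
    IsHolomorphicAutomorphism fun z => F (G z) := by
  obtain ⟨hF, F', hF', h1, h2⟩ := hF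
  obtain ⟨hG, G', hG', h3, h4⟩ := hG
  exact ⟨hF.comp hG, fun z => G' (F' z), hG'.comp hF', fun z => by simp [h1, h3],
    fun z => by simp [h2, h4]⟩

/-- Vector fields whose Euler steps are approximated to first order by automorphisms. -/
def HasAutomorphismSteps (V : EuclideanSpace ℂ (Fin n) → EuclideanSpace ℂ (Fin n)) : Prop :=
  Continuous V ∧ ∀ R η : ℝ, 0 < η → ∃ h₀ > 0, ∀ h : ℝ, 0 < h → h < h₀ →
    ∃ A, IsHolomorphicAutomorphism A ∧ ∀ z, ‖z‖ ≤ R → ‖A z - z - (h : ℂ) • V z‖ ≤ η * h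

theorem hasAutomorphismSteps_zero :
    HasAutomorphismSteps (fun _ : EuclideanSpace ℂ (Fin n) => (0 : EuclideanSpace ℂ (Fin n))) :=
  ⟨continuous_const, fun _ η hη => ⟨1, one_pos, fun h hh _ =>
    ⟨_, isHolomorphicAutomorphism_id, fun z _ => by simpa using by positivity⟩⟩⟩

theorem exists_norm_le_of_continuous {V : EuclideanSpace ℂ (Fin n) → EuclideanSpace ℂ (Fin n)}
    (hV : Continuous V) (R : ℝ) : ∃ M > 0, ∀ z, ‖z‖ ≤ R → ‖V z‖ ≤ M := by
  obtain ⟨M, hM⟩ := ((isCompact_closedBall (0 : EuclideanSpace ℂ (Fin n)) R).image hV).isBounded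
    |>.exists_norm_le
  exact ⟨|M| + 1, by positivity, fun z hz =>
    (hM _ (mem_image_of_mem V (mem_closedBall_zero_iff.2 hz))).trans
      ((le_abs_self M).trans (by linarith))⟩

theorem HasAutomorphismSteps.add {V W : EuclideanSpace ℂ (Fin n) → EuclideanSpace ℂ (Fin n)}
    (hV : HasAutomorphismSteps V) (hW : HasAutomorphismSteps W) :
    HasAutomorphismSteps fun z => V z + W z := by
  refine ⟨hV.1.add hW.1, fun R η hη => ?_⟩
  obtain ⟨M, hM0, hM⟩ := exists_norm_le_of_continuous hV.1 R
  have huc : UniformContinuousOn W (closedBall 0 (R + 1)) :=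
    (isCompact_closedBall _ _).uniformContinuousOn_of_continuous hW.1.continuousOn
  obtain ⟨δ, hδ, hδW⟩ := Metric.uniformContinuousOn_iff.1 huc (η / 3) (by positivity)
  obtain ⟨a, ha, hA⟩ := hV.2 R (η / 3) (by positivity)
  obtain ⟨b, hb, hB⟩ := hW.2 (R + 1) (η / 3) (by positivity)
  set c := min 1 δ / (M + η / 3) with hc
  have hc0 : 0 < c := by positivity
  refine ⟨min (min a b) c, by positivity, fun h hh hlt => ?_⟩
  obtain ⟨⟨hha, hhb⟩, hhc⟩ := (lt_min_iff.1 hlt).imp_left lt_min_iff.1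
  obtain ⟨A, hA1, hA2⟩ := hA h hh hha
  obtain ⟨B, hB1, hB2⟩ := hB h hh hhb
  refine ⟨_, hB1.comp hA1, fun z hz => ?_⟩
  have h1 := hA2 z hz
  have hnh : ‖(h : ℂ)‖ = h := by rw [Complex.norm_real, Real.norm_of_nonneg hh.le]
  have h2 : ‖A z - z‖ < min 1 δ := by
    calc ‖A z - z‖ = ‖(A z - z - (h : ℂ) • V z) + (h : ℂ) • V z‖ := by rw [sub_add_cancel]
      _ ≤ η / 3 * h + h * M := by
        refine (norm_add_le _ _).trans (add_le_add h1 ?_)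
        rw [norm_smul, hnh]
        exact mul_le_mul_of_nonneg_left (hM z hz) hh.le
      _ = h * (M + η / 3) := by ring
      _ < min 1 δ := (lt_div_iff₀ (by positivity)).1 hhc
  obtain ⟨h2a, h2b⟩ := lt_min_iff.1 h2
  have h3 : ‖A z‖ ≤ R + 1 := by
    have := norm_le_norm_add_norm_sub' (A z) z
    linarith
  have h4 := hB2 (A z) h3
  have h5 : ‖W (A z) - W z‖ < η / 3 := by
    rw [← dist_eq_norm]
    exact hδW _ (mem_closedBall_zero_iff.2 h3) _ (mem_closedBall_zero_iff.2 (by linarith))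
      (by rwa [dist_eq_norm])
  have : B (A z) - z - (h : ℂ) • (V z + W z) = (B (A z) - A z - (h : ℂ) • W (A z)) +
      (A z - z - (h : ℂ) • V z) + (h : ℂ) • (W (A z) - W z) := by
    rw [smul_add, smul_sub]; abel
  rw [this]
  refine (norm_add₃_le).trans ?_
  rw [norm_smul, hnh]
  nlinarith

theorem HasAutomorphismSteps.of_approx {V : EuclideanSpace ℂ (Fin n) → EuclideanSpace ℂ (Fin n)}
    (hV : Continuous V)
    (h : ∀ R η : ℝ, 0 < η → ∃ W, HasAutomorphismSteps W ∧ ∀ z, ‖z‖ ≤ R → ‖W z - V z‖ ≤ η) :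
    HasAutomorphismSteps V := by
  refine ⟨hV, fun R η hη => ?_⟩
  obtain ⟨W, hW, hWV⟩ := h R (η / 2) (by positivity)
  obtain ⟨h₀, hh₀, hA⟩ := hW.2 R (η / 2) (by positivity)
  refine ⟨h₀, hh₀, fun h hh hlt => ?_⟩
  obtain ⟨A, hA1, hA2⟩ := hA h hh hlt
  refine ⟨A, hA1, fun z hz => ?_⟩
  have h1 := hA2 z hz
  have h2 := hWV z hz
  have : A z - z - (h : ℂ) • V z = (A z - z - (h : ℂ) • W z) + (h : ℂ) • (W z - V z) := by
    rw [smul_sub]; abel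
  rw [this]
  refine (norm_add_le _ _).trans ?_
  rw [norm_smul, Complex.norm_real, Real.norm_of_nonneg hh.le]
  nlinarith

theorem HasAutomorphismSteps.of_family
    {G : ℝ → EuclideanSpace ℂ (Fin n) → EuclideanSpace ℂ (Fin n)}
    (hG : Continuous (Function.uncurry G)) (h : ∀ t > 0, HasAutomorphismSteps (G t)) :
    HasAutomorphismSteps (G 0) := by
  refine .of_approx (hG.comp (Continuous.prodMk_right 0)) fun R η hη => ?_
  obtain ⟨w, hw, hw2⟩ := (isCompact_closedBall (0 : EuclideanSpace ℂ (Fin n)) R).mem_uniformity_of_prod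
    (f := G) (s := univ) hG.continuousOn (mem_univ 0) (Metric.dist_mem_uniformity hη)
  rw [nhdsWithin_univ] at hw
  obtain ⟨r, hr, hrw⟩ := Metric.mem_nhds_iff.1 hw
  refine ⟨G (r / 2), h _ (by positivity), fun z hz => ?_⟩
  have h1 : r / 2 ∈ w := hrw (by
    rw [mem_ball_zero_iff, Real.norm_of_nonneg (by positivity)]; linarith)
  have := hw2 _ h1 z (mem_closedBall_zero_iff.2 hz)
  rw [← dist_eq_norm]
  exact (show dist (G (r / 2) z) (G 0 z) < η from this).le

theorem HasAutomorphismSteps.sum {κ : Type*} (s : Finset κ)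
    {V : κ → EuclideanSpace ℂ (Fin n) → EuclideanSpace ℂ (Fin n)}
    (hV : ∀ k ∈ s, HasAutomorphismSteps (V k)) :
    HasAutomorphismSteps fun z => ∑ k ∈ s, V k z := by
  classical
  induction s using Finset.induction_on with
  | empty => simpa using hasAutomorphismSteps_zero
  | insert k s hk ih =>
    simp only [Finset.sum_insert hk]
    exact (hV k (by simp)).add (ih fun j hj => hV j (by simp [hj]))

theorem hasAutomorphismSteps_shear (c : ℂ) (l : EuclideanSpace ℂ (Fin n) →L[ℂ] ℂ)
    {v : EuclideanSpace ℂ (Fin n)} (hv : l v = 0) :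
    HasAutomorphismSteps fun z => (c * Complex.exp (l z)) • v := by
  refine ⟨by fun_prop, fun R η hη => ⟨1, one_pos, fun h hh _ => ?_⟩⟩
  refine ⟨fun z => z + (h * (c * Complex.exp (l z))) • v, ⟨by fun_prop,
    fun z => z - (h * (c * Complex.exp (l z))) • v, by fun_prop, fun z => ?_, fun z => ?_⟩,
    fun z _ => ?_⟩
  · simp [hv]
  · simp [hv]
  · rw [add_sub_cancel_left, mul_smul, sub_self, norm_zero]
    positivity

theorem hasAutomorphismSteps_overshear (c : ℂ) {l m : EuclideanSpace ℂ (Fin n) →L[ℂ] ℂ}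
    {v : EuclideanSpace ℂ (Fin n)} (hv : l v = 0) (hm : m v = 1) :
    HasAutomorphismSteps fun z => (c * Complex.exp (l z) * m z) • v := by
  refine ⟨by fun_prop, fun R η hη => ?_⟩
  obtain ⟨M, hM⟩ := ((isCompact_closedBall (0 : EuclideanSpace ℂ (Fin n)) R).image
    (f := fun z => c * Complex.exp (l z)) (by fun_prop)).isBounded.exists_norm_le
  obtain ⟨N, hN⟩ := ((isCompact_closedBall (0 : EuclideanSpace ℂ (Fin n)) R).image
    (f := fun z => m z • v) (by fun_prop)).isBounded.exists_norm_le
  have hM' : ∀ z, ‖z‖ ≤ R → ‖c * Complex.exp (l z)‖ ≤ |M| + 1 := fun z hz =>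
    (hM _ (mem_image_of_mem _ (mem_closedBall_zero_iff.2 hz))).trans
      ((le_abs_self M).trans (by linarith))
  have hN' : ∀ z, ‖z‖ ≤ R → ‖m z • v‖ ≤ |N| + 1 := fun z hz =>
    (hN _ (mem_image_of_mem _ (mem_closedBall_zero_iff.2 hz))).trans
      ((le_abs_self N).trans (by linarith))
  refine ⟨min (1 / (|M| + 1)) (η / ((|M| + 1) ^ 2 * (|N| + 1))), by positivity, fun h hh hlt => ?_⟩
  obtain ⟨hl1, hl2⟩ := lt_min_iff.1 hlt
  refine ⟨fun z => z + ((Complex.exp (h * (c * Complex.exp (l z))) - 1) * m z) • v, ⟨by fun_prop,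
    fun z => z + ((Complex.exp (-(h * (c * Complex.exp (l z)))) - 1) * m z) • v, by fun_prop,
    fun z => ?_, fun z => ?_⟩, fun z hz => ?_⟩
  · have := Complex.exp_ne_zero (h * (c * Complex.exp (l z)))
    simp only [map_add, map_smul, hv, mul_zero, add_zero, hm, smul_eq_mul, mul_one,
      Complex.exp_neg]
    generalize Complex.exp (h * (c * Complex.exp (l z))) = w at this ⊢
    rw [add_assoc, ← add_smul]
    convert add_zero z
    rw [smul_eq_zero]
    left
    field_simp
    ring
  · have := Complex.exp_ne_zero (h * (c * Complex.exp (l z)))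
    simp only [map_add, map_smul, hv, mul_zero, add_zero, hm, smul_eq_mul, mul_one,
      Complex.exp_neg]
    generalize Complex.exp (h * (c * Complex.exp (l z))) = w at this ⊢
    rw [add_assoc, ← add_smul]
    convert add_zero z
    rw [smul_eq_zero]
    left
    field_simp
    ring
  · set w := c * Complex.exp (l z) with hw
    have hwM := hM' z hz
    have e1 : z + ((Complex.exp (h * w) - 1) * m z) • v - z - (h : ℂ) • (w * m z) • v =
        (Complex.exp (h * w) - 1 - h * w) • m z • v := by
      rw [add_sub_cancel_left, smul_smul, smul_smul, ← sub_smul]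
      ring_nf
    have e2 : ‖(h : ℂ) * w‖ ≤ h * (|M| + 1) := by
      rw [norm_mul, Complex.norm_real, Real.norm_of_nonneg hh.le]
      gcongr
    have e3 : h * (|M| + 1) ≤ 1 := ((lt_div_iff₀ (by positivity)).1 hl1).le
    rw [e1, norm_smul]
    calc _ ≤ (h * (|M| + 1)) ^ 2 * (|N| + 1) := by
          refine mul_le_mul ((Complex.norm_exp_sub_one_sub_id_le (e2.trans e3)).trans ?_)
            (hN' z hz) (norm_nonneg _) (by positivity)
          gcongr
      _ = h * (h * ((|M| + 1) ^ 2 * (|N| + 1))) := by ring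
      _ ≤ h * η := by
          gcongr
          exact ((lt_div_iff₀ (by positivity)).1 hl2).le
      _ = η * h := mul_comm _ _

/-- The entire function `(exp x - 1) / x`. -/
def expQuotient : ℂ → ℂ := dslope Complex.exp 0

theorem continuous_expQuotient : Continuous expQuotient := by
  rw [← continuousOn_univ, expQuotient, continuousOn_dslope univ_mem]
  exact ⟨Complex.continuous_exp.continuousOn, Complex.differentiable_exp 0⟩

theorem expQuotient_zero : expQuotient 0 = 1 := by
  simp [expQuotient]

theorem mul_expQuotient (x : ℂ) : x * expQuotient x = Complex.exp x - 1 := by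
  have := sub_smul_dslope Complex.exp 0 x
  simpa [expQuotient] using this

theorem hasAutomorphismSteps_exp (hn : 2 ≤ n) (c : ℂ) (l : EuclideanSpace ℂ (Fin n) →L[ℂ] ℂ)
    (u : EuclideanSpace ℂ (Fin n)) :
    HasAutomorphismSteps fun z => (c * Complex.exp (l z)) • u := by
  by_cases hu : l u = 0
  · exact hasAutomorphismSteps_shear c l hu
  suffices H : ∀ (c : ℂ) (u : EuclideanSpace ℂ (Fin n)), l u = 1 →
      HasAutomorphismSteps fun z => (c * Complex.exp (l z)) • u by
    have := H (c * l u) ((l u)⁻¹ • u) (by simp [hu])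
    convert this using 2 with z
    rw [smul_smul]
    congr 1
    field_simp
  clear hu u c
  intro c u hu
  obtain ⟨v, hv, hv0⟩ : ∃ v, l v = 0 ∧ v ≠ 0 := by
    have : LinearMap.ker (l : EuclideanSpace ℂ (Fin n) →ₗ[ℂ] ℂ) ≠ ⊥ :=
      LinearMap.ker_ne_bot_of_finrank_lt (by simp; omega)
    obtain ⟨v, hv, hv0⟩ := Submodule.exists_mem_ne_zero_of_ne_bot this
    exact ⟨v, hv, hv0⟩
  obtain ⟨ν, hν⟩ := SeparatingDual.exists_eq_one (R := ℂ) hv0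
  set m := ν - ν u • l with hm
  have hmu : m u = 0 := by simp [hm, hu]
  have hmv : m v = 1 := by simp [hm, hv, hν]
  have hfam := HasAutomorphismSteps.of_family
    (G := fun (t : ℝ) z => (c * Complex.exp (l z)) • (Complex.exp (t * m z) • u -
      (m z * expQuotient (t * m z)) • v)) (by
      have := continuous_expQuotient
      simp only [Function.uncurry_def]
      fun_prop) (fun t ht => by
      have ht' : (t : ℂ) ≠ 0 := by exact_mod_cast ht.ne'
      have h1 := hasAutomorphismSteps_shear (c / t) (l + (t : ℂ) • m) (v := (t : ℂ) • u - v)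
        (by simp [hu, hv, hmu, hmv])
      have h2 := hasAutomorphismSteps_shear (c / t) l hv
      convert h1.add h2 using 2 with z
      have h3 : m z * expQuotient (t * m z) = (Complex.exp (t * m z) - 1) / t := by
        rw [← mul_expQuotient]
        field_simp
      rw [h3]
      simp only [add_apply, smul_apply, smul_eq_mul,
        Complex.exp_add, smul_sub, smul_smul]
      rw [sub_add, ← sub_smul]
      congr 2 <;> field_simp)
  have hover := hasAutomorphismSteps_overshear c hv hmv
  convert hfam.add hover using 2 with z
  simp only [Complex.ofReal_zero, zero_mul, Complex.exp_zero, expQuotient_zero, one_smul, mul_one,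
    smul_sub, smul_smul, sub_add_cancel]

theorem hasAutomorphismSteps_polynomial (hn : 2 ≤ n) (P : MvPolynomial (Fin n) ℂ) :
    ∀ (c : ℂ) (l : EuclideanSpace ℂ (Fin n) →L[ℂ] ℂ) (u : EuclideanSpace ℂ (Fin n)),
    HasAutomorphismSteps fun z =>
      (c * MvPolynomial.eval (fun j => z j) P * Complex.exp (l z)) • u := by
  induction P using MvPolynomial.induction_on with
  | C a =>
    intro c l u
    simpa using hasAutomorphismSteps_exp hn (c * a) l u
  | add p q hp hq =>
    intro c l u
    convert (hp c l u).add (hq c l u) using 2 with z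
    rw [← add_smul, map_add]
    ring_nf
  | mul_X p i hp =>
    intro c l u
    have hpc : Continuous fun z : EuclideanSpace ℂ (Fin n) => MvPolynomial.eval (fun j => z j) p :=
      (MvPolynomial.continuous_eval p).comp (by fun_prop)
    have hfam := HasAutomorphismSteps.of_family
      (G := fun (t : ℝ) z => (c * MvPolynomial.eval (fun j => z j) p * Complex.exp (l z) *
        (z i * expQuotient (t * z i))) • u) (by
        have := continuous_expQuotient
        have := hpc.comp (continuous_snd (X := ℝ))
        simp only [Function.comp_def] at this
        simp only [Function.uncurry_def]
        fun_prop) (fun t ht => by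
        have ht' : (t : ℂ) ≠ 0 := by exact_mod_cast ht.ne'
        convert (hp (c / t) (l + (t : ℂ) • EuclideanSpace.proj i) u).add (hp (-c / t) l u)
          using 2 with z
        have h3 : z i * expQuotient (t * z i) = (Complex.exp (t * z i) - 1) / t := by
          rw [← mul_expQuotient]
          field_simp
        rw [h3, ← add_smul]
        simp only [add_apply, smul_apply, smul_eq_mul,
          Complex.exp_add, EuclideanSpace.proj, PiLp.proj_apply]
        congr 1
        field_simp
        ring)
    convert hfam using 2 with z
    simp only [map_mul, MvPolynomial.eval_X, Complex.ofReal_zero, zero_mul, expQuotient_zero]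
    ring_nf

theorem IsPolynomialField.hasAutomorphismSteps (hn : 2 ≤ n)
    {V : EuclideanSpace ℂ (Fin n) → EuclideanSpace ℂ (Fin n)} (hV : IsPolynomialField V) :
    HasAutomorphismSteps V := by
  choose P hP using hV
  have := HasAutomorphismSteps.sum Finset.univ fun i _ =>
    hasAutomorphismSteps_polynomial hn (P i) 1 0 (EuclideanSpace.single i 1)
  convert this using 2 with z
  ext j
  simp [hP, Pi.single_apply]

end Shears

section Flow

variable {n : ℕ}

/-- Uniformity in time of the approximation of Euler steps by automorphisms. -/
theorem exists_uniform_automorphism_steps {P : Set (EuclideanSpace ℂ (Fin n))}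
    (hP : Bornology.IsBounded P) {V : ℝ → EuclideanSpace ℂ (Fin n) → EuclideanSpace ℂ (Fin n)}
    {C : ℝ} (hC : 0 ≤ C)
    (hVs : ∀ s ∈ Icc (0 : ℝ) 1, ∀ s' ∈ Icc (0 : ℝ) 1, ∀ y ∈ P, ‖V s y - V s' y‖ ≤ C * |s - s'|)
    (hVa : ∀ s ∈ Icc (0 : ℝ) 1, ∀ η > 0, ∃ W, HasAutomorphismSteps W ∧ ∀ y ∈ P, ‖V s y - W y‖ < η)
    {η : ℝ} (hη : 0 < η) :
    ∃ h₀ > 0, ∀ s ∈ Icc (0 : ℝ) 1, ∀ h : ℝ, 0 < h → h < h₀ →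
      ∃ A, IsHolomorphicAutomorphism A ∧ ∀ y ∈ P, ‖A y - y - (h : ℂ) • V s y‖ ≤ η * h := by
  obtain ⟨R, hR⟩ := hP.exists_norm_le
  refine isCompact_Icc.induction_on (p := fun S : Set ℝ => ∃ h₀ > (0 : ℝ), ∀ s ∈ S,
    ∀ h : ℝ, 0 < h → h < h₀ →
      ∃ A, IsHolomorphicAutomorphism A ∧ ∀ y ∈ P, ‖A y - y - (h : ℂ) • V s y‖ ≤ η * h)
    ⟨1, one_pos, by simp⟩ ?_ ?_ ?_
  · rintro s t hst ⟨h₀, hh₀, h⟩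
    exact ⟨h₀, hh₀, fun x hx => h x (hst hx)⟩
  · rintro s t ⟨a, ha, hA⟩ ⟨b, hb, hB⟩
    refine ⟨min a b, lt_min ha hb, fun x hx h hh hlt => ?_⟩
    obtain ⟨h1, h2⟩ := lt_min_iff.1 hlt
    rcases hx with hx | hx
    exacts [hA x hx h hh h1, hB x hx h hh h2]
  · intro s hs
    obtain ⟨W, hW, hWV⟩ := hVa s hs (η / 3) (by positivity)
    obtain ⟨h₀, hh₀, hA⟩ := hW.2 R (η / 3) (by positivity)
    set d := η / (3 * (C + 1)) with hd
    have hd0 : 0 < d := by positivity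
    have hCd : C * d ≤ η / 3 := by
      rw [hd, mul_div_assoc', div_le_div_iff₀ (by positivity) (by positivity)]
      nlinarith
    refine ⟨Icc 0 1 ∩ ball s d, inter_mem_nhdsWithin _ (ball_mem_nhds _ hd0), h₀, hh₀, ?_⟩
    rintro s' ⟨hs', hss'⟩ h hh hlt
    obtain ⟨A, hA1, hA2⟩ := hA h hh hlt
    refine ⟨A, hA1, fun y hy => ?_⟩
    have h1 := hA2 y (hR y hy)
    have h2 := hWV y hy
    have hsd : |s - s'| ≤ d := by
      rw [← Real.dist_eq, dist_comm]
      exact (mem_ball.1 hss').le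
    have h3 := (hVs s hs s' hs' y hy).trans (mul_le_mul_of_nonneg_left hsd hC)
    have e : A y - y - (h : ℂ) • V s' y = (A y - y - (h : ℂ) • W y) +
        (h : ℂ) • ((V s y - V s' y) - (V s y - W y)) := by
      rw [sub_sub_sub_cancel_left, smul_sub, sub_add_sub_cancel]
    rw [e]
    refine (norm_add_le _ _).trans ?_
    rw [norm_smul, Complex.norm_real, Real.norm_of_nonneg hh.le]
    have h4 : ‖(V s y - V s' y) - (V s y - W y)‖ ≤ η / 3 + η / 3 :=
      (norm_sub_le _ _).trans (add_le_add (h3.trans hCd) h2.le)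
    have h5 := mul_le_mul_of_nonneg_left h4 hh.le
    linarith

/-- Solution curves of time dependent fields with approximable Euler steps are approximated by
automorphisms. -/
theorem exists_automorphism_of_flow {P : Set (EuclideanSpace ℂ (Fin n))}
    (hP : Bornology.IsBounded P) {V : ℝ → EuclideanSpace ℂ (Fin n) → EuclideanSpace ℂ (Fin n)}
    {C : ℝ} (hC : 0 ≤ C)
    (hVy : ∀ s ∈ Icc (0 : ℝ) 1, ∀ y ∈ P, ∀ y' ∈ P, ‖V s y - V s y'‖ ≤ C * ‖y - y'‖)
    (hVs : ∀ s ∈ Icc (0 : ℝ) 1, ∀ s' ∈ Icc (0 : ℝ) 1, ∀ y ∈ P, ‖V s y - V s' y‖ ≤ C * |s - s'|)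
    (hVa : ∀ s ∈ Icc (0 : ℝ) 1, ∀ η > 0, ∃ W, HasAutomorphismSteps W ∧ ∀ y ∈ P, ‖V s y - W y‖ < η)
    {L : Set (EuclideanSpace ℂ (Fin n))}
    {Y : ℝ → EuclideanSpace ℂ (Fin n) → EuclideanSpace ℂ (Fin n)} {ρ : ℝ} (hρ : 0 < ρ)
    (hYP : ∀ s ∈ Icc (0 : ℝ) 1, ∀ z ∈ L, closedBall (Y s z) ρ ⊆ P)
    (hY : ∀ s ∈ Icc (0 : ℝ) 1, ∀ h : ℝ, 0 ≤ h → s + h ≤ 1 → ∀ z ∈ L,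
      Y (s + h) z = Y s z + (h : ℂ) • V s (Y s z))
    {ε : ℝ} (hε : 0 < ε) :
    ∃ Ψ, IsHolomorphicAutomorphism Ψ ∧ ∀ z ∈ L, ‖Ψ (Y 0 z) - Y 1 z‖ < ε := by
  set μ := min (ε / 2) ρ with hμ
  have hμ0 : 0 < μ := by positivity
  set η := μ / Real.exp C with hη
  have hη0 : 0 < η := by positivity
  obtain ⟨h₀, hh₀, hA⟩ := exists_uniform_automorphism_steps hP hC hVs hVa hη0
  obtain ⟨N, hN⟩ := exists_nat_gt (max 1 h₀⁻¹)
  have hN1 : (1 : ℝ) < N := (le_max_left _ _).trans_lt hN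
  have hN0 : (0 : ℝ) < N := by linarith
  set h : ℝ := 1 / N with hh
  have hpos : 0 < h := by positivity
  have hlt : h < h₀ := by
    rw [hh, one_div]
    exact inv_lt_of_inv_lt₀ hh₀ ((le_max_right _ _).trans_lt hN)
  have hNh : N * h = 1 := by rw [hh]; field_simp
  have hpow : ∀ k : ℕ, k ≤ N → η * (k * h) * (1 + C * h) ^ k ≤ μ := by
    intro k hk
    have hk' : (k : ℝ) ≤ N := by exact_mod_cast hk
    have h1 : (k : ℝ) * h ≤ 1 := by nlinarith
    have h2 : (1 + C * h) ^ k ≤ Real.exp C := by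
      calc (1 + C * h) ^ k ≤ Real.exp (C * h) ^ k := by
            gcongr
            linarith [Real.add_one_le_exp (C * h)]
        _ = Real.exp (k * (C * h)) := (Real.exp_nat_mul _ _).symm
        _ ≤ Real.exp C := by
            gcongr
            nlinarith
    calc η * (k * h) * (1 + C * h) ^ k ≤ η * 1 * Real.exp C := by gcongr
      _ = μ := by rw [hη]; field_simp
  have key : ∀ k : ℕ, k ≤ N → ∃ Ψ, IsHolomorphicAutomorphism Ψ ∧
      ∀ z ∈ L, ‖Ψ (Y 0 z) - Y (k * h) z‖ ≤ η * (k * h) * (1 + C * h) ^ k := by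
    intro k
    induction k with
    | zero => exact fun _ => ⟨_, isHolomorphicAutomorphism_id, fun z _ => by simp⟩
    | succ k ih =>
      intro hk
      obtain ⟨Ψ, hΨ, hΨY⟩ := ih (by omega)
      have hk' : ((k : ℝ) + 1) ≤ N := by exact_mod_cast hk
      have hs : (k : ℝ) * h ∈ Icc (0 : ℝ) 1 := ⟨by positivity, by nlinarith⟩
      obtain ⟨A, hA1, hA2⟩ := hA _ hs h hpos hlt
      refine ⟨_, hA1.comp hΨ, fun z hz => ?_⟩
      have e1 := hΨY z hz
      have hyP : Y (k * h) z ∈ P := hYP _ hs z hz (mem_closedBall_self hρ.le)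
      have hxP : Ψ (Y 0 z) ∈ P := hYP _ hs z hz (by
        rw [mem_closedBall_iff_norm]
        exact e1.trans ((hpow k (by omega)).trans (min_le_right _ _)))
      have e2 := hA2 _ hxP
      have e3 := hVy _ hs _ hxP _ hyP
      have e4 : Y ((k + 1 : ℕ) * h) z = Y (k * h) z + (h : ℂ) • V (k * h) (Y (k * h) z) := by
        rw [← hY _ hs h hpos.le (by nlinarith) z hz]
        push_cast
        ring_nf
      set x := Ψ (Y 0 z)
      set y := Y (k * h) z
      have e5 : A x - (y + (h : ℂ) • V (k * h) y) = (A x - x - (h : ℂ) • V (k * h) x) + (x - y) +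
          (h : ℂ) • (V (k * h) x - V (k * h) y) := by
        rw [smul_sub]; abel
      rw [e4, e5]
      refine norm_add₃_le.trans ?_
      rw [norm_smul, Complex.norm_real, Real.norm_of_nonneg hpos.le]
      have e6 : (1 : ℝ) ≤ (1 + C * h) ^ (k + 1) := one_le_pow₀ (by nlinarith)
      calc ‖A x - x - (h : ℂ) • V (k * h) x‖ + ‖x - y‖ + h * ‖V (k * h) x - V (k * h) y‖
          ≤ η * h * 1 + ‖x - y‖ + h * (C * ‖x - y‖) := by
            rw [mul_one]
            gcongr
        _ = η * h * 1 + (1 + C * h) * ‖x - y‖ := by ring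
        _ ≤ η * h * (1 + C * h) ^ (k + 1) +
            (1 + C * h) * (η * (k * h) * (1 + C * h) ^ k) := by gcongr
        _ = _ := by push_cast; ring
  obtain ⟨Ψ, hΨ, hΨY⟩ := key N le_rfl
  refine ⟨Ψ, hΨ, fun z hz => ?_⟩
  have := (hΨY z hz).trans (hpow N le_rfl)
  rw [hNh] at this
  exact this.trans_lt ((min_le_left _ _).trans_lt (by linarith))

end Flow

section NearIdentity

variable {E : Type*} [NormedAddCommGroup E] [NormedSpace ℂ E] {L : Set E} {g : E → E} {ρ δ : ℝ}

omit [NormedSpace ℂ E] in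
theorem thickening_ball_subset {a b : ℝ} {w : E} (hw : w ∈ thickening a L) :
    ball w b ⊆ thickening (a + b) L := by
  intro x hx
  obtain ⟨z, hz, hwz⟩ := mem_thickening_iff.1 hw
  exact mem_thickening_iff.2 ⟨z, hz, by
    have := dist_triangle x w z
    have := mem_ball.1 hx
    linarith⟩

theorem norm_fderiv_le_of_small (hρ : 0 < ρ) (hg : DifferentiableOn ℂ g (thickening (4 * ρ) L))
    (hgδ : ∀ z ∈ thickening (4 * ρ) L, ‖g z‖ ≤ δ) (hδ : δ ≤ ρ / 4) {w : E}
    (hw : w ∈ thickening (2 * ρ) L) : ‖fderiv ℂ g w‖ ≤ 1 / 2 := by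
  have hsub : ball w (2 * ρ) ⊆ thickening (4 * ρ) L := by
    have := thickening_ball_subset (b := 2 * ρ) hw
    rwa [← add_mul, show (2 + 2 : ℝ) = 4 by norm_num] at this
  refine (norm_fderiv_le_of_differentiableOn_ball (by positivity) (hg.mono hsub)
    fun x hx => hgδ x (hsub hx)).trans ?_
  rw [div_le_iff₀ (by positivity)]
  linarith

theorem norm_sub_le_of_small (hρ : 0 < ρ) (hg : DifferentiableOn ℂ g (thickening (4 * ρ) L))
    (hgδ : ∀ z ∈ thickening (4 * ρ) L, ‖g z‖ ≤ δ) (hδ : δ ≤ ρ / 4) {x y : E}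
    (hx : x ∈ thickening ρ L) (hy : y ∈ thickening ρ L) : ‖g x - g y‖ ≤ 1 / 2 * ‖x - y‖ := by
  rcases lt_or_ge ‖x - y‖ ρ with h | h
  · have hsub : ball y ρ ⊆ thickening (2 * ρ) L := by
      have := thickening_ball_subset (b := ρ) hy
      rwa [← two_mul] at this
    let _ : NormedSpace ℝ E := NormedSpace.restrictScalars ℝ ℂ E
    exact (convex_ball y ρ).norm_image_sub_le_of_norm_fderiv_le (𝕜 := ℂ) (f := g)
      (fun w hw => hg.differentiableAt (isOpen_thickening.mem_nhds
        (thickening_mono (by linarith) _ (hsub hw))))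
      (fun w hw => norm_fderiv_le_of_small hρ hg hgδ hδ (hsub hw)) (mem_ball_self hρ)
      (mem_ball_iff_norm.2 h)
  · have h1 := hgδ x (thickening_mono (by linarith) _ hx)
    have h2 := hgδ y (thickening_mono (by linarith) _ hy)
    have := norm_sub_le (g x) (g y)
    linarith

theorem exists_add_smul_eq [CompleteSpace E] (hρ : 0 < ρ)
    (hg : DifferentiableOn ℂ g (thickening (4 * ρ) L))
    (hgδ : ∀ z ∈ thickening (4 * ρ) L, ‖g z‖ ≤ δ) (hδ : δ ≤ ρ / 4) {s : ℝ} (hs : s ∈ Icc (0 : ℝ) 1)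
    {y : E} (hy : y ∈ thickening (ρ / 2) L) :
    ∃ x ∈ thickening ρ L, x + (s : ℂ) • g x = y := by
  have hns : ‖(s : ℂ)‖ = s := by rw [Complex.norm_real, Real.norm_of_nonneg hs.1]
  have hsub : closedBall y (ρ / 4) ⊆ thickening ρ L := by
    refine (closedBall_subset_ball (show ρ / 4 < ρ / 2 by linarith)).trans ?_
    have := thickening_ball_subset (b := ρ / 2) hy
    rwa [add_halves] at this
  have hmaps : MapsTo (fun x => y - (s : ℂ) • g x) (closedBall y (ρ / 4))
      (closedBall y (ρ / 4)) := by
    intro x hx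
    rw [mem_closedBall_iff_norm, sub_sub_cancel_left, norm_neg, norm_smul, hns]
    have := hgδ x (thickening_mono (by linarith) _ (hsub hx))
    have := norm_nonneg (g x)
    nlinarith [hs.1, hs.2]
  have hcontr : ContractingWith (1 / 2) (hmaps.restrict _ _ _) := by
    refine ⟨by rw [← NNReal.coe_lt_coe]; norm_num, LipschitzWith.of_dist_le_mul fun a b => ?_⟩
    rw [Subtype.dist_eq, Subtype.dist_eq, dist_eq_norm, dist_eq_norm]
    simp only [MapsTo.val_restrict_apply, sub_sub_sub_cancel_left]
    rw [← smul_sub, norm_smul, hns, norm_sub_rev (a : E) b]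
    have := norm_sub_le_of_small hρ hg hgδ hδ (hsub b.2) (hsub a.2)
    have := norm_nonneg (g b - g a)
    simp only [NNReal.coe_div, NNReal.coe_one, NNReal.coe_ofNat]
    nlinarith [hs.1, hs.2]
  obtain ⟨x, hx, hfix, -⟩ := hcontr.exists_fixedPoint' isClosed_closedBall.isComplete hmaps
    (mem_closedBall_self (by positivity)) (edist_ne_top _ _)
  refine ⟨x, hsub hx, ?_⟩
  have : y - (s : ℂ) • g x = x := hfix
  rw [← sub_eq_iff_eq_add.1 this]

theorem norm_sub_le_of_add_smul (hρ : 0 < ρ) (hg : DifferentiableOn ℂ g (thickening (4 * ρ) L))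
    (hgδ : ∀ z ∈ thickening (4 * ρ) L, ‖g z‖ ≤ δ) (hδ : δ ≤ ρ / 4) {s s' : ℝ}
    (hs : s ∈ Icc (0 : ℝ) 1) {x x' : E} (hx : x ∈ thickening ρ L) (hx' : x' ∈ thickening ρ L) :
    ‖x - x'‖ ≤ 2 * (‖(x + (s : ℂ) • g x) - (x' + (s' : ℂ) • g x')‖ + δ * |s - s'|) := by
  have hns : ‖(s : ℂ)‖ = s := by rw [Complex.norm_real, Real.norm_of_nonneg hs.1]
  have e : x - x' = ((x + (s : ℂ) • g x) - (x' + (s' : ℂ) • g x')) - (s : ℂ) • (g x - g x') -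
      ((s - s' : ℝ) : ℂ) • g x' := by
    push_cast
    rw [smul_sub, sub_smul]
    abel
  have h1 := norm_sub_le_of_small hρ hg hgδ hδ hx hx'
  have h2 := hgδ x' (thickening_mono (by linarith) _ hx')
  have h3 : ‖x - x'‖ ≤ ‖(x + (s : ℂ) • g x) - (x' + (s' : ℂ) • g x')‖ + s * ‖g x - g x'‖ +
      |s - s'| * ‖g x'‖ := by
    conv_lhs => rw [e]
    refine (norm_sub_le _ _).trans (add_le_add ((norm_sub_le _ _).trans (add_le_add le_rfl ?_)) ?_)
    · rw [norm_smul, hns]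
    · rw [norm_smul, Complex.norm_real, Real.norm_eq_abs]
  have h4 : s * ‖g x - g x'‖ ≤ 1 / 2 * ‖x - x'‖ := by
    have := norm_nonneg (g x - g x')
    nlinarith [hs.1, hs.2]
  have h5 := mul_le_mul_of_nonneg_left h2 (abs_nonneg (s - s'))
  linarith

theorem exists_inverse_family [CompleteSpace E] (hρ : 0 < ρ)
    (hg : DifferentiableOn ℂ g (thickening (4 * ρ) L))
    (hgδ : ∀ z ∈ thickening (4 * ρ) L, ‖g z‖ ≤ δ) (hδ : δ ≤ ρ / 4) :
    ∃ V : ℝ → E → E, (∀ s ∈ Icc (0 : ℝ) 1, DifferentiableOn ℂ (V s) (thickening (ρ / 2) L)) ∧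
      (∀ s ∈ Icc (0 : ℝ) 1, ∀ y ∈ thickening (ρ / 2) L, ∀ y' ∈ thickening (ρ / 2) L,
        ‖V s y - V s y'‖ ≤ ‖y - y'‖) ∧
      (∀ s ∈ Icc (0 : ℝ) 1, ∀ s' ∈ Icc (0 : ℝ) 1, ∀ y ∈ thickening (ρ / 2) L,
        ‖V s y - V s' y‖ ≤ δ * |s - s'|) ∧
      ∀ s ∈ Icc (0 : ℝ) 1, ∀ z ∈ L, z + (s : ℂ) • g z ∈ thickening (ρ / 2) L →
        V s (z + (s : ℂ) • g z) = g z := by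
  have hex : ∀ (s : ℝ) (y : E), ∃ x, s ∈ Icc (0 : ℝ) 1 → y ∈ thickening (ρ / 2) L →
      x ∈ thickening ρ L ∧ x + (s : ℂ) • g x = y := by
    intro s y
    by_cases h : s ∈ Icc (0 : ℝ) 1 ∧ y ∈ thickening (ρ / 2) L
    · obtain ⟨x, h1, h2⟩ := exists_add_smul_eq hρ hg hgδ hδ h.1 h.2
      exact ⟨x, fun _ _ => ⟨h1, h2⟩⟩
    · exact ⟨0, fun h1 h2 => (h ⟨h1, h2⟩).elim⟩
  choose X hX using hex
  have hXlip : ∀ s ∈ Icc (0 : ℝ) 1, ∀ s' ∈ Icc (0 : ℝ) 1, ∀ y ∈ thickening (ρ / 2) L,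
      ∀ y' ∈ thickening (ρ / 2) L, ‖X s y - X s' y'‖ ≤ 2 * (‖y - y'‖ + δ * |s - s'|) := by
    intro s hs s' hs' y hy y' hy'
    have := norm_sub_le_of_add_smul hρ hg hgδ hδ (s' := s') hs (hX s y hs hy).1
      (hX s' y' hs' hy').1
    rwa [(hX s y hs hy).2, (hX s' y' hs' hy').2] at this
  have hVlip : ∀ s ∈ Icc (0 : ℝ) 1, ∀ s' ∈ Icc (0 : ℝ) 1, ∀ y ∈ thickening (ρ / 2) L,
      ∀ y' ∈ thickening (ρ / 2) L, ‖g (X s y) - g (X s' y')‖ ≤ ‖y - y'‖ + δ * |s - s'| := by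
    intro s hs s' hs' y hy y' hy'
    have h1 := norm_sub_le_of_small hρ hg hgδ hδ (hX s y hs hy).1 (hX s' y' hs' hy').1
    have h2 := hXlip s hs s' hs' y hy y' hy'
    linarith
  refine ⟨fun s y => g (X s y), fun s hs y hy => ?_, fun s hs y hy y' hy' => ?_,
    fun s hs s' hs' y hy => ?_, fun s hs z hz hy => ?_⟩
  · have hns : ‖(s : ℂ)‖ = s := by rw [Complex.norm_real, Real.norm_of_nonneg hs.1]
    obtain ⟨hx, hxy⟩ := hX s y hs hy
    have hgx : DifferentiableAt ℂ g (X s y) := hg.differentiableAt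
      (isOpen_thickening.mem_nhds (thickening_mono (by linarith) _ hx))
    have hcont : ContinuousAt (X s) y := by
      rw [Metric.continuousAt_iff']
      intro ε hε
      filter_upwards [isOpen_thickening.mem_nhds hy, ball_mem_nhds y (half_pos hε)] with y' hy' hb
      have := hXlip s hs s hs y' hy' y hy
      rw [mem_ball_iff_norm] at hb
      rw [dist_eq_norm]
      simp only [sub_self, abs_zero, mul_zero, add_zero] at this
      linarith
    have ht : ‖-((s : ℂ) • fderiv ℂ g (X s y))‖ < 1 := by
      rw [norm_neg, norm_smul, hns]
      have h1 := norm_fderiv_le_of_small hρ hg hgδ hδ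
        (thickening_mono (show ρ ≤ 2 * ρ by linarith) _ hx)
      have := norm_nonneg (fderiv ℂ g (X s y))
      nlinarith [hs.1, hs.2]
    have hF : HasFDerivAt (fun x => x + (s : ℂ) • g x)
        ((ContinuousLinearEquiv.ofUnit (Units.oneSub _ ht) : E ≃L[ℂ] E) : E →L[ℂ] E) (X s y) := by
      refine ((hasFDerivAt_id (X s y)).add (hgx.hasFDerivAt.const_smul (s : ℂ))).congr_fderiv ?_
      symm
      change ((Units.oneSub _ ht : (E →L[ℂ] E)ˣ) : E →L[ℂ] E) = _
      rw [Units.val_oneSub, sub_neg_eq_add]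
      rfl
    have hXd := (HasFDerivAt.of_local_left_inverse hcont hF
      (by filter_upwards [isOpen_thickening.mem_nhds hy] with y' hy' using
        (hX s y' hs hy').2)).differentiableAt
    exact (hgx.comp y hXd).differentiableWithinAt
  · simpa using hVlip s hs s hs y hy y' hy'
  · simpa using hVlip s hs s' hs' y hy y hy
  · have hzT := self_subset_thickening hρ L hz
    have := norm_sub_le_of_add_smul hρ hg hgδ hδ (s' := s) hs (hX s _ hs hy).1 hzT
    rw [(hX s _ hs hy).2] at this
    simp only [sub_self, norm_zero, abs_zero, mul_zero, add_zero] at this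
    have h0 : X s (z + (s : ℂ) • g z) = z := sub_eq_zero.1 (norm_le_zero_iff.1 this)
    simp only [h0]

end NearIdentity

section Core

variable {n : ℕ}

/-- Holomorphic maps close to the identity near a polynomially convex compact set, as well as
their inverses, are approximated by automorphisms. -/
theorem exists_automorphism_near_identity (hn : 2 ≤ n) {L U : Set (EuclideanSpace ℂ (Fin n))}
    (hLc : IsCompact L) (hL : IsPolynomiallyConvex L) (hU : IsOpen U) (hLU : L ⊆ U) :
    ∃ δ > 0, ∀ F : EuclideanSpace ℂ (Fin n) → EuclideanSpace ℂ (Fin n), DifferentiableOn ℂ F U →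
      (∀ z ∈ U, ‖F z - z‖ ≤ δ) → ∀ ε > 0,
      (∃ Ψ, IsHolomorphicAutomorphism Ψ ∧ ∀ z ∈ L, ‖Ψ z - F z‖ < ε) ∧
      ∃ Ψ, IsHolomorphicAutomorphism Ψ ∧ ∀ z ∈ L, ‖Ψ (F z) - z‖ < ε := by
  obtain ⟨τ, hτ, hτU⟩ := hLc.exists_thickening_subset_open hU hLU
  obtain ⟨ρ, hρ, rfl⟩ : ∃ ρ > 0, τ = 4 * ρ := ⟨τ / 4, by positivity, by ring⟩
  obtain ⟨P, hPc, hLP, hPT, hPapp⟩ := exists_polynomialField_approx hLc hL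
    (isOpen_thickening (δ := ρ / 2) (E := L)) (self_subset_thickening (by positivity) L)
  obtain ⟨σ, hσ, hσP⟩ := hLc.exists_thickening_subset_open isOpen_interior hLP
  refine ⟨min (ρ / 4) (σ / 4), by positivity, fun F hF hFδ ε hε => ?_⟩
  set δ := min (ρ / 4) (σ / 4) with hδdef
  have hδ : δ ≤ ρ / 4 := min_le_left _ _
  have hδσ : δ ≤ σ / 4 := min_le_right _ _
  have hδ0 : 0 ≤ δ := by positivity
  have hgδ : ∀ z ∈ thickening (4 * ρ) L, ‖F z - z‖ ≤ δ := fun z hz => hFδ z (hτU hz)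
  obtain ⟨V, hVd, hVy, hVs, hVL⟩ := exists_inverse_family (g := fun z => F z - z) hρ
    ((hF.mono hτU).sub differentiableOn_id) hgδ hδ
  have hball : ∀ s ∈ Icc (0 : ℝ) 1, ∀ z ∈ L,
      closedBall (z + (s : ℂ) • (F z - z)) (σ / 2) ⊆ P := by
    intro s hs z hz x hx
    refine interior_subset (hσP (mem_thickening_iff.2 ⟨z, hz, ?_⟩))
    have h1 : ‖(s : ℂ) • (F z - z)‖ ≤ δ := by
      rw [norm_smul, Complex.norm_real, Real.norm_of_nonneg hs.1]
      have := hgδ z (self_subset_thickening (by positivity) L hz)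
      have := norm_nonneg (F z - z)
      nlinarith [hs.1, hs.2]
    have h2 : dist (z + (s : ℂ) • (F z - z)) z ≤ δ := by
      rwa [dist_eq_norm, add_sub_cancel_left]
    have := dist_triangle x (z + (s : ℂ) • (F z - z)) z
    have := mem_closedBall.1 hx
    linarith
  have hVval : ∀ s ∈ Icc (0 : ℝ) 1, ∀ z ∈ L, V s (z + (s : ℂ) • (F z - z)) = F z - z :=
    fun s hs z hz => hVL s hs z hz (hPT (hball s hs z hz (mem_closedBall_self (by positivity))))
  have hVapp : ∀ s ∈ Icc (0 : ℝ) 1, ∀ η > 0, ∃ W, HasAutomorphismSteps W ∧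
      ∀ y ∈ P, ‖V s y - W y‖ < η := fun s hs η hη => by
    obtain ⟨Q, hQ, hQV⟩ := hPapp (V s) (hVd s hs) η hη
    exact ⟨Q, hQ.hasAutomorphismSteps hn, hQV⟩
  have hVapp' : ∀ s ∈ Icc (0 : ℝ) 1, ∀ η > 0, ∃ W, HasAutomorphismSteps W ∧
      ∀ y ∈ P, ‖-V s y - W y‖ < η := fun s hs η hη => by
    obtain ⟨Q, hQ, hQV⟩ := hPapp (fun y => -V s y) (hVd s hs).fun_neg η hη
    exact ⟨Q, hQ.hasAutomorphismSteps hn, hQV⟩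
  have hrev : ∀ s ∈ Icc (0 : ℝ) 1, 1 - s ∈ Icc (0 : ℝ) 1 := fun s hs =>
    ⟨by linarith [hs.2], by linarith [hs.1]⟩
  constructor
  · obtain ⟨Ψ, hΨ, hΨY⟩ := exists_automorphism_of_flow hPc.isBounded (V := V) (C := 1 + δ)
      (by positivity) (fun s hs y hy y' hy' => (hVy s hs y (hPT hy) y' (hPT hy')).trans
        (le_mul_of_one_le_left (norm_nonneg _) (by linarith)))
      (fun s hs s' hs' y hy => (hVs s hs s' hs' y (hPT hy)).trans
        (mul_le_mul_of_nonneg_right (by linarith) (abs_nonneg _))) hVapp (L := L)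
      (Y := fun s z => z + (s : ℂ) • (F z - z)) (half_pos hσ) hball
      (fun s hs h hh hsh z hz => by
        rw [hVval s hs z hz]
        push_cast
        rw [add_smul, add_assoc]) hε
    refine ⟨Ψ, hΨ, fun z hz => ?_⟩
    simpa using hΨY z hz
  · obtain ⟨Ψ, hΨ, hΨY⟩ := exists_automorphism_of_flow hPc.isBounded
      (V := fun s y => -V (1 - s) y) (C := 1 + δ)
      (by positivity) (fun s hs y hy y' hy' => by
        rw [neg_sub_neg, norm_sub_rev]
        exact (hVy _ (hrev s hs) y (hPT hy) y' (hPT hy')).trans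
          (le_mul_of_one_le_left (norm_nonneg _) (by linarith)))
      (fun s hs s' hs' y hy => by
        rw [neg_sub_neg, norm_sub_rev]
        refine (hVs _ (hrev s hs) _ (hrev s' hs') y (hPT hy)).trans ?_
        rw [sub_sub_sub_cancel_left, abs_sub_comm]
        exact mul_le_mul_of_nonneg_right (by linarith) (abs_nonneg _))
      (fun s hs => hVapp' _ (hrev s hs)) (L := L)
      (Y := fun s z => z + ((1 - s : ℝ) : ℂ) • (F z - z)) (half_pos hσ)
      (fun s hs => hball _ (hrev s hs))
      (fun s hs h hh hsh z hz => by
        rw [hVval _ (hrev s hs) z hz]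
        push_cast
        module) hε
    refine ⟨Ψ, hΨ, fun z hz => ?_⟩
    simpa using hΨY z hz

end Core

section LocalInverses

variable {E F : Type} [NormedAddCommGroup E] [NormedSpace ℂ E] [FiniteDimensional ℂ E]
  [NormedAddCommGroup F] [NormedSpace ℂ F] [FiniteDimensional ℂ F]

theorem exists_straightening {φ : E → ℂ} {V : Set E} {p : E} (hV : IsOpen V)
    (hφ : DifferentiableOn ℂ φ V) (hp : p ∈ V) {e : E} (he : fderiv ℂ φ p e = 1) :
    ∃ Λ : E → E, Λ p = p ∧ (∀ᶠ y in 𝓝 p, DifferentiableAt ℂ Λ y) ∧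
      HasFDerivAt Λ (ContinuousLinearMap.id ℂ E) p ∧
      (∀ᶠ y in 𝓝 p, fderiv ℂ φ p (y - p) = φ (Λ y) - φ p) ∧ (∃ W ∈ 𝓝 p, InjOn Λ W) ∧
      ∀ᶠ z in 𝓝 p, Λ (z + (φ z - φ p - fderiv ℂ φ p (z - p)) • e) = z := by
  set φ' := fderiv ℂ φ p with hφ'
  set Θ : E → E := fun z => z + (φ z - φ p - φ' (z - p)) • e with hΘ
  have hcd : ContDiffAt ℂ 1 φ p :=
    (contDiffOn_of_differentiableOn hV 1 hφ).contDiffAt (hV.mem_nhds hp)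
  have hΘcd : ContDiffAt ℂ 1 Θ p := by
    refine contDiffAt_id.add (ContDiffAt.smul (ContDiffAt.sub (hcd.sub contDiffAt_const) ?_)
      contDiffAt_const)
    exact φ'.contDiff.contDiffAt.comp p (contDiffAt_id.sub contDiffAt_const)
  have hφd : HasFDerivAt φ φ' p := (hφ.differentiableAt (hV.mem_nhds hp)).hasFDerivAt
  have hΘd : HasFDerivAt Θ ((ContinuousLinearEquiv.refl ℂ E : E ≃L[ℂ] E) : E →L[ℂ] E) p := by
    have h1 : HasFDerivAt (fun z => φ' (z - p)) φ' p :=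
      φ'.hasFDerivAt.comp p ((hasFDerivAt_id p).sub_const p)
    have h2 := (hasFDerivAt_id (𝕜 := ℂ) p).add (((hφd.sub_const (φ p)).sub h1).smul_const e)
    refine h2.congr_fderiv ?_
    ext x
    simp
  have hΘp : Θ p = p := by simp [hΘ]
  have hst := hΘcd.hasStrictFDerivAt' hΘd one_ne_zero
  refine ⟨hst.localInverse Θ _ p, ?_, ?_, ?_, ?_, ?_, ?_⟩
  · have := hst.localInverse_apply_image
    rwa [hΘp] at this
  · have := hΘcd.to_localInverse hΘd one_ne_zero
    have h2 := this.eventually (by simp)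
    rw [hΘp] at h2
    filter_upwards [h2] with y hy
    exact hy.differentiableAt one_ne_zero
  · have := hst.to_localInverse.hasFDerivAt
    rw [hΘp] at this
    exact this
  · have := hst.eventually_right_inverse
    rw [hΘp] at this
    filter_upwards [this] with y hy
    conv_lhs => rw [← hy]
    simp only [hΘ, map_sub, map_add, map_smul, he, smul_eq_mul]
    ring
  · have := hst.eventually_right_inverse
    rw [hΘp] at this
    refine ⟨_, this, fun x hx y hy hxy => ?_⟩
    rw [mem_ofPred_eq] at hx hy
    rw [← hx, ← hy, hxy]
  · exact hst.eventually_left_inverse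

theorem hasDerivAt_sub_mul {g : ℂ → ℂ} {a : ℂ} (hg : DifferentiableAt ℂ g a) :
    HasDerivAt (fun z => (z - a) * g z) (g a) a := by
  refine (((hasDerivAt_id a).sub_const a).mul hg.hasDerivAt).congr_deriv ?_
  simp

/-- A holomorphic function of one variable that is injective near a point has nonzero
derivative there. -/
theorem deriv_ne_zero_of_eventually_injOn {f : ℂ → ℂ} {a : ℂ} {V : Set ℂ} (hV : V ∈ 𝓝 a)
    (hf : AnalyticAt ℂ f a) (hinj : InjOn f V) : deriv f a ≠ 0 := by
  intro hd
  have hf0 : AnalyticAt ℂ (fun z => f z - f a) a := hf.sub analyticAt_const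
  have hne : ¬ ∀ᶠ z in 𝓝 a, f z - f a = 0 := by
    intro h
    have h2 : ∀ᶠ z in 𝓝[≠] a, False := by
      filter_upwards [nhdsWithin_le_nhds h, nhdsWithin_le_nhds hV, self_mem_nhdsWithin]
        with z hz hzV hza
      exact hza (hinj hzV (mem_of_mem_nhds hV) (sub_eq_zero.1 hz))
    exact absurd h2.exists (by simp)
  obtain ⟨k, g, hg, hga, hfg⟩ := hf0.exists_eventuallyEq_pow_smul_nonzero_iff.2 hne
  have hk : 2 ≤ k := by
    by_contra! hk
    have hfa := hfg.self_of_nhds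
    interval_cases k
    · simp at hfa
      exact hga hfa.symm
    · have h1 : HasDerivAt (fun z => f z - f a) (g a) a := by
        have : HasDerivAt (fun z => (z - a) ^ 1 • g z) (g a) a := by
          simpa using hasDerivAt_sub_mul hg.differentiableAt
        exact this.congr_of_eventuallyEq hfg
      have h2 : HasDerivAt f (g a) a := by simpa using h1.add_const (f a)
      exact hga (h2.deriv.symm.trans hd)
  obtain ⟨c, hc⟩ : ∃ c : ℂ, c ^ k = g a := IsAlgClosed.exists_pow_nat_eq _ (by omega)
  have hc0 : c ≠ 0 := by
    rintro rfl
    rw [zero_pow (by omega)] at hc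
    exact hga hc.symm
  set r : ℂ → ℂ := fun z => c * Complex.exp (Complex.log (g z / g a) / k) with hr
  have hra : AnalyticAt ℂ r a := by
    refine analyticAt_const.mul (AnalyticAt.cexp (AnalyticAt.div ?_ analyticAt_const ?_))
    · refine AnalyticAt.clog (hg.div analyticAt_const hga) ?_
      rw [div_self hga]
      simp
    · simp
      omega
  have hrk : ∀ᶠ z in 𝓝 a, r z ^ k = g z := by
    filter_upwards [hg.continuousAt.eventually_ne hga] with z hz
    have hk0 : (k : ℂ) ≠ 0 := by simp; omega
    rw [hr, mul_pow, hc, ← Complex.exp_nat_mul, mul_div_cancel₀ _ hk0,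
      Complex.exp_log (div_ne_zero hz hga), mul_div_cancel₀ _ hga]
  have hra1 : r a = c := by simp [hr, div_self hga]
  set q : ℂ → ℂ := fun z => (z - a) * r z with hq
  have hqa : AnalyticAt ℂ q a := (analyticAt_id.sub analyticAt_const).mul hra
  have hqd : deriv q a = c := by
    rw [(hasDerivAt_sub_mul hra.differentiableAt).deriv, hra1]
  have hmap : map q (𝓝 a) = 𝓝 (q a) := by
    have := hqa.hasStrictDerivAt
    rw [hqd] at this
    exact this.map_nhds_eq hc0
  have hqa0 : q a = 0 := by simp [hq]
  rw [hqa0] at hmap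
  have hfq : ∀ᶠ z in 𝓝 a, z ∈ V ∧ f z - f a = q z ^ k := by
    filter_upwards [hV, hfg, hrk] with z h1 h2 h3
    refine ⟨h1, ?_⟩
    rw [h2, hq, mul_pow, h3, smul_eq_mul]
  have himg : ∀ᶠ y in 𝓝 (0 : ℂ), ∃ z, (z ∈ V ∧ f z - f a = q z ^ k) ∧ q z = y := by
    rw [← hmap]
    exact mem_of_superset (image_mem_map hfq) (by rintro _ ⟨z, hz, rfl⟩; exact ⟨z, hz, rfl⟩)
  set ω : ℂ := Complex.exp (2 * Real.pi * Complex.I / k)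
  have hω : IsPrimitiveRoot ω k := Complex.isPrimitiveRoot_exp k (by omega)
  have himg2 : ∀ᶠ y in 𝓝 (0 : ℂ), ∃ z, (z ∈ V ∧ f z - f a = q z ^ k) ∧ q z = ω * y := by
    have : Tendsto (fun y => ω * y) (𝓝 0) (𝓝 0) := by
      have : Continuous fun y : ℂ => ω * y := by fun_prop
      simpa using this.tendsto 0
    exact this.eventually himg
  have : ∀ᶠ y in 𝓝[≠] (0 : ℂ), False := by
    filter_upwards [nhdsWithin_le_nhds himg, nhdsWithin_le_nhds himg2, self_mem_nhdsWithin]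
      with y h1 h2 hy
    obtain ⟨z, ⟨hzV, hz⟩, hzy⟩ := h1
    obtain ⟨z', ⟨hzV', hz'⟩, hzy'⟩ := h2
    have : z = z' := by
      refine hinj hzV hzV' (sub_left_injective (b := f a) ?_)
      simp only [hz, hz', hzy, hzy', mul_pow, hω.pow_eq_one, one_mul]
    subst this
    have h3 : (ω - 1) * y = 0 := by rw [sub_mul, ← hzy', hzy]; ring
    rcases mul_eq_zero.1 h3 with h | h
    · exact hω.ne_one (by omega) (sub_eq_zero.1 h)
    · exact hy h
  exact absurd this.exists (by simp)

omit [FiniteDimensional ℂ E] in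
/-- Zeros of a holomorphic function on a complex line persist on nearby parallel lines. -/
theorem eventually_exists_zero_on_line {h : E → ℂ} {U : Set E} {p e : E} (hU : IsOpen U)
    (hh : DifferentiableOn ℂ h U) (hp : p ∈ U) (hhp : h p = 0)
    (hne : ¬ ∀ᶠ t : ℂ in 𝓝 0, h (p + t • e) = 0) {S : Set E} (hS : S ∈ 𝓝 p) :
    ∀ᶠ w in 𝓝 (0 : E), ∃ t : ℂ, p + w + t • e ∈ S ∧ h (p + w + t • e) = 0 := by
  have hSU : {x : E × ℂ | p + x.1 + x.2 • e ∈ S ∩ U} ∈ 𝓝 ((0 : E), (0 : ℂ)) := by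
    have hc : Continuous fun x : E × ℂ => p + x.1 + x.2 • e := by fun_prop
    refine hc.continuousAt.preimage_mem_nhds ?_
    simpa using inter_mem hS (hU.mem_nhds hp)
  obtain ⟨A, hA, B, hB, hAB⟩ := mem_nhds_prod_iff.1 hSU
  have hline : ∀ w : E, Continuous fun t : ℂ => p + w + t • e := fun w => by fun_prop
  have hlinea : AnalyticAt ℂ (fun t : ℂ => h (p + t • e)) 0 := by
    refine analyticAt_of_eventually_differentiableAt ?_
    have hc : Continuous fun t : ℂ => p + t • e := by fun_prop
    have := hc.continuousAt.preimage_mem_nhds (x := 0) (t := U) (by simpa using hU.mem_nhds hp)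
    filter_upwards [this] with t ht
    exact (hh.differentiableAt (hU.mem_nhds ht)).comp t
      ((differentiableAt_id.smul_const e).const_add p)
  have hev := hlinea.eventually_eq_zero_or_eventually_ne_zero.resolve_left hne
  rw [eventually_nhdsWithin_iff] at hev
  obtain ⟨ρ, hρ, hball⟩ := Metric.mem_nhds_iff.1 (inter_mem hev hB)
  obtain ⟨r, hr, hrρ⟩ := exists_between hρ
  have hcl : closedBall (0 : ℂ) r ⊆ ball 0 ρ := closedBall_subset_ball hrρ
  have hmem : ∀ w ∈ A, ∀ t ∈ closedBall (0 : ℂ) r, p + w + t • e ∈ S ∩ U :=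
    fun w hw t ht => hAB (mk_mem_prod hw (hball (hcl ht)).2)
  have hcont : ∀ w ∈ A, ContinuousOn (fun t : ℂ => h (p + w + t • e)) (closedBall 0 r) :=
    fun w hw => hh.continuousOn.comp (hline w).continuousOn fun t ht => (hmem w hw t ht).2
  have h0A : (0 : E) ∈ A := mem_of_mem_nhds hA
  obtain ⟨t₀, ht₀, hmin⟩ := (isCompact_sphere (0 : ℂ) r).exists_isMinOn
    (NormedSpace.sphere_nonempty.2 hr.le)
    ((hcont 0 h0A).mono sphere_subset_closedBall).norm
  set m : ℝ := ‖h (p + 0 + t₀ • e)‖ with hm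
  have hmpos : 0 < m := by
    rw [hm, add_zero, norm_pos_iff]
    refine (hball (hcl (sphere_subset_closedBall ht₀))).1 ?_
    rintro rfl
    simp at ht₀
    exact hr.ne ht₀
  have hclose : ∀ᶠ w in 𝓝 (0 : E), ∀ t ∈ closedBall (0 : ℂ) r,
      ‖h (p + w + t • e) - h (p + 0 + t • e)‖ < m / 3 := by
    refine (isCompact_closedBall (0 : ℂ) r).eventually_forall_of_forall_eventually ?_
    intro t ht
    have hU' : p + 0 + t • e ∈ U := (hmem 0 h0A t ht).2
    have hd : ContinuousAt h (p + 0 + t • e) :=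
      (hh.differentiableAt (hU.mem_nhds hU')).continuousAt
    have h1 : ContinuousAt (fun x : E × ℂ => h (p + x.1 + x.2 • e)) (0, t) := by
      refine ContinuousAt.comp (f := fun x : E × ℂ => p + x.1 + x.2 • e) hd ?_
      fun_prop
    have h2 : ContinuousAt (fun x : E × ℂ => h (p + 0 + x.2 • e)) (0, t) := by
      refine ContinuousAt.comp (f := fun x : E × ℂ => p + 0 + x.2 • e) hd ?_
      fun_prop
    have h3 := (h1.sub h2).norm
    refine h3.eventually_lt continuousAt_const ?_
    rw [Pi.sub_apply, sub_self, norm_zero]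
    positivity
  filter_upwards [hclose, hA] with w hw hwA
  by_contra! hcon
  have hnz : ∀ t ∈ closedBall (0 : ℂ) r, h (p + w + t • e) ≠ 0 :=
    fun t ht => hcon t (hmem w hwA t ht).1
  have hdcl : DiffContOnCl ℂ (fun t : ℂ => (h (p + w + t • e))⁻¹) (ball 0 r) := by
    refine DiffContOnCl.inv ⟨?_, ?_⟩ ?_
    · refine hh.comp (t := U) ?_ fun t ht => (hmem w hwA t (ball_subset_closedBall ht)).2
      exact ((differentiable_id.smul_const e).const_add (p + w)).differentiableOn
    · rw [closure_ball _ hr.ne']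
      exact hcont w hwA
    · rw [closure_ball _ hr.ne']
      exact hnz
  have hbd := Complex.norm_le_of_forall_mem_frontier_norm_le (C := (2 * m / 3)⁻¹)
    isBounded_ball hdcl (fun t ht => by
      rw [frontier_ball _ hr.ne'] at ht
      rw [norm_inv]
      refine inv_anti₀ (by positivity) ?_
      have h1 := hw t (sphere_subset_closedBall ht)
      have h2 : m ≤ ‖h (p + 0 + t • e)‖ := hmin ht
      have h3 := norm_sub_norm_le (h (p + 0 + t • e)) (h (p + w + t • e))
      rw [norm_sub_rev] at h3
      linarith) (subset_closure (mem_ball_self hr))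
  have h0 := hw 0 (mem_closedBall_self hr.le)
  simp only [zero_smul, add_zero, hhp, sub_zero] at h0
  simp only [zero_smul, add_zero, norm_inv] at hbd
  have hpos : 0 < ‖h (p + w)‖ := by
    have := hnz 0 (mem_closedBall_self hr.le)
    simp only [zero_smul, add_zero] at this
    positivity
  have := (inv_le_inv₀ hpos (by positivity)).1 hbd
  linarith

end LocalInverses

section InjectiveMaps

variable {E F : Type} [NormedAddCommGroup E] [NormedSpace ℂ E] [FiniteDimensional ℂ E]
  [NormedAddCommGroup F] [NormedSpace ℂ F] [FiniteDimensional ℂ F]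

/-- If all iterated derivatives at zero vanish along a line, the function vanishes along it. -/
theorem exists_iteratedFDeriv_ne_zero {h : E → ℂ} {a z : E} {R : ℝ}
    (hh : DifferentiableOn ℂ h (ball a R)) (hz : z ∈ ball a R) (hhz : h z ≠ 0) :
    ∃ k, iteratedFDeriv ℂ k h a (fun _ => z - a) ≠ 0 := by
  by_contra! hcon
  have hR : 0 < R := pos_of_mem_ball hz
  set T : Set ℂ := (fun t : ℂ => a + t • (z - a)) ⁻¹' ball a R with hT
  have hc : Continuous fun t : ℂ => a + t • (z - a) := by fun_prop
  have hTo : IsOpen T := isOpen_ball.preimage hc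
  have h0 : (0 : ℂ) ∈ T := by simpa [hT] using hR
  have h1 : (1 : ℂ) ∈ T := by simpa [hT] using hz
  have hTc : Convex ℝ T := by
    intro s hs t ht u v hu hv huv
    have := convex_ball a R hs ht hu hv huv
    simp only [hT, mem_preimage]
    convert this using 1
    have h2 : a = (u + v) • a := by rw [huv, one_smul]
    nth_rw 1 [h2]
    simp only [add_smul, smul_add, smul_assoc]
    abel
  have hd : DifferentiableOn ℂ (fun t : ℂ => h (a + t • (z - a))) T :=
    hh.comp (((differentiable_id.smul_const (z - a)).const_add a).differentiableOn)
      fun t ht => ht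
  have han : AnalyticOnNhd ℂ (fun t : ℂ => h (a + t • (z - a))) T :=
    analyticOnNhd_of_differentiableOn hTo hd
  have hord : analyticOrderAt (fun t : ℂ => h (a + t • (z - a))) 0 = ⊤ := by
    refine ENat.eq_top_iff_forall_ge.2 fun m => ?_
    refine (natCast_le_analyticOrderAt_iff_iteratedDeriv_eq_zero (han 0 h0)).2 fun i _ => ?_
    rw [iteratedDeriv_comp_line isOpen_ball hh a (z - a) i 0 h0, zero_smul, add_zero]
    exact hcon i
  have := han.eqOn_zero_of_preconnected_of_eventuallyEq_zero hTc.isPreconnected h0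
    (analyticOrderAt_eq_top.1 hord) h1
  simp at this
  exact hhz this

/-- The zero set of a holomorphic function that does not vanish identically contains, arbitrarily
close to any of its points, a piece of a complex hypersurface. -/
theorem exists_hypersurface_in_zeros {h : E → ℂ} {a : E} {R : ℝ}
    (hh : DifferentiableOn ℂ h (ball a R)) (hha : h a = 0) {z : E} (hz : z ∈ ball a R)
    (hhz : h z ≠ 0) :
    ∃ (Λ : E → E) (p : E) (ℓ : E →L[ℂ] ℂ), ℓ ≠ 0 ∧ (∃ W ∈ 𝓝 p, InjOn Λ W) ∧
      (∀ᶠ y in 𝓝 p, DifferentiableAt ℂ Λ y ∧ Λ y ∈ ball a R) ∧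
      ∀ᶠ w in 𝓝 (0 : E), ℓ w = 0 → h (Λ (p + w)) = 0 := by
  have hR : 0 < R := pos_of_mem_ball hz
  set e := z - a
  have hex : ∃ k, ∃ p ∈ ball a R, h p = 0 ∧ iteratedFDeriv ℂ k h p (fun _ => e) ≠ 0 := by
    obtain ⟨k, hk⟩ := exists_iteratedFDeriv_ne_zero hh hz hhz
    exact ⟨k, a, mem_ball_self hR, hha, hk⟩
  classical
  obtain ⟨p, hp, hhp, hk⟩ := Nat.find_spec hex
  have hmin := fun m (hm : m < Nat.find hex) => Nat.find_min hex hm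
  generalize hkk : Nat.find hex = k at hk hmin
  obtain _ | m := k
  · simp [hhp] at hk
  have hmin' : ∀ q ∈ ball a R, h q = 0 → iteratedFDeriv ℂ m h q (fun _ => e) = 0 := by
    intro q hq hhq
    by_contra hcon
    exact hmin m (Nat.lt_succ_self m) ⟨q, hq, hhq, hcon⟩
  set H : E → ℂ := fun q => iteratedFDeriv ℂ m h q (fun _ => e) with hH
  have hHd : DifferentiableOn ℂ H (ball a R) := by
    have := differentiableOn_iteratedFDeriv isOpen_ball hh m
    intro q hq
    exact ((ContinuousMultilinearMap.apply ℂ (fun _ : Fin m => E) ℂ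
      (fun _ => e)).differentiableAt.comp_differentiableWithinAt q (this q hq))
  have hp0 : p + (0 : ℂ) • e ∈ ball a R := by simpa using hp
  have hcl : Continuous fun t : ℂ => p + t • e := by fun_prop
  have hev : ∀ᶠ t : ℂ in 𝓝 0, p + t • e ∈ ball a R :=
    hcl.continuousAt.preimage_mem_nhds (isOpen_ball.mem_nhds hp0)
  have hHe : fderiv ℂ H p e = iteratedFDeriv ℂ (m + 1) h p (fun _ => e) := by
    have h1 := iteratedDeriv_comp_line isOpen_ball hh p e (m + 1) 0 hp0
    rw [iteratedDeriv_succ, zero_smul, add_zero] at h1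
    rw [← h1]
    have h2 : iteratedDeriv m (fun t : ℂ => h (p + t • e)) =ᶠ[𝓝 0] fun t => H (p + t • e) := by
      filter_upwards [hev] with t ht
      exact iteratedDeriv_comp_line isOpen_ball hh p e m t ht
    rw [h2.deriv_eq]
    have h3 : HasDerivAt (fun t : ℂ => p + t • e) e 0 := by
      simpa using ((hasDerivAt_id (0 : ℂ)).smul_const e).const_add p
    have h4 : HasFDerivAt H (fderiv ℂ H p) (p + (0 : ℂ) • e) := by
      simpa using (hHd.differentiableAt (isOpen_ball.mem_nhds hp)).hasFDerivAt
    exact (h4.comp_hasDerivAt (0 : ℂ) h3).deriv.symm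
  set c := iteratedFDeriv ℂ (m + 1) h p (fun _ => e) with hc
  have hφd : DifferentiableOn ℂ (fun q => c⁻¹ * H q) (ball a R) := hHd.const_mul _
  have hφe : fderiv ℂ (fun q => c⁻¹ * H q) p e = 1 := by
    rw [fderiv_const_mul (hHd.differentiableAt (isOpen_ball.mem_nhds hp)), smul_apply, hHe,
      smul_eq_mul, inv_mul_cancel₀ hk]
  obtain ⟨Λ, hΛp, hΛd, hΛ', -, hΛi, hΛl⟩ := exists_straightening isOpen_ball hφd hp hφe
  set ℓ := fderiv ℂ (fun q => c⁻¹ * H q) p with hℓ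
  have hHp : H p = 0 := hmin' p hp hhp
  refine ⟨Λ, p, ℓ, ?_, hΛi, ?_, ?_⟩
  · intro h0
    rw [h0] at hφe
    simp at hφe
  · refine hΛd.and (hΛ'.continuousAt.preimage_mem_nhds ?_)
    rw [hΛp]
    exact isOpen_ball.mem_nhds hp
  · have hne : ¬ ∀ᶠ t : ℂ in 𝓝 0, h (p + t • e) = 0 := by
      intro h0
      have h1 := iteratedDeriv_comp_line isOpen_ball hh p e (m + 1) 0 hp0
      have h2 : (fun t : ℂ => h (p + t • e)) =ᶠ[𝓝 0] fun _ => 0 := h0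
      rw [h2.iteratedDeriv_eq, zero_smul, add_zero] at h1
      refine hk (h1.symm.trans ?_)
      simp
    filter_upwards [eventually_exists_zero_on_line isOpen_ball hh hp hhp hne
      (hΛl.and (isOpen_ball.mem_nhds hp))] with w hw hℓw
    obtain ⟨t, ⟨ht, htR⟩, ht0⟩ := hw
    have hHz : H (p + w + t • e) = 0 := hmin' _ htR ht0
    have h1 : ℓ (p + w + t • e - p) = t := by
      rw [show p + w + t • e - p = w + t • e by abel, map_add, map_smul, hℓw, hφe]
      simp
    rw [h1, hHz, hHp] at ht
    have h2 : p + w + t • e + (c⁻¹ * 0 - c⁻¹ * 0 - t) • e = p + w := by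
      simp
    rw [h2] at ht
    rw [ht]
    exact ht0

theorem exists_jacobian (hEF : Module.finrank ℂ E = Module.finrank ℂ F) {f : E → F} {U : Set E}
    (hU : IsOpen U) (hf : DifferentiableOn ℂ f U) :
    ∃ h : E → ℂ, DifferentiableOn ℂ h U ∧
      ∀ z, h z = 0 ↔ ¬ Function.Injective (fderiv ℂ f z) := by
  set ι : F ≃L[ℂ] E := ContinuousLinearEquiv.ofFinrankEq hEF.symm
  set b := Module.finBasis ℂ E
  set A : E → E →ₗ[ℂ] E := fun z => ((ι : F →L[ℂ] E).comp (fderiv ℂ f z) : E →L[ℂ] E)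
  refine ⟨fun z => LinearMap.det (A z), ?_, fun z => ?_⟩
  · simp only [← LinearMap.det_toMatrix b, Matrix.det_apply]
    refine DifferentiableOn.fun_sum fun σ _ => DifferentiableOn.const_smul ?_ _
    have hent : ∀ i j, DifferentiableOn ℂ (fun z => LinearMap.toMatrix b b (A z) i j) U := by
      intro i j
      have h1 := differentiableOn_fderiv_apply hU hf (b j)
      have h2 : Differentiable ℂ fun x : F => b.repr (ι x) i :=
        (LinearMap.toContinuousLinearMap
          ((b.coord i).comp (ι : F →ₗ[ℂ] E))).differentiable
      refine (h2.comp_differentiableOn h1).congr fun z _ => ?_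
      simp [A, LinearMap.toMatrix_apply]
    intro z hz
    exact (HasFDerivWithinAt.finsetProd fun i _ =>
      (hent (σ i) i z hz).hasFDerivWithinAt).differentiableWithinAt
  · have h1 : Function.Injective (fderiv ℂ f z) ↔ Function.Injective (A z) := by
      simp [A, Function.Injective]
    rw [h1, ← LinearMap.ker_eq_bot, ← LinearMap.isUnit_iff_ker_eq_bot,
      LinearMap.isUnit_iff_isUnit_det, isUnit_iff_ne_zero, not_not]


/-- Injective holomorphic maps between spaces of dimension `N` have injective derivatives. -/
def HasInjectiveDerivatives (N : ℕ) : Prop :=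
  ∀ (E F : Type) [NormedAddCommGroup E] [NormedSpace ℂ E] [FiniteDimensional ℂ E]
    [NormedAddCommGroup F] [NormedSpace ℂ F] [FiniteDimensional ℂ F],
    Module.finrank ℂ E = N → Module.finrank ℂ F = N →
    ∀ (f : E → F) (U : Set E), IsOpen U → DifferentiableOn ℂ f U → InjOn f U →
      ∀ a ∈ U, Function.Injective (fderiv ℂ f a)

theorem finrank_ker_eq {N : ℕ} (hE : Module.finrank ℂ E = N + 1) {ℓ : E →L[ℂ] ℂ} (hℓ : ℓ ≠ 0) :
    Module.finrank ℂ (LinearMap.ker (ℓ : E →ₗ[ℂ] ℂ)) = N := by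
  have h0 : (ℓ : E →ₗ[ℂ] ℂ) ≠ 0 := by
    intro h
    exact hℓ (ContinuousLinearMap.coe_injective h)
  have := Module.Dual.finrank_ker_add_one_of_ne_zero (f := (ℓ : E →ₗ[ℂ] ℂ)) h0
  omega

theorem HasInjectiveDerivatives.injective_of_ne_zero {N : ℕ} (hN : HasInjectiveDerivatives N)
    (hE : Module.finrank ℂ E = N + 1) (hF : Module.finrank ℂ F = N + 1) {f : E → F} {U : Set E}
    (hU : IsOpen U) (hf : DifferentiableOn ℂ f U) (hinj : InjOn f U) {a : E} (ha : a ∈ U)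
    (hne : fderiv ℂ f a ≠ 0) : Function.Injective (fderiv ℂ f a) := by
  set A := fderiv ℂ f a with hA
  obtain ⟨e, he⟩ : ∃ e, A e ≠ 0 := by
    by_contra! hcon
    exact hne (ContinuousLinearMap.ext hcon)
  obtain ⟨π, hπ⟩ := SeparatingDual.exists_eq_one (R := ℂ) he
  have hfa : HasFDerivAt f A a := (hf.differentiableAt (hU.mem_nhds ha)).hasFDerivAt
  have hφd : DifferentiableOn ℂ (fun z => π (f z)) U := π.differentiable.comp_differentiableOn hf
  have hφ' : fderiv ℂ (fun z => π (f z)) a = π.comp A := (π.hasFDerivAt.comp a hfa).fderiv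
  obtain ⟨Λ, hΛa, hΛd, hΛ', hΛφ, ⟨W, hW, hΛi⟩, -⟩ :=
    exists_straightening (e := e) hU hφd ha (by rw [hφ']; exact hπ)
  rw [hφ'] at hΛφ
  have hΛU : ∀ᶠ y in 𝓝 a, Λ y ∈ U :=
    hΛ'.continuousAt.preimage_mem_nhds (by rw [hΛa]; exact hU.mem_nhds ha)
  obtain ⟨r, hr, hball⟩ := Metric.mem_nhds_iff.1
    (hΛd.and (hΛφ.and (hΛU.and (show ∀ᶠ y in 𝓝 a, y ∈ W from hW))))
  set M := LinearMap.ker ((π.comp A : E →L[ℂ] ℂ) : E →ₗ[ℂ] ℂ) with hM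
  obtain ⟨P, hP⟩ := Submodule.ClosedComplemented.of_finiteDimensional
    (LinearMap.ker (π : F →ₗ[ℂ] ℂ))
  have hcont : Continuous fun w : M => a + (w : E) := by fun_prop
  have hB : ∀ w : M, w ∈ (fun w : M => a + (w : E)) ⁻¹' ball a r → π (f (Λ (a + w))) = π (f a) := by
    intro w hw
    have h1 := (hball hw).2.1
    have h2 : (π.comp A) (w : E) = 0 := w.2
    rw [add_sub_cancel_left, h2] at h1
    exact (sub_eq_zero.1 h1.symm)
  have hshift : ∀ w : M, HasFDerivAt (fun w : M => a + (w : E)) M.subtypeL w := fun w =>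
    M.subtypeL.hasFDerivAt.const_add a
  have hA0 : HasFDerivAt (fun w : M => P (f (Λ (a + (w : E))))) (P.comp (A.comp M.subtypeL)) 0 := by
    have h1 : HasFDerivAt Λ (ContinuousLinearMap.id ℂ E) (a + ((0 : M) : E)) := by
      simpa using hΛ'
    have h2 := h1.comp (0 : M) (hshift 0)
    have h3 : HasFDerivAt f A (Λ (a + ((0 : M) : E))) := by
      simpa [hΛa] using hfa
    exact P.hasFDerivAt.comp (0 : M) (h3.comp (0 : M) h2)
  have key := hN M (LinearMap.ker (π : F →ₗ[ℂ] ℂ))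
    (finrank_ker_eq hE (ℓ := π.comp A) (fun h => by
      have := congrArg (fun L : E →L[ℂ] ℂ => L e) h
      simp [hπ] at this))
    (finrank_ker_eq hF (ℓ := π) (fun h => by simp [h] at hπ))
    (fun w : M => P (f (Λ (a + (w : E))))) ((fun w : M => a + (w : E)) ⁻¹' ball a r)
    (isOpen_ball.preimage hcont)
    (fun w hw => by
      have h1 := hball hw
      have h2 := (hf.differentiableAt (hU.mem_nhds h1.2.2.1)).comp (a + (w : E)) h1.1
      exact ((P.differentiableAt.comp w
        (h2.comp w (hshift w).differentiableAt))).differentiableWithinAt)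
    (fun w hw w' hw' hww' => by
      have h1 : f (Λ (a + w)) = f (Λ (a + w')) := by
        have h2 : π (f (Λ (a + w)) - f (Λ (a + w'))) = 0 := by
          rw [map_sub, hB w hw, hB w' hw', sub_self]
        have h3 := hP ⟨_, h2⟩
        simp only [map_sub] at h3
        have h4 : P (f (Λ (a + w))) - P (f (Λ (a + w'))) = 0 := sub_eq_zero.2 hww'
        rw [h4] at h3
        exact sub_eq_zero.1 (congrArg Subtype.val h3).symm
      have h2 := hinj (hball hw).2.2.1 (hball hw').2.2.1 h1
      have h3 := hΛi (hball hw).2.2.2 (hball hw').2.2.2 h2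
      exact Subtype.ext (add_left_cancel h3))
    0 (by simpa using hr)
  rw [hA0.fderiv] at key
  intro x y hxy
  have hx : A (x - y) = 0 := by rw [map_sub]; exact sub_eq_zero.2 hxy
  have hmem : x - y ∈ M := by
    change π (A (x - y)) = 0
    rw [hx, map_zero]
  have h0 : (⟨x - y, hmem⟩ : M) = 0 := by
    refine key ?_
    simp only [ContinuousLinearMap.comp_apply, Submodule.subtypeL_apply, hx, map_zero]
  exact sub_eq_zero.1 (congrArg Subtype.val h0)

omit [FiniteDimensional ℂ E] [FiniteDimensional ℂ F] in
theorem eq_of_fderiv_eq_zero {f : E → F} {a : E} {R : ℝ}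
    (hd : ∀ z ∈ ball a R, HasFDerivAt f (0 : E →L[ℂ] F) z) {x y : E} (hx : x ∈ ball a R)
    (hy : y ∈ ball a R) : f x = f y := by
  refine (convex_ball a R).is_const_of_fderivWithin_eq_zero (𝕜 := ℂ)
    (fun z hz => (hd z hz).differentiableAt.differentiableWithinAt) (fun z hz => ?_) hx hy
  exact ((hd z hz).hasFDerivWithinAt).fderivWithin (isOpen_ball.uniqueDiffWithinAt hz)

theorem hasInjectiveDerivatives_zero : HasInjectiveDerivatives 0 := by
  intro E F _ _ _ _ _ _ hE _ f U _ _ _ a _ x y _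
  have := Module.finrank_zero_iff.1 hE
  exact Subsingleton.elim x y

theorem hasInjectiveDerivatives_one : HasInjectiveDerivatives 1 := by
  intro E F _ _ _ _ _ _ hE hF f U hU hf hinj a ha
  refine hasInjectiveDerivatives_zero.injective_of_ne_zero hE hF hU hf hinj ha fun hA => ?_
  set ι : ℂ ≃L[ℂ] E := ContinuousLinearEquiv.ofFinrankEq (by simp [hE])
  set κ : F ≃L[ℂ] ℂ := ContinuousLinearEquiv.ofFinrankEq (by simp [hF])
  have hc : Continuous fun t : ℂ => a + ι t := by fun_prop
  have hV : (fun t : ℂ => a + ι t) ⁻¹' U ∈ 𝓝 (0 : ℂ) :=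
    hc.continuousAt.preimage_mem_nhds (by simpa using hU.mem_nhds ha)
  have hd : ∀ t, a + ι t ∈ U → HasFDerivAt (fun t : ℂ => κ (f (a + ι t)))
      ((κ : F →L[ℂ] ℂ).comp ((fderiv ℂ f (a + ι t)).comp (ι : ℂ →L[ℂ] E))) t := fun t ht =>
    κ.hasFDerivAt.comp t ((hf.differentiableAt (hU.mem_nhds ht)).hasFDerivAt.comp t
      (ι.hasFDerivAt.const_add a))
  refine deriv_ne_zero_of_eventually_injOn (f := fun t : ℂ => κ (f (a + ι t))) hV ?_ ?_ ?_
  · exact analyticAt_of_eventually_differentiableAt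
      (mem_of_superset hV fun t ht => (hd t ht).differentiableAt)
  · intro s hs t ht hst
    exact ι.injective (add_left_cancel (hinj hs ht (κ.injective hst)))
  · have h0 := (hd 0 (by simpa using ha)).hasDerivAt.deriv
    simp only [map_zero, add_zero, hA] at h0
    rw [h0]
    simp

theorem HasInjectiveDerivatives.succ {N : ℕ} (hN : HasInjectiveDerivatives (N + 1)) :
    HasInjectiveDerivatives (N + 2) := by
  intro E F _ _ _ _ _ _ hE hF f U hU hf hinj a ha
  refine hN.injective_of_ne_zero hE hF hU hf hinj ha fun hA => ?_
  have hnt : Nontrivial E := Module.nontrivial_of_finrank_pos (R := ℂ) (by omega)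
  obtain ⟨h, hhd, hh⟩ := exists_jacobian (hE.trans hF.symm) hU hf
  obtain ⟨R, hR, hball⟩ := Metric.isOpen_iff.1 hU a ha
  have hzero : ∀ z ∈ U, h z = 0 → HasFDerivAt f (0 : E →L[ℂ] F) z := by
    intro z hz hhz
    have h1 : fderiv ℂ f z = 0 := by
      by_contra hne
      exact (hh z).1 hhz (hN.injective_of_ne_zero hE hF hU hf hinj hz hne)
    rw [← h1]
    exact (hf.differentiableAt (hU.mem_nhds hz)).hasFDerivAt
  have hha : h a = 0 := by
    rw [hh, hA]
    intro hcon
    obtain ⟨x, y, hxy⟩ := hnt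
    exact hxy (hcon (by simp))
  by_cases hz : ∃ z ∈ ball a R, h z ≠ 0
  · obtain ⟨z, hzR, hz⟩ := hz
    obtain ⟨Λ, p, ℓ, hℓ, ⟨W, hW, hΛi⟩, hΛd, hΛh⟩ :=
      exists_hypersurface_in_zeros (hhd.mono hball) hha hzR hz
    set M := LinearMap.ker (ℓ : E →ₗ[ℂ] ℂ) with hM
    have hMrank : Module.finrank ℂ M = N + 1 := finrank_ker_eq hE hℓ
    have hMnt : Nontrivial M := Module.nontrivial_of_finrank_pos (R := ℂ) (by omega)
    have hcont : Continuous fun w : M => p + (w : E) := by fun_prop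
    have htend : Tendsto (fun w : M => p + (w : E)) (𝓝 0) (𝓝 p) := by
      simpa using hcont.tendsto 0
    have htend0 : Tendsto (fun w : M => (w : E)) (𝓝 0) (𝓝 0) := by
      simpa using continuous_subtype_val.tendsto (0 : M)
    obtain ⟨r, hr, hrM⟩ := Metric.mem_nhds_iff.1 ((htend.eventually hΛd).and
      ((htend0.eventually hΛh).and (htend.eventually (show ∀ᶠ y in 𝓝 p, y ∈ W from hW))))
    obtain ⟨w, hw0, hwr⟩ : ∃ w : M, w ≠ 0 ∧ w ∈ ball (0 : M) r := by
      obtain ⟨v, hv⟩ := exists_ne (0 : M)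
      have := NormedField.exists_norm_lt ℂ (show 0 < r / ‖v‖ by positivity)
      obtain ⟨c, hc0, hc⟩ := this
      refine ⟨c • v, smul_ne_zero (norm_pos_iff.1 hc0) hv, ?_⟩
      rw [mem_ball_zero_iff, norm_smul]
      exact (lt_div_iff₀ (norm_pos_iff.2 hv)).1 hc
    have hconst := eq_of_fderiv_eq_zero (f := fun w : M => f (Λ (p + (w : E)))) (a := 0) (R := r)
      (fun w hw => by
        obtain ⟨⟨h1, h2⟩, h3, -⟩ := hrM hw
        have h4 := hzero _ (hball h2) (h3 w.2)
        have h5 := h1.hasFDerivAt.comp w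
          (show HasFDerivAt (fun w : M => p + (w : E)) M.subtypeL w from
            M.subtypeL.hasFDerivAt.const_add p)
        exact (h4.comp w h5).congr_fderiv (by simp)) hwr (mem_ball_self hr)
    obtain ⟨⟨-, h2⟩, -, h3⟩ := hrM hwr
    obtain ⟨⟨-, h2'⟩, -, h3'⟩ := hrM (mem_ball_self hr)
    have h4 := hΛi h3 h3' (hinj (hball h2) (hball h2') hconst)
    exact hw0 (Subtype.ext (add_left_cancel h4))
  · push Not at hz
    obtain ⟨x, hx0, hxr⟩ : ∃ x : E, x ≠ a ∧ x ∈ ball a R := by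
      have h1 : (ball a R \ {a}).Nonempty := by
        have := (ball_mem_nhds a hR)
        have h2 : ∀ᶠ x in 𝓝[≠] a, x ∈ ball a R ∧ x ≠ a :=
          (eventually_nhdsWithin_of_eventually_nhds this).and self_mem_nhdsWithin
        have hne : (𝓝[≠] a).NeBot := Module.punctured_nhds_neBot ℂ E a
        exact h2.exists
      exact ⟨h1.some, h1.some_mem.2, h1.some_mem.1⟩
    have := eq_of_fderiv_eq_zero (fun z hz' => hzero z (hball hz') (hz z hz')) hxr
      (mem_ball_self hR)
    exact hx0 (hinj (hball hxr) ha this)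

theorem hasInjectiveDerivatives (N : ℕ) : HasInjectiveDerivatives N := by
  match N with
  | 0 => exact hasInjectiveDerivatives_zero
  | 1 => exact hasInjectiveDerivatives_one
  | N + 2 => exact (hasInjectiveDerivatives (N + 1)).succ

/-- An injective holomorphic map between equidimensional spaces is open with holomorphic
inverse. -/
theorem exists_holomorphic_inverse {f : E → E} {U : Set E} (hU : IsOpen U)
    (hf : DifferentiableOn ℂ f U) (hinj : InjOn f U) :
    (∀ V ⊆ U, IsOpen V → IsOpen (f '' V)) ∧
      DifferentiableOn ℂ (Function.invFunOn f U) (f '' U) := by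
  have hequiv : ∀ a ∈ U, ∃ A : E ≃L[ℂ] E, HasStrictFDerivAt f (A : E →L[ℂ] E) a := by
    intro a ha
    have h1 := hasInjectiveDerivatives (Module.finrank ℂ E) E E rfl rfl f U hU hf hinj a ha
    refine ⟨(LinearEquiv.ofInjectiveEndo _ h1).toContinuousLinearEquiv, ?_⟩
    have h2 : ContDiffAt ℂ 1 f a :=
      (contDiffOn_of_differentiableOn hU 1 hf).contDiffAt (hU.mem_nhds ha)
    have h3 := h2.hasStrictFDerivAt one_ne_zero
    convert h3 using 1
    ext x
    simp
  have hopen : ∀ V ⊆ U, IsOpen V → IsOpen (f '' V) := by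
    intro V hVU hV
    rw [isOpen_iff_mem_nhds]
    rintro _ ⟨a, ha, rfl⟩
    obtain ⟨A, hA⟩ := hequiv a (hVU ha)
    rw [← hA.map_nhds_eq_of_equiv]
    exact image_mem_map (hV.mem_nhds ha)
  refine ⟨hopen, ?_⟩
  rintro _ ⟨a, ha, rfl⟩
  obtain ⟨A, hA⟩ := hequiv a ha
  have hleft : ∀ x ∈ U, Function.invFunOn f U (f x) = x := fun x hx => hinj.leftInvOn_invFunOn hx
  have hcont : ContinuousAt (Function.invFunOn f U) (f a) := by
    rw [ContinuousAt, hleft a ha]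
    intro S hS
    have h1 : f '' (interior S ∩ U) ∈ 𝓝 (f a) :=
      (hopen _ inter_subset_right (isOpen_interior.inter hU)).mem_nhds
        (mem_image_of_mem f ⟨mem_interior_iff_mem_nhds.2 hS, ha⟩)
    refine mem_map.2 (mem_of_superset h1 ?_)
    rintro _ ⟨x, hx, rfl⟩
    rw [mem_preimage, hleft x hx.2]
    exact interior_subset hx.1
  have hd : HasFDerivAt f (A : E →L[ℂ] E) (Function.invFunOn f U (f a)) := by
    rw [hleft a ha]
    exact hA.hasFDerivAt
  refine (hd.of_local_left_inverse hcont ?_).differentiableAt.differentiableWithinAt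
  filter_upwards [(hopen U subset_rfl hU).mem_nhds (mem_image_of_mem f ha)] with y hy
  exact Function.invFunOn_eq hy

end InjectiveMaps

section Isotopies

variable {n : ℕ}

/-- Uniform approximability on `K` by holomorphic automorphisms. -/
def IsApproximable (K : Set (EuclideanSpace ℂ (Fin n)))
    (f : EuclideanSpace ℂ (Fin n) → EuclideanSpace ℂ (Fin n)) : Prop :=
  ∀ ε > 0, ∃ Ψ, IsHolomorphicAutomorphism Ψ ∧ ∀ z ∈ K, ‖Ψ z - f z‖ < ε

theorem IsApproximable.of_comp {K : Set (EuclideanSpace ℂ (Fin n))}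
    {f g : EuclideanSpace ℂ (Fin n) → EuclideanSpace ℂ (Fin n)} (hK : IsCompact (f '' K))
    (hf : IsApproximable K f)
    (h : ∀ ε > 0, ∃ A, IsHolomorphicAutomorphism A ∧ ∀ z ∈ K, ‖A (f z) - g z‖ < ε) :
    IsApproximable K g := by
  intro ε hε
  obtain ⟨A, hA, hAg⟩ := h (ε / 2) (by positivity)
  have hu := hK.uniformContinuousAt_of_continuousAt A (fun y _ => hA.1.continuous.continuousAt)
    (Metric.dist_mem_uniformity (show 0 < ε / 2 by positivity))
  obtain ⟨η, hη, hηu⟩ := Metric.mem_uniformity_dist.1 hu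
  obtain ⟨G, hG, hGf⟩ := hf η hη
  refine ⟨_, hA.comp hG, fun z hz => ?_⟩
  have h1 : dist (A (f z)) (A (G z)) < ε / 2 := by
    refine hηu (a := f z) (b := G z) ?_ (mem_image_of_mem f hz)
    rw [dist_comm, dist_eq_norm]
    exact hGf z hz
  have h2 := hAg z hz
  rw [dist_comm, dist_eq_norm] at h1
  calc ‖A (G z) - g z‖ = ‖(A (G z) - A (f z)) + (A (f z) - g z)‖ := by rw [sub_add_sub_cancel]
    _ ≤ ‖A (G z) - A (f z)‖ + ‖A (f z) - g z‖ := norm_add_le _ _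
    _ < ε := by linarith

/-- Along an isotopy with polynomially convex images, approximability is locally constant. -/
theorem eventually_isApproximable_iff (hn : 2 ≤ n) {K Ω : Set (EuclideanSpace ℂ (Fin n))}
    (hK : IsCompact K) (hΩ : IsOpen Ω) (hKΩ : K ⊆ Ω)
    {Φ : ℝ → EuclideanSpace ℂ (Fin n) → EuclideanSpace ℂ (Fin n)} {I : Set ℝ}
    (hcont : ContinuousOn (fun p : ℝ × EuclideanSpace ℂ (Fin n) => Φ p.1 p.2) (I ×ˢ Ω))
    (hinj : ∀ t ∈ I, InjOn (Φ t) Ω) (hhol : ∀ t ∈ I, DifferentiableOn ℂ (Φ t) Ω)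
    {s : ℝ} (hs : s ∈ I) (hpc : IsPolynomiallyConvex (Φ s '' K)) :
    ∀ᶠ t in 𝓝[I] s, IsApproximable K (Φ s) ↔ IsApproximable K (Φ t) := by
  have himg : ∀ t ∈ I, IsCompact (Φ t '' K) := fun t ht =>
    hK.image_of_continuousOn ((hhol t ht).continuousOn.mono hKΩ)
  obtain ⟨C, hC, hKC, hCΩ⟩ := exists_compact_between hK hΩ hKΩ
  have hiΩ : interior C ⊆ Ω := interior_subset.trans hCΩ
  obtain ⟨hopen, hinv⟩ := exists_holomorphic_inverse isOpen_interior
    ((hhol s hs).mono hiΩ) ((hinj s hs).mono hiΩ)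
  set g := Function.invFunOn (Φ s) (interior C)
  have hg : ∀ x ∈ interior C, g (Φ s x) = x :=
    fun x hx => ((hinj s hs).mono hiΩ).leftInvOn_invFunOn hx
  obtain ⟨δ, hδ, hnear⟩ := exists_automorphism_near_identity hn (himg s hs) hpc
    (hopen _ subset_rfl isOpen_interior) (image_mono hKC)
  obtain ⟨v, hv, hunif⟩ : ∃ v ∈ 𝓝[I] s, ∀ t ∈ v, ∀ x ∈ C, dist (Φ t x) (Φ s x) < δ :=
    hC.mem_uniformity_of_prod (f := Φ) (hcont.mono (prod_mono_right hCΩ)) hs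
      (Metric.dist_mem_uniformity hδ)
  filter_upwards [hv, self_mem_nhdsWithin] with t htv htI
  have ht := hunif t htv
  have hF := hnear (fun y => Φ t (g y))
    ((hhol t htI).comp hinv (by
      rintro _ ⟨x, hx, rfl⟩
      rw [hg x hx]
      exact hiΩ hx))
    (by
      rintro _ ⟨x, hx, rfl⟩
      rw [hg x hx, ← dist_eq_norm]
      exact (ht x (interior_subset hx)).le)
  constructor
  · intro h
    refine h.of_comp (himg s hs) fun ε hε => ?_
    obtain ⟨A, hA, hAF⟩ := (hF ε hε).1
    refine ⟨A, hA, fun z hz => ?_⟩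
    have := hAF _ (mem_image_of_mem _ hz)
    rwa [hg z (hKC hz)] at this
  · intro h
    refine h.of_comp (himg t htI) fun ε hε => ?_
    obtain ⟨A, hA, hAF⟩ := (hF ε hε).2
    refine ⟨A, hA, fun z hz => ?_⟩
    have := hAF _ (mem_image_of_mem _ hz)
    rwa [hg z (hKC hz)] at this

end Isotopies

end AndersenLempert

/-- Andersén–Lempert theorem for isotopies of compact polynomially convex sets: if an isotopy
of injective holomorphic maps starting at the identity keeps the images of a compact
polynomially convex set K polynomially convex, then the time-one map can be approximated
uniformly on K by holomorphic automorphisms of ℂⁿ. -/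
theorem automorphism_approximation_on_polynomially_convex_isotopy
    (n : ℕ) (hn : 2 ≤ n)
    (K : Set (EuclideanSpace ℂ (Fin n))) (hK : IsCompact K) (hKpc : IsPolynomiallyConvex K)
    (Ω : Set (EuclideanSpace ℂ (Fin n))) (hΩopen : IsOpen Ω) (hKΩ : K ⊆ Ω)
    (Φ : ℝ → EuclideanSpace ℂ (Fin n) → EuclideanSpace ℂ (Fin n))
    (hcont : ContinuousOn (fun p : ℝ × EuclideanSpace ℂ (Fin n) => Φ p.1 p.2)
      (Set.Icc (0 : ℝ) 1 ×ˢ Ω))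
    (hinj : ∀ t ∈ Set.Icc (0 : ℝ) 1, Set.InjOn (Φ t) Ω)
    (hhol : ∀ t ∈ Set.Icc (0 : ℝ) 1, DifferentiableOn ℂ (Φ t) Ω)
    (h0 : ∀ z ∈ Ω, Φ 0 z = z)
    (hKt : ∀ t ∈ Set.Icc (0 : ℝ) 1, IsPolynomiallyConvex (Φ t '' K))
    (ε : ℝ) (hε : 0 < ε) :
    ∃ Ψ : EuclideanSpace ℂ (Fin n) → EuclideanSpace ℂ (Fin n),
      IsHolomorphicAutomorphism Ψ ∧ ∀ z ∈ K, ‖Ψ z - Φ 1 z‖ < ε := by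
  have hiff : AndersenLempert.IsApproximable K (Φ 0) ↔ AndersenLempert.IsApproximable K (Φ 1) :=
    isPreconnected_Icc.induction₂
      (fun s t : ℝ =>
        AndersenLempert.IsApproximable K (Φ s) ↔ AndersenLempert.IsApproximable K (Φ t))
      (fun s hs => AndersenLempert.eventually_isApproximable_iff hn hK hΩopen hKΩ hcont hinj hhol
        hs (hKt s hs))
      (fun _ _ _ _ _ _ h₁ h₂ => h₁.trans h₂) (fun _ _ _ _ h => h.symm)
      (Set.left_mem_Icc.2 zero_le_one) (Set.right_mem_Icc.2 zero_le_one)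
  refine hiff.1 (fun η hη => ⟨_, AndersenLempert.isHolomorphicAutomorphism_id, fun z hz => ?_⟩) ε hε
  rwa [h0 z (hKΩ hz), sub_self, norm_zero]
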